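/- arXiv:2301.13084 — 2 statements merged into one kernel-verified Lean document; each statement's English description precedes it below -/
import Mathlib

section
/- Let (R,m) be an excellent local ring of prime characteristic p > 0 such that R̂ is reduced and equidimensional. Then there exists a balanced big Cohen–Macaulay R-algebra B such that I* = I^B (:= IB ∩ R) for all ideals I ⊆ R; in particular, the tight Hilbert coefficients of any m-primary ideal coincide with its BCM Hilbert coefficients with respect to B, and B satisfies condition (†). -/
open IsLocalRing

universe u

section BasicDefs

variable (R : Type*) [CommRing R]

/-- The length of a module, i.e. the Krull dimension of its lattice of submodules. -/
noncomputable def moduleLength (M : Type*) [AddCommGroup M] [Module R M] : WithBot ℕ∞ :=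
  Order.krullDim (Submodule R M)

/-- A system of parameters of a Noetherian local ring: `d` elements generating an
ideal whose radical is the maximal ideal, where `d` is the Krull dimension. -/
def IsSOP [IsLocalRing R] {d : ℕ} (x : Fin d → R) : Prop :=
  ringKrullDim R = (d : WithBot ℕ∞) ∧
    (Ideal.span (Set.range x)).radical = maximalIdeal R

/-- A parameter ideal is an ideal generated by a system of parameters. -/
def IsParameterIdeal [IsLocalRing R] (Q : Ideal R) : Prop :=
  ∃ (d : ℕ) (x : Fin d → R), IsSOP R x ∧ Q = Ideal.span (Set.range x)

/-- `f : R →+* B` makes `B` a balanced big Cohen-Macaulay `R`-algebra if every system of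
parameters of `R` maps to a regular sequence on `B` and `m·B ≠ B`. -/
def IsBalancedBigCMHom [IsLocalRing R] {B : Type*} [CommRing B] (f : R →+* B) : Prop :=
  (∀ (d : ℕ) (x : Fin d → R), IsSOP R x →
      RingTheory.Sequence.IsRegular B (List.ofFn fun i => f (x i))) ∧
    (maximalIdeal R).map f ≠ ⊤

/-- A balanced big Cohen-Macaulay algebra. -/
def IsBalancedBigCM [IsLocalRing R] (B : Type*) [CommRing B] [Algebra R B] : Prop :=
  IsBalancedBigCMHom R (algebraMap R B)

/-- The integral closure of an ideal `I`, as a set: all `x` satisfying an equation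
`x^n + a₁ x^{n-1} + ⋯ + aₙ = 0` with `aₖ ∈ I^k`. -/
def intClSet (I : Ideal R) : Set R :=
  { x | ∃ n : ℕ, 0 < n ∧ ∃ a : ℕ → R,
      (∀ k ∈ Finset.Icc 1 n, a k ∈ I ^ k) ∧
      x ^ n + ∑ k ∈ Finset.Icc 1 n, a k * x ^ (n - k) = 0 }

/-- `I^B := IB ∩ R`, the contraction of the extension of `I` along `f : R →+* B`. -/
def contractedExt {B : Type*} [CommRing B] (f : R →+* B) (I : Ideal R) : Ideal R :=
  (I.map f).comap f

/-- Condition (†): `I^B ⊆ \bar I` for every m-primary ideal `I`. -/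
def SatisfiesDagger [IsLocalRing R] {B : Type*} [CommRing B] (f : R →+* B) : Prop :=
  ∀ I : Ideal R, I.radical = maximalIdeal R →
    (contractedExt R f I : Set R) ⊆ intClSet R I

/-- `e` is the family of Hilbert coefficients of the filtration `J` (in dimension `d`):
for `n ≫ 0`, `ℓ(R/J (n+1)) = ∑_{i≤d} (-1)^i e i * choose (n+d-i) (d-i)`. -/
def HasHilbertSeries (d : ℕ) (J : ℕ → Ideal R) (e : ℕ → ℤ) : Prop :=
  ∃ N : ℕ, ∀ n ≥ N, ∃ m : ℕ,
    moduleLength R (R ⧸ J (n + 1)) = (m : WithBot ℕ∞) ∧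
    (m : ℤ) = ∑ i ∈ Finset.range (d + 1),
      (-1) ^ i * e i * ((n + d - i).choose (d - i) : ℤ)

/-- Module version of `HasHilbertSeries`, for the `J`-adic filtration of a module `M`. -/
def HasHilbertSeriesMod (M : Type*) [AddCommGroup M] [Module R M] (d : ℕ)
    (J : Ideal R) (e : ℕ → ℤ) : Prop :=
  ∃ N : ℕ, ∀ n ≥ N, ∃ m : ℕ,
    moduleLength R (M ⧸ (J ^ (n + 1) • (⊤ : Submodule R M))) = (m : WithBot ℕ∞) ∧
    (m : ℤ) = ∑ i ∈ Finset.range (d + 1),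
      (-1) ^ i * e i * ((n + d - i).choose (d - i) : ℤ)


/-- The limit closure `(x₁,…,x_d)^{lim} = ⋃ₜ ((x₁^{t+1},…,x_d^{t+1}) : (x₁⋯x_d)^t)`. -/
def limitClosure {d : ℕ} (x : Fin d → R) : Ideal R :=
  ⨆ t : ℕ, (Ideal.span (Set.range fun i => x i ^ (t + 1))).colon
    (Ideal.span {(∏ i, x i) ^ t})

/-- A ring is equidimensional if `dim (R/P) = dim R` for every minimal prime `P`. -/
def IsEquidimensional : Prop :=
  ∀ P ∈ minimalPrimes R, ringKrullDim (R ⧸ P) = ringKrullDim R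

/-- Depth at least `n`: there is a regular sequence of length `n` in the
(Jacobson) radical, i.e. in the maximal ideal when `R` is local. -/
def HasDepthGE (n : ℕ) : Prop :=
  ∃ rs : List R, rs.length = n ∧ (∀ r ∈ rs, r ∈ (⊥ : Ideal R).jacobson) ∧
    RingTheory.Sequence.IsRegular R rs

/-- A Cohen-Macaulay (Noetherian) local ring: depth = dimension. -/
def IsCohenMacaulayLocalRing : Prop :=
  IsLocalRing R ∧ IsNoetherianRing R ∧
    ∃ d : ℕ, ringKrullDim R = (d : WithBot ℕ∞) ∧ HasDepthGE R d

/-- Serre's condition S₂: for every prime `P`,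
`depth R_P ≥ min 2 (dim R_P)`. -/
def SerreS2 : Prop :=
  ∀ (P : Ideal R) (hP : P.IsPrime) (n : ℕ),
    (n : WithBot ℕ∞) ≤ min 2 (ringKrullDim (Localization.AtPrime P)) →
    HasDepthGE (Localization.AtPrime P) n

/-- A regular local ring: a Noetherian local ring whose maximal ideal is generated
by `dim R` elements. -/
def IsRegularLocal : Prop :=
  IsLocalRing R ∧ IsNoetherianRing R ∧ ∃ (d : ℕ) (x : Fin d → R),
    ringKrullDim R = (d : WithBot ℕ∞) ∧
      Ideal.span (Set.range x) = (⊥ : Ideal R).jacobson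

/-- A regular (not necessarily local) ring: Noetherian and all localizations at
primes are regular local rings. -/
def IsRegularRing' : Prop :=
  IsNoetherianRing R ∧
    ∀ (P : Ideal R) (hP : P.IsPrime), IsRegularLocal (Localization.AtPrime P)

/-- The tight closure of an ideal `I` in characteristic `p`, as a set. -/
def tightClSet (p : ℕ) (I : Ideal R) : Set R :=
  { x | ∃ c : R, (∀ P ∈ minimalPrimes R, c ∉ P) ∧
      ∃ E : ℕ, ∀ e ≥ E, c * x ^ p ^ e ∈ Ideal.span ((fun a => a ^ p ^ e) '' (I : Set R)) }

/-- F-rationality: every parameter ideal is tightly closed. -/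
def IsFRational [IsLocalRing R] (p : ℕ) : Prop :=
  ∀ Q : Ideal R, IsParameterIdeal R Q → tightClSet R p Q ⊆ (Q : Set R)

end BasicDefs

section Excellence

open TensorProduct

/-- Geometrically regular `k`-algebra (for `k` a field): `L ⊗[k] A` is regular
for every finite field extension `L` of `k`. -/
def IsGeometricallyRegular (k : Type u) (A : Type u) [CommRing k] [CommRing A]
    [Algebra k A] : Prop :=
  ∀ (L : Type u) [Field L] [Algebra k L], Module.Finite k L → IsRegularRing' (L ⊗[k] A)

/-- `R` is a G-ring: for every prime `p`, the fibers of
`R_p → (R_p)^∧` are geometrically regular. -/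
def IsGRing (R : Type u) [CommRing R] : Prop :=
  ∀ (p : Ideal R) (hp : p.IsPrime) (q : Ideal (Localization.AtPrime p)) (hq : q.IsPrime),
    IsGeometricallyRegular
      (ResidueField (Localization.AtPrime q))
      ((ResidueField (Localization.AtPrime q))
        ⊗[Localization.AtPrime p]
        AdicCompletion (maximalIdeal (Localization.AtPrime p)) (Localization.AtPrime p))

/-- `R` is J-2: the regular locus of every finitely generated `R`-algebra is open. -/
def IsJ2 (R : Type u) [CommRing R] : Prop :=
  ∀ (A : Type u) [CommRing A] [Algebra R A], Algebra.FiniteType R A →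
    IsOpen { P : PrimeSpectrum A | IsRegularLocal (Localization.AtPrime P.asIdeal) }

/-- A catenary ring: any two saturated chains of primes with the same endpoints
have the same length. -/
def IsCatenary (A : Type*) [CommRing A] : Prop :=
  ∀ c₁ c₂ : LTSeries (PrimeSpectrum A),
    c₁.head = c₂.head → c₁.last = c₂.last →
    (∀ i : Fin c₁.length, c₁.toFun i.castSucc ⋖ c₁.toFun i.succ) →
    (∀ i : Fin c₂.length, c₂.toFun i.castSucc ⋖ c₂.toFun i.succ) →
    c₁.length = c₂.length

/-- Universally catenary: every finitely generated `R`-algebra is catenary. -/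
def IsUniversallyCatenary (R : Type u) [CommRing R] : Prop :=
  ∀ (A : Type u) [CommRing A] [Algebra R A], Algebra.FiniteType R A → IsCatenary A

/-- An excellent ring: Noetherian, a G-ring, J-2 and universally catenary. -/
def IsExcellentRing (R : Type u) [CommRing R] : Prop :=
  IsNoetherianRing R ∧ IsGRing R ∧ IsJ2 R ∧ IsUniversallyCatenary R

end Excellence

/-- `R` is BCM_B-rational (in dimension `d`): Cohen-Macaulay and the natural map
`H^d_m(R) → H^d_m(B)` is injective. -/
def IsBCMRational (R : Type u) [CommRing R] [IsLocalRing R]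
    (B : Type u) [CommRing B] [Algebra R B] (d : ℕ) : Prop :=
  IsCohenMacaulayLocalRing R ∧
    Function.Injective
      ((localCohomology (maximalIdeal R) d).map (ModuleCat.ofHom (Algebra.linearMap R B)))


section
/-! ### The big Cohen-Macaulay algebra as a localized product of Frobenius twists -/

namespace TCB

section construction

lemma pi_span {R : Type*} [CommRing R] {ι : Type*} [Finite ι] (s : Set ι) (a : ι → ℕ → R)
    (v : ℕ → R) :
    v ∈ Ideal.span (a '' s) ↔ ∀ e, v e ∈ Ideal.span ((fun j => a j e) '' s) := by
  classical
  have := Fintype.ofFinite ι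
  rw [Set.image_eq_range]
  simp_rw [Set.image_eq_range, Ideal.mem_span_range_iff_exists_fun]
  constructor
  · rintro ⟨c, hc⟩ e
    refine ⟨fun j => c j e, ?_⟩
    rw [← hc]; simp [Finset.sum_apply]
  · intro h
    choose c hc using h
    refine ⟨fun j e => c e j, ?_⟩
    ext e
    rw [← hc e]; simp [Finset.sum_apply]

variable (R : Type u) [CommRing R]

/-- The complement of the union of the minimal primes. -/
def circ : Submonoid R where
  carrier := {c | ∀ P ∈ minimalPrimes R, c ∉ P}
  mul_mem' := by
    intro a b ha hb P hP hab
    have := Ideal.IsMinimalPrime.isPrime hP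
    exact (this.mem_or_mem hab).elim (ha P hP) (hb P hP)
  one_mem' := by
    intro P hP h1
    have := Ideal.IsMinimalPrime.isPrime hP
    exact this.ne_top ((Ideal.eq_top_iff_one _).2 h1)

lemma mem_circ (c : R) : c ∈ circ R ↔ ∀ P ∈ minimalPrimes R, c ∉ P := Iff.rfl

/-- Sequences which are eventually constant with value in `circ R`. -/
def seqS : Submonoid (ℕ → R) where
  carrier := {s | ∃ c ∈ circ R, ∃ E, ∀ e ≥ E, s e = c}
  mul_mem' := by
    rintro a b ⟨c, hc, E, h⟩ ⟨c', hc', E', h'⟩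
    exact ⟨c * c', mul_mem hc hc', max E E', fun e he => by
      simp [h e (le_of_max_le_left he), h' e (le_of_max_le_right he)]⟩
  one_mem' := ⟨1, one_mem _, 0, fun _ _ => rfl⟩

/-- The target ring. -/
abbrev bigB : Type u := Localization (seqS R)

variable (p : ℕ) [Fact p.Prime] [CharP R p]

/-- `x ↦ (x^{p^e})_e`. -/
noncomputable def frobSeq : R →+* (ℕ → R) := RingHom.pi fun e => iterateFrobenius R p e

lemma frobSeq_apply (x : R) (e : ℕ) : frobSeq R p x e = x ^ p ^ e := by
  change iterateFrobenius R p e x = _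
  rw [iterateFrobenius_def]

/-- The structure map. -/
noncomputable def bigF : R →+* bigB R := (algebraMap (ℕ → R) (bigB R)).comp (frobSeq R p)

lemma alg_mem_map_iff (J : Ideal (ℕ → R)) (v : ℕ → R) :
    algebraMap (ℕ → R) (bigB R) v ∈ J.map (algebraMap (ℕ → R) (bigB R)) ↔
      ∃ s ∈ seqS R, s * v ∈ J := by
  rw [IsLocalization.algebraMap_mem_map_algebraMap_iff (seqS R)]

lemma span_pow_image (I : Ideal R) (s : Finset R) (hs : Ideal.span (s : Set R) = I) (e : ℕ) :
    Ideal.span ((fun a => a ^ p ^ e) '' (I : Set R)) =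
      Ideal.span ((fun a => a ^ p ^ e) '' (s : Set R)) := by
  have h : (fun a : R => a ^ p ^ e) = iterateFrobenius R p e := by
    ext a; simp [iterateFrobenius_def]
  rw [h, ← Ideal.map_span, ← Ideal.map_span, hs, Ideal.span_eq]

lemma mem_map_bigF_iff (s : Finset R) (v : ℕ → R) :
    algebraMap (ℕ → R) (bigB R) v ∈ (Ideal.span (s : Set R)).map (bigF R p) ↔
      ∃ c ∈ circ R, ∃ E : ℕ, ∀ e ≥ E,
        c * v e ∈ Ideal.span ((fun a => a ^ p ^ e) '' (s : Set R)) := by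
  classical
  have key : ∀ w : ℕ → R, w ∈ (Ideal.span (s : Set R)).map (frobSeq R p) ↔
      ∀ e, w e ∈ Ideal.span ((fun a => a ^ p ^ e) '' (s : Set R)) := by
    intro w
    have h1 : (frobSeq R p) '' (s : Set R) =
        (fun j : (s : Set R) => frobSeq R p j) '' Set.univ := by
      ext; simp
    rw [Ideal.map_span, h1, pi_span]
    refine forall_congr' fun e => ?_
    have h2 : (fun j : (s : Set R) => frobSeq R p j e) '' Set.univ =
        (fun a => a ^ p ^ e) '' (s : Set R) := by
      ext; simp [frobSeq_apply]
    rw [h2]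
  rw [bigF, ← Ideal.map_map, alg_mem_map_iff]
  constructor
  · rintro ⟨t, ⟨c, hc, E, hE⟩, ht⟩
    refine ⟨c, hc, E, fun e he => ?_⟩
    have := (key _).1 ht e
    rwa [Pi.mul_apply, hE e he] at this
  · rintro ⟨c, hc, E, hE⟩
    refine ⟨fun e => if E ≤ e then c else 0, ⟨c, hc, E, fun e he => by simp [he]⟩, ?_⟩
    rw [key]
    intro e
    by_cases he : E ≤ e
    · simpa [he] using hE e he
    · simp [he]

lemma tight_eq [IsNoetherianRing R] (I : Ideal R) :
    tightClSet R p I = (contractedExt R (bigF R p) I : Set R) := by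
  obtain ⟨s, hs⟩ := (IsNoetherian.noetherian I : I.FG)
  ext x
  have := mem_map_bigF_iff R p s (frobSeq R p x)
  have e0 : (x ∈ (contractedExt R (bigF R p) I : Set R)) ↔
    algebraMap (ℕ → R) (bigB R) (frobSeq R p x) ∈ (Ideal.span (s : Set R)).map (bigF R p) := by
    change bigF R p x ∈ I.map (bigF R p) ↔ _
    rw [← hs]; rfl
  rw [e0, this]
  simp only [tightClSet, Set.mem_ofPred_eq, frobSeq_apply, mem_circ, span_pow_image R p I s hs]

/-- Uniform colon killers. -/
def ColonKill [IsLocalRing R] : Prop :=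
  ∀ (d : ℕ) (x : Fin d → R), IsSOP R x → ∃ c ∈ circ R, ∀ (N : ℕ) (_ : 0 < N) (i : Fin d) (u : R),
    u * x i ^ N ∈ Ideal.span ((fun j => x j ^ N) '' {j | j < i}) →
    c * u ∈ Ideal.span ((fun j => x j ^ N) '' {j | j < i})

lemma ofList_take_ofFn {S : Type*} [CommRing S] {d : ℕ} (y : Fin d → S) (i : Fin d) :
    Ideal.ofList (List.take i (List.ofFn y)) = Ideal.span (y '' {j | j < i}) := by
  rw [Ideal.ofList]
  congr 1
  ext z
  simp only [Set.mem_ofPred_eq, Set.mem_image, List.mem_take_iff_getElem, List.getElem_ofFn,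
    List.length_ofFn]
  constructor
  · rintro ⟨j, hj, rfl⟩
    exact ⟨⟨j, by omega⟩, by simpa [Fin.lt_def] using hj.trans_le (min_le_left _ _), rfl⟩
  · rintro ⟨j, hj, rfl⟩
    exact ⟨j, by simpa using hj, rfl⟩

lemma weaklyRegular_ofFn_iff {S : Type*} [CommRing S] {d : ℕ} (y : Fin d → S) :
    RingTheory.Sequence.IsWeaklyRegular S (List.ofFn y) ↔
      ∀ (i : Fin d) (u : S), u * y i ∈ Ideal.span (y '' {j | j < i}) →
        u ∈ Ideal.span (y '' {j | j < i}) := by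
  rw [RingTheory.Sequence.isWeaklyRegular_iff]
  constructor
  · intro h i u hu
    have := h i (by simp)
    rw [isSMulRegular_iff_right_eq_zero_of_smul] at this
    have h2 := this (Submodule.Quotient.mk u)
    rw [← Submodule.Quotient.mk_smul, Submodule.Quotient.mk_eq_zero,
      Submodule.Quotient.mk_eq_zero] at h2
    simp only [ofList_take_ofFn, List.getElem_ofFn, smul_eq_mul, Ideal.mul_top] at h2
    exact h2 (by rwa [mul_comm])
  · intro h i hi
    have hi' : i < d := by simpa using hi
    rw [isSMulRegular_iff_right_eq_zero_of_smul]
    intro m hm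
    obtain ⟨u, rfl⟩ := Submodule.Quotient.mk_surjective _ m
    rw [← Submodule.Quotient.mk_smul, Submodule.Quotient.mk_eq_zero] at hm
    rw [Submodule.Quotient.mk_eq_zero]
    have e := ofList_take_ofFn y ⟨i, hi'⟩
    simp only at e
    rw [e] at hm ⊢
    simp only [List.getElem_ofFn, smul_eq_mul, Ideal.mul_top] at hm ⊢
    exact h ⟨i, hi'⟩ u (by rwa [mul_comm])

lemma bigCM [IsLocalRing R] [IsNoetherianRing R] (hck : ColonKill R) :
    IsBalancedBigCMHom R (bigF R p) := by
  classical
  have hprop : (maximalIdeal R).map (bigF R p) ≠ ⊤ := by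
    intro h
    obtain ⟨s, hs⟩ := (IsNoetherian.noetherian (maximalIdeal R) : (maximalIdeal R).FG)
    rw [Ideal.eq_top_iff_one, ← hs, ← map_one (algebraMap (ℕ → R) (bigB R)),
      mem_map_bigF_iff] at h
    obtain ⟨c, hc, E, hE⟩ := h
    have hc0 : c ∈ ⨅ i : ℕ, (maximalIdeal R) ^ i := by
      rw [Ideal.mem_iInf]
      intro i
      have h2 := hE (max E i) (le_max_left _ _)
      rw [← span_pow_image R p (maximalIdeal R) s hs] at h2
      simp only [Pi.one_apply, mul_one] at h2
      refine (Ideal.pow_le_pow_right (le_trans (le_max_right E i)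
        (Nat.lt_pow_self (Fact.out : p.Prime).one_lt).le)) ((Ideal.span_le.2 ?_) h2)
      rintro _ ⟨a, ha, rfl⟩
      exact Ideal.pow_mem_pow ha _
    rw [Ideal.iInf_pow_eq_bot_of_isLocalRing _ (Ideal.IsPrime.ne_top inferInstance)] at hc0
    obtain ⟨P, hP⟩ := Ideal.nonempty_minimalPrimes (I := (⊥ : Ideal R)) bot_ne_top
    refine hc P hP ?_
    rw [Ideal.mem_bot.1 hc0]; exact zero_mem _
  refine ⟨fun d x hx => ⟨?_, ?_⟩, hprop⟩
  · rw [weaklyRegular_ofFn_iff]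
    intro i u hu
    obtain ⟨c, hc, hck⟩ := hck d x hx
    obtain ⟨w, s, rfl⟩ := IsLocalization.exists_mk'_eq (seqS R) u
    have himg : ∀ (g : R → R), (fun j => g (x j)) '' {j | j < i} =
        g '' ((Finset.univ.filter (· < i)).image x : Finset R) := by
      intro g; ext; simp
    have hI : Ideal.span ((fun i => bigF R p (x i)) '' {j | j < i}) =
        (Ideal.span (((Finset.univ.filter (· < i)).image x : Finset R) : Set R)).map
          (bigF R p) := by
      rw [Ideal.map_span]; congr 1; ext; simp
    rw [hI] at hu ⊢
    have h1 : algebraMap (ℕ → R) (bigB R) (w * frobSeq R p (x i)) ∈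
        (Ideal.span (((Finset.univ.filter (· < i)).image x : Finset R) : Set R)).map
          (bigF R p) := by
      have h2 := Ideal.mul_mem_left _ (algebraMap (ℕ → R) (bigB R) s) hu
      rw [← mul_assoc, IsLocalization.mk'_spec'] at h2
      rw [map_mul]; exact h2
    rw [mem_map_bigF_iff] at h1
    obtain ⟨c', hc', E, hE⟩ := h1
    have h3 : algebraMap (ℕ → R) (bigB R) w ∈
        (Ideal.span (((Finset.univ.filter (· < i)).image x : Finset R) : Set R)).map
          (bigF R p) := by
      rw [mem_map_bigF_iff]
      refine ⟨c * c', mul_mem hc hc', E, fun e he => ?_⟩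
      have h4 := hE e he
      rw [← himg (fun a => a ^ p ^ e)] at h4 ⊢
      rw [mul_assoc]
      refine hck (p ^ e) (pow_pos (Fact.out : p.Prime).pos _) i (c' * w e) ?_
      rwa [Pi.mul_apply, frobSeq_apply, ← mul_assoc] at h4
    rw [← IsLocalization.mk'_spec (bigB R) w s] at h3
    exact (Ideal.mul_unit_mem_iff_mem _ (IsLocalization.map_units (bigB R) s)).1 h3
  · intro h
    apply hprop
    rw [eq_top_iff]
    rw [smul_eq_mul, Ideal.mul_top] at h
    rw [h, Ideal.ofList, Ideal.span_le]
    intro z hz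
    simp only [Set.mem_ofPred_eq, List.mem_ofFn] at hz
    obtain ⟨j, rfl⟩ := hz
    apply Ideal.mem_map_of_mem
    rw [← hx.2]
    exact Ideal.le_radical (Ideal.subset_span ⟨j, rfl⟩)

end construction

end TCB

end

section
namespace TCB

section dagger

variable {R : Type u} [CommRing R]

lemma circ_nzd [IsReduced R] {c : R} (hc : c ∈ circ R) : c ∈ nonZeroDivisors R := by
  rw [mem_nonZeroDivisors_iff_right]
  intro u hu
  have h : u ∈ sInf (minimalPrimes R) := by
    rw [Submodule.mem_sInf]
    intro P hP
    have := Ideal.IsMinimalPrime.isPrime hP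
    refine (this.mem_or_mem (show u * c ∈ P by rw [hu]; exact zero_mem _)).resolve_right (hc P hP)
  rw [minimalPrimes, Ideal.sInf_minimalPrimes] at h
  have : IsNilpotent u := by
    obtain ⟨n, hn⟩ := h
    exact ⟨n, by simpa using hn⟩
  exact this.eq_zero

lemma expand_mem (I : Ideal R) (x : R) (m : ℕ) (y : R)
    (hy : y ∈ I * (I ⊔ Ideal.span {x}) ^ m) :
    ∃ a : ℕ → R, (∀ k ∈ Finset.Icc 1 (m + 1), a k ∈ I ^ k) ∧
      y = ∑ k ∈ Finset.Icc 1 (m + 1), a k * x ^ (m + 1 - k) := by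
  induction m generalizing y with
  | zero =>
    refine ⟨fun _ => y, ?_, by simp⟩
    intro k hk
    have : k = 1 := by simpa using hk
    subst this
    simpa using hy
  | succ m ih =>
    rw [pow_succ, ← mul_assoc, Ideal.mul_sup] at hy
    obtain ⟨y1, h1, y2, h2, rfl⟩ := Submodule.mem_sup.1 hy
    obtain ⟨z, hz, rfl⟩ := Ideal.mem_mul_span_singleton.1 h2
    obtain ⟨a2, ha2, rfl⟩ := ih z hz
    have h3 : ∀ y1 ∈ I * (I ⊔ Ideal.span {x}) ^ m * I, ∃ b : ℕ → R,
        (∀ k ∈ Finset.Icc 1 (m + 1), b k ∈ I ^ (k + 1)) ∧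
        y1 = ∑ k ∈ Finset.Icc 1 (m + 1), b k * x ^ (m + 1 - k) := by
      intro y1 h1
      refine Submodule.mul_induction_on h1 ?_ ?_
      · intro u hu v hv
        obtain ⟨a, ha, rfl⟩ := ih u hu
        refine ⟨fun k => a k * v, fun k hk => ?_, ?_⟩
        · rw [pow_succ]; exact Ideal.mul_mem_mul (ha k hk) hv
        · rw [Finset.sum_mul]; exact Finset.sum_congr rfl fun k _ => by ring
      · rintro u v ⟨b, hb, rfl⟩ ⟨b', hb', rfl⟩
        refine ⟨fun k => b k + b' k, fun k hk => add_mem (hb k hk) (hb' k hk), ?_⟩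
        rw [← Finset.sum_add_distrib]; exact Finset.sum_congr rfl fun k _ => by ring
    obtain ⟨b, hb, rfl⟩ := h3 y1 h1
    refine ⟨fun k => (if k ≤ m + 1 then a2 k else 0) + (if 2 ≤ k then b (k - 1) else 0),
      fun k hk => ?_, ?_⟩
    · rw [Finset.mem_Icc] at hk
      refine add_mem ?_ ?_
      · split_ifs with h
        · exact ha2 k (Finset.mem_Icc.2 ⟨hk.1, h⟩)
        · exact zero_mem _
      · split_ifs with h
        · have := hb (k - 1) (Finset.mem_Icc.2 ⟨by omega, by omega⟩)
          rwa [Nat.sub_add_cancel hk.1] at this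
        · exact zero_mem _
    · simp_rw [add_mul, Finset.sum_add_distrib]
      rw [add_comm]
      congr 1
      · rw [Finset.sum_mul]
        conv_rhs => rw [Finset.sum_Icc_succ_top (by omega)]
        simp only [show ¬ (m + 1 + 1 ≤ m + 1) by omega, if_false, zero_mul, add_zero]
        refine Finset.sum_congr rfl fun k hk => ?_
        rw [Finset.mem_Icc] at hk
        rw [if_pos hk.2, mul_assoc, ← pow_succ]
        congr 2; omega
      · conv_rhs => rw [← Finset.add_sum_Ioc_eq_sum_Icc (by omega)]
        simp only [show ¬ (2 ≤ 1) by omega, if_false, zero_mul, zero_add]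
        refine Finset.sum_bij (fun k _ => k + 1) ?_ ?_ ?_ ?_
        · intro k hk; simp only [Finset.mem_Icc, Finset.mem_Ioc] at *; omega
        · intro a _ b _ h; omega
        · intro k hk
          simp only [Finset.mem_Ioc] at hk
          exact ⟨k - 1, by simp only [Finset.mem_Icc]; omega, by omega⟩
        · intro k hk
          simp only [Finset.mem_Icc] at hk
          rw [if_pos (by omega), Nat.add_sub_cancel]
          congr 2; omega

lemma mem_intCl_of_pow_mem (I : Ideal R) (x : R) (m : ℕ)
    (h : x ^ (m + 1) ∈ I * (I ⊔ Ideal.span {x}) ^ m) : x ∈ intClSet R I := by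
  obtain ⟨a, ha, e⟩ := expand_mem I x m _ h
  refine ⟨m + 1, Nat.succ_pos _, fun k => - a k, fun k hk => neg_mem (ha k hk), ?_⟩
  rw [e]; simp

lemma mem_intCl [IsNoetherianRing R] (I : Ideal R) (x c : R) (hc : c ∈ nonZeroDivisors R)
    (h : ∀ n : ℕ, ∃ q ≥ n, c * x ^ q ∈ I ^ q) : x ∈ intClSet R I := by
  classical
  let Rx := Localization.Away x
  let xi : Rx := IsLocalization.Away.invSelf x
  have hxi : algebraMap R Rx x * xi = 1 := IsLocalization.Away.mul_invSelf x
  obtain ⟨s, hs⟩ := (IsNoetherian.noetherian I : I.FG)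
  let S : Subalgebra R Rx :=
    Algebra.adjoin R ((s.image (fun a => algebraMap R Rx a * xi) : Finset Rx) : Set Rx)
  have hfg : S.FG := Subalgebra.fg_adjoin_finset _
  have hnoeth : IsNoetherianRing S := isNoetherianRing_of_fg hfg
  have hIS : ∀ a ∈ I, algebraMap R Rx a * xi ∈ S := by
    intro a ha
    rw [← hs] at ha
    refine Submodule.span_induction (p := fun a _ => algebraMap R Rx a * xi ∈ S) ?_ ?_ ?_ ?_ ha
    · intro a ha
      exact Algebra.subset_adjoin (by simpa using ⟨a, ha, rfl⟩)
    · simp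
    · intro a b _ _ h1 h2
      rw [map_add, add_mul]; exact add_mem h1 h2
    · intro r a _ h1
      rw [smul_eq_mul, map_mul, mul_assoc, ← Algebra.smul_def]
      exact S.smul_mem h1 r
  let J : Ideal S := Ideal.span {t : S | ∃ a ∈ I, (t : Rx) = algebraMap R Rx a * xi}
  have hpow : ∀ k : ℕ, ∀ y ∈ I ^ k, ∃ t ∈ J ^ k, (t : Rx) = algebraMap R Rx y * xi ^ k := by
    intro k
    induction k with
    | zero => intro y _; exact ⟨algebraMap R S y, by simp, by simp⟩
    | succ k ih =>
      intro y hy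
      rw [pow_succ] at hy
      refine Submodule.mul_induction_on hy ?_ ?_
      · intro u hu v hv
        obtain ⟨t, ht, e⟩ := ih u hu
        refine ⟨t * ⟨_, hIS v hv⟩, ?_, ?_⟩
        · rw [pow_succ]
          exact Ideal.mul_mem_mul ht (Ideal.subset_span ⟨v, hv, rfl⟩)
        · rw [MulMemClass.coe_mul, e, map_mul]; ring
      · rintro u v ⟨t, ht, e⟩ ⟨t', ht', e'⟩
        refine ⟨t + t', add_mem ht ht', ?_⟩
        rw [AddMemClass.coe_add, e, e', map_add]; ring
  have hcJ : ∀ n, algebraMap R S c ∈ J ^ n := by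
    intro n
    obtain ⟨q, hq, hm⟩ := h n
    obtain ⟨t, ht, e⟩ := hpow q _ hm
    have : t = algebraMap R S c := by
      apply Subtype.ext
      rw [e, map_mul, map_pow, mul_assoc, ← mul_pow, hxi, one_pow, mul_one]; rfl
    rw [← this]
    exact Ideal.pow_le_pow_right hq ht
  have hKr : algebraMap R S c ∈ (⨅ i : ℕ, J ^ i • ⊤ : Submodule S S) := by
    rw [Submodule.mem_iInf]
    intro i
    have := hcJ i
    simpa using this
  rw [Ideal.mem_iInf_smul_pow_eq_bot_iff] at hKr
  obtain ⟨⟨r, hr⟩, hrc⟩ := hKr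
  have hr1 : (r : Rx) = 1 := by
    have h1 : algebraMap R Rx c * ((r : Rx) - 1) = 0 := by
      have := congrArg (fun t : S => (t : Rx)) hrc
      have e2 : (r : Rx) * algebraMap R Rx c = algebraMap R Rx c := this
      rw [mul_sub, mul_comm, e2]; ring
    have h2 : algebraMap R Rx c ∈ nonZeroDivisors Rx :=
      IsLocalization.map_nonZeroDivisors_le (Submonoid.powers x) Rx ⟨c, hc, rfl⟩
    have h3 := (mem_nonZeroDivisors_iff.1 h2).1 _ h1
    exact sub_eq_zero.1 h3
  set K := I ⊔ Ideal.span {x} with hK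
  have hxK : x ∈ K := Ideal.mem_sup_right (Ideal.mem_span_singleton_self x)
  have hSform : ∀ t ∈ S, ∃ n : ℕ, ∃ b ∈ K ^ n, t * algebraMap R Rx x ^ n = algebraMap R Rx b := by
    intro t ht
    refine Algebra.adjoin_induction (p := fun t _ => ∃ n : ℕ, ∃ b ∈ K ^ n,
      t * algebraMap R Rx x ^ n = algebraMap R Rx b) ?_ ?_ ?_ ?_ ht
    · intro t ht
      obtain ⟨a, ha, rfl⟩ : ∃ a ∈ s, algebraMap R Rx a * xi = t := by simpa using ht
      refine ⟨1, a, ?_, ?_⟩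
      · rw [pow_one]; exact Ideal.mem_sup_left (hs ▸ Ideal.subset_span ha)
      · rw [pow_one, mul_assoc, mul_comm xi, hxi, mul_one]
    · intro r; exact ⟨0, r, by simp, by simp⟩
    · rintro t t' _ _ ⟨n, b, hb, e⟩ ⟨n', b', hb', e'⟩
      refine ⟨n + n', b * x ^ n' + b' * x ^ n, add_mem ?_ ?_, ?_⟩
      · rw [pow_add]; exact Ideal.mul_mem_mul hb (Ideal.pow_mem_pow hxK _)
      · rw [add_comm n, pow_add]; exact Ideal.mul_mem_mul hb' (Ideal.pow_mem_pow hxK _)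
      · simp only [map_add, map_mul, map_pow, ← e, ← e']; ring
    · rintro t t' _ _ ⟨n, b, hb, e⟩ ⟨n', b', hb', e'⟩
      refine ⟨n + n', b * b', ?_, ?_⟩
      · rw [pow_add]; exact Ideal.mul_mem_mul hb hb'
      · simp only [map_mul, ← e, ← e']; ring
  have hJform : ∀ t ∈ J, ∃ n : ℕ, ∃ b ∈ I * K ^ n,
      (t : Rx) * algebraMap R Rx x ^ (n + 1) = algebraMap R Rx b := by
    intro t ht
    refine Submodule.span_induction (p := fun (t : S) _ => ∃ n : ℕ, ∃ b ∈ I * K ^ n,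
      (t : Rx) * algebraMap R Rx x ^ (n + 1) = algebraMap R Rx b) ?_ ?_ ?_ ?_ ht
    · rintro t ⟨a, ha, e⟩
      refine ⟨0, a, by simpa using ha, ?_⟩
      rw [e, zero_add, pow_one, mul_assoc, mul_comm xi, hxi, mul_one]
    · exact ⟨0, 0, zero_mem _, by simp⟩
    · rintro t t' _ _ ⟨n, b, hb, e⟩ ⟨n', b', hb', e'⟩
      refine ⟨n + n' + 1, b * x ^ (n' + 1) + b' * x ^ (n + 1), add_mem ?_ ?_, ?_⟩
      · rw [add_assoc, pow_add, ← mul_assoc]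
        exact Ideal.mul_mem_mul hb (Ideal.pow_mem_pow hxK _)
      · rw [add_comm n, add_assoc, pow_add, ← mul_assoc]
        exact Ideal.mul_mem_mul hb' (Ideal.pow_mem_pow hxK _)
      · simp only [map_add, map_mul, map_pow, ← e, ← e']; push_cast; ring
    · rintro a t _ ⟨n, b, hb, e⟩
      obtain ⟨n', b', hb', e'⟩ := hSform a a.2
      refine ⟨n + n', b * b', ?_, ?_⟩
      · rw [pow_add, ← mul_assoc]; exact Ideal.mul_mem_mul hb hb'
      · simp only [map_mul, ← e, ← e', smul_eq_mul]; push_cast; ring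
  obtain ⟨n, b, hb, e⟩ := hJform r hr
  rw [hr1, one_mul, ← map_pow, IsLocalization.eq_iff_exists (Submonoid.powers x)] at e
  obtain ⟨⟨_, k, rfl⟩, e⟩ := e
  refine mem_intCl_of_pow_mem I x (n + k) ?_
  have : x ^ (n + k + 1) = b * x ^ k := by
    rw [mul_comm b, ← e]; simp only; ring
  rw [this, pow_add, ← mul_assoc]
  exact Ideal.mul_mem_mul hb (Ideal.pow_mem_pow hxK _)

/-- Condition (dagger) for the big algebra. -/
lemma bigDagger (p : ℕ) [Fact p.Prime] [CharP R p] [IsLocalRing R] [IsNoetherianRing R]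
    [IsReduced R] : SatisfiesDagger R (bigF R p) := by
  intro I _ x hx
  rw [← tight_eq] at hx
  obtain ⟨c, hc, E, hE⟩ := hx
  refine mem_intCl I x c (circ_nzd ((mem_circ R c).2 hc)) fun n => ?_
  refine ⟨p ^ (n + E), ?_, ?_⟩
  · exact ((Nat.lt_pow_self (Fact.out : p.Prime).one_lt).le.trans'
      (Nat.le_add_right n E))
  · refine (Ideal.span_le.2 ?_ : Ideal.span _ ≤ I ^ (p ^ (n + E))) (hE (n + E) (by omega))
    rintro _ ⟨a, ha, rfl⟩
    exact Ideal.pow_mem_pow ha _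

end dagger

end TCB

end

section
/-! ### Depth of ideals in a Noetherian local ring -/

namespace TCB

section depth

variable {W : Type*} [CommRing W]

/-- `y` is a nonzerodivisor modulo `I`. -/
def NZ (I : Ideal W) (y : W) : Prop := ∀ u, y * u ∈ I → u ∈ I

lemma mem_sup_span {I : Ideal W} {x u : W} :
    u ∈ I ⊔ Ideal.span {x} ↔ ∃ v, u - x * v ∈ I := by
  constructor
  · intro h
    obtain ⟨i, hi, w, hw, rfl⟩ := Submodule.mem_sup.1 h
    obtain ⟨v, rfl⟩ := Ideal.mem_span_singleton'.1 hw
    exact ⟨v, by ring_nf; exact hi⟩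
  · rintro ⟨v, hv⟩
    have : u = (u - x * v) + v * x := by ring
    rw [this]
    exact add_mem (Ideal.mem_sup_left hv)
      (Ideal.mem_sup_right (Ideal.mul_mem_left _ _ (Ideal.mem_span_singleton_self x)))

lemma krull_mem [IsLocalRing W] [IsNoetherianRing W] (I : Ideal W) (u : W)
    (h : ∀ k : ℕ, u ∈ I ⊔ maximalIdeal W ^ k) : u ∈ I := by
  by_cases hI : I = ⊤
  · rw [hI]; trivial
  have : Nontrivial (W ⧸ I) := Ideal.Quotient.nontrivial_iff.2 hI
  have : IsLocalRing (W ⧸ I) :=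
    IsLocalRing.of_surjective' (Ideal.Quotient.mk I) Ideal.Quotient.mk_surjective
  have h1 : (maximalIdeal W).map (Ideal.Quotient.mk I) ≠ ⊤ := by
    intro e
    have := (Ideal.map_eq_top_or_isMaximal_of_surjective (Ideal.Quotient.mk I)
      Ideal.Quotient.mk_surjective (I := maximalIdeal W) inferInstance)
    have h2 : Ideal.comap (Ideal.Quotient.mk I) ((maximalIdeal W).map (Ideal.Quotient.mk I)) = ⊤ := by
      rw [e]; rfl
    rw [Ideal.comap_map_of_surjective _ Ideal.Quotient.mk_surjective, ← RingHom.ker_eq_comap_bot,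
      Ideal.mk_ker, sup_eq_left.2 (IsLocalRing.le_maximalIdeal hI)] at h2
    exact (Ideal.IsPrime.ne_top inferInstance) h2
  have h3 := Ideal.iInf_pow_eq_bot_of_isLocalRing _ h1
  have h4 : Ideal.Quotient.mk I u ∈ (⨅ i : ℕ, (maximalIdeal W).map (Ideal.Quotient.mk I) ^ i) := by
    rw [Ideal.mem_iInf]
    intro k
    obtain ⟨i, hi, w, hw, rfl⟩ := Submodule.mem_sup.1 (h k)
    rw [map_add, Ideal.Quotient.eq_zero_iff_mem.2 hi, zero_add, ← Ideal.map_pow]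
    exact Ideal.mem_map_of_mem _ hw
  rw [h3] at h4
  exact Ideal.Quotient.eq_zero_iff_mem.1 h4

lemma nz_swap_left [IsLocalRing W] [IsNoetherianRing W] {I : Ideal W} {x z : W}
    (hxm : x ∈ maximalIdeal W) (hx : NZ I x) (hz : NZ (I ⊔ Ideal.span {x}) z) : NZ I z := by
  intro u hu
  apply krull_mem
  have key : ∀ k : ℕ, ∃ u', u - x ^ k * u' ∈ I ∧ z * u' ∈ I := by
    intro k
    induction k with
    | zero => exact ⟨u, by simp, hu⟩
    | succ k ih =>
      obtain ⟨u', h1, h2⟩ := ih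
      obtain ⟨v, hv⟩ := mem_sup_span.1 (hz u' (Ideal.mem_sup_left h2))
      refine ⟨v, ?_, ?_⟩
      · have : u - x ^ (k + 1) * v = (u - x ^ k * u') + x ^ k * (u' - x * v) := by ring
        rw [this]; exact add_mem h1 (Ideal.mul_mem_left _ _ hv)
      · apply hx
        have : x * (z * v) = z * u' - z * (u' - x * v) := by ring
        rw [this]; exact sub_mem h2 (Ideal.mul_mem_left _ _ hv)
  intro k
  obtain ⟨u', h1, _⟩ := key k
  have : u = (u - x ^ k * u') + x ^ k * u' := by ring
  rw [this]
  exact add_mem (Ideal.mem_sup_left h1) (Ideal.mem_sup_right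
    (Ideal.mul_mem_right _ _ (Ideal.pow_mem_pow hxm k)))

lemma nz_swap_right {I : Ideal W} {x z : W}
    (hx : NZ I x) (hz : NZ (I ⊔ Ideal.span {x}) z) : NZ (I ⊔ Ideal.span {z}) x := by
  intro u hu
  obtain ⟨w, hw⟩ := mem_sup_span.1 hu
  have h1 : z * w ∈ I ⊔ Ideal.span {x} := by
    rw [mem_sup_span]
    exact ⟨u, by have := neg_mem hw; rwa [neg_sub] at this⟩
  obtain ⟨v, hv⟩ := mem_sup_span.1 (hz w h1)
  rw [mem_sup_span]
  refine ⟨v, hx _ ?_⟩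
  have : x * (u - z * v) = (x * u - z * w) + z * (w - x * v) := by ring
  rw [this]; exact add_mem hw (Ideal.mul_mem_left _ _ hv)

/-- Associated prime of an ideal, elementwise. -/
def IsAss (I P : Ideal W) : Prop := P.IsPrime ∧ ∃ u, ∀ a, a ∈ P ↔ a * u ∈ I

lemma isAss_iff [IsNoetherianRing W] (I P : Ideal W) :
    P ∈ associatedPrimes W (W ⧸ I) ↔ IsAss I P := by
  rw [AssociatedPrimes.mem_iff, isAssociatedPrime_iff]
  refine and_congr_right fun _ => ?_
  constructor
  · rintro ⟨x, rfl⟩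
    obtain ⟨u, rfl⟩ := Ideal.Quotient.mk_surjective x
    refine ⟨u, fun a => ?_⟩
    rw [Submodule.mem_colon_singleton, Submodule.mem_bot, ← Ideal.Quotient.eq_zero_iff_mem, map_mul]
    rfl
  · rintro ⟨u, hu⟩
    refine ⟨Ideal.Quotient.mk I u, ?_⟩
    ext a
    rw [Submodule.mem_colon_singleton, Submodule.mem_bot, hu, ← Ideal.Quotient.eq_zero_iff_mem,
      map_mul]
    rfl

lemma finite_ass [IsNoetherianRing W] (I : Ideal W) : {P | IsAss I P}.Finite := by
  have := associatedPrimes.finite W (W ⧸ I)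
  refine this.subset fun P hP => (isAss_iff I P).2 hP

lemma exists_ass [IsNoetherianRing W] (I : Ideal W) (u : W) (hu : u ∉ I) :
    ∃ P, IsAss I P ∧ ∀ a, a * u ∈ I → a ∈ P := by
  obtain ⟨P, hP, h⟩ := exists_le_isAssociatedPrime_of_isNoetherianRing W (Ideal.Quotient.mk I u)
    (by rwa [Ne, Ideal.Quotient.eq_zero_iff_mem])
  refine ⟨P, (isAss_iff I P).1 hP, fun a ha => h ?_⟩
  rw [Submodule.mem_colon_singleton, Submodule.mem_bot]
  exact Ideal.Quotient.eq_zero_iff_mem.2 ha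

lemma nz_of_forall_ass [IsNoetherianRing W] {I : Ideal W} {y : W}
    (h : ∀ P, IsAss I P → y ∉ P) : NZ I y := by
  intro u hu
  by_contra hn
  obtain ⟨P, hP, h'⟩ := exists_ass I u hn
  exact h P hP (h' y hu)

lemma NZ.notMem {I : Ideal W} {y : W} (h : NZ I y) {P : Ideal W} (hP : IsAss I P) : y ∉ P := by
  intro hy
  obtain ⟨hp, u, hu⟩ := hP
  have : u ∈ I := h u ((hu y).1 hy)
  exact hp.ne_top ((Ideal.eq_top_iff_one _).2 ((hu 1).2 (by simpa using this)))

lemma dim_quot_succ_le {P P' : Ideal W} [P.IsPrime] (h : P < P') :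
    ringKrullDim (W ⧸ P') + 1 ≤ ringKrullDim (W ⧸ P) := by
  obtain ⟨r, hr, hn⟩ := SetLike.exists_of_lt h
  refine ringKrullDim_succ_le_of_surjective (Ideal.Quotient.factor h.le)
    (Ideal.Quotient.factor_surjective h.le) (r := Ideal.Quotient.mk P r) ?_ ?_
  · rw [mem_nonZeroDivisors_iff_ne_zero]
    rwa [Ne, Ideal.Quotient.eq_zero_iff_mem]
  · simpa [Ideal.Quotient.eq_zero_iff_mem] using hr

/-- The quotient by `I` has depth at least `n`. -/
def DD [IsLocalRing W] : ℕ → Ideal W → Prop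
  | 0, _ => True
  | n + 1, I => ∃ x ∈ maximalIdeal W, NZ I x ∧ DD n (I ⊔ Ideal.span {x})

variable [IsLocalRing W] [IsNoetherianRing W]

lemma dim_ass_ge (n : ℕ) (I P : Ideal W) (hD : DD n I) (hP : IsAss I P) :
    (n : WithBot ℕ∞) ≤ ringKrullDim (W ⧸ P) := by
  induction n generalizing I P with
  | zero =>
    have : P.IsPrime := hP.1
    have := ringKrullDim_nonneg_of_nontrivial (R := W ⧸ P)
    simpa using this
  | succ n ih =>
    obtain ⟨x, hxm, hx, hD⟩ := hD
    have hxP := hx.notMem hP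
    obtain ⟨hp, u, hu⟩ := hP
    have huI : u ∉ I := by
      intro h
      exact hp.ne_top ((Ideal.eq_top_iff_one _).2 ((hu 1).2 (by simpa using h)))
    -- divide `u` by the largest possible power of `x`
    obtain ⟨v, hv, hvP⟩ : ∃ v, v ∉ I ⊔ Ideal.span {x} ∧ ∀ a ∈ P, a * v ∈ I := by
      by_contra hcon
      push Not at hcon
      apply huI
      apply krull_mem
      have key : ∀ k : ℕ, ∃ u', u - x ^ k * u' ∈ I ∧ ∀ a ∈ P, a * u' ∈ I := by
        intro k
        induction k with
        | zero => exact ⟨u, by simp, fun a ha => (hu a).1 ha⟩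
        | succ k ih =>
          obtain ⟨u', h1, h2⟩ := ih
          have h3 : u' ∈ I ⊔ Ideal.span {x} := by
            by_contra h
            obtain ⟨a, ha, ha'⟩ := hcon u' h
            exact ha' (h2 a ha)
          obtain ⟨v, hv⟩ := mem_sup_span.1 h3
          refine ⟨v, ?_, fun a ha => ?_⟩
          · have : u - x ^ (k + 1) * v = (u - x ^ k * u') + x ^ k * (u' - x * v) := by ring
            rw [this]; exact add_mem h1 (Ideal.mul_mem_left _ _ hv)
          · apply hx
            have : x * (a * v) = a * u' - a * (u' - x * v) := by ring
            rw [this]; exact sub_mem (h2 a ha) (Ideal.mul_mem_left _ _ hv)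
      intro k
      obtain ⟨u', h1, _⟩ := key k
      have : u = (u - x ^ k * u') + x ^ k * u' := by ring
      rw [this]
      exact add_mem (Ideal.mem_sup_left h1) (Ideal.mem_sup_right
        (Ideal.mul_mem_right _ _ (Ideal.pow_mem_pow hxm k)))
    obtain ⟨P', hP', h'⟩ := exists_ass _ v hv
    have hlt : P < P' := by
      refine lt_of_le_of_ne (fun a ha => h' a (Ideal.mem_sup_left (hvP a ha))) ?_
      rintro rfl
      exact hxP (h' x (Ideal.mem_sup_right
        (Ideal.mul_mem_right _ _ (Ideal.mem_span_singleton_self x))))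
    have h1 := ih _ P' hD hP'
    have h2 := dim_quot_succ_le hlt
    refine le_trans ?_ h2
    push_cast
    gcongr

lemma dim_quot_max : ringKrullDim (W ⧸ maximalIdeal W) = 0 := by
  exact ringKrullDim_eq_zero_of_isField
    ((Ideal.Quotient.maximal_ideal_iff_isField_quotient _).1 inferInstance)

lemma exists_common_nz {I J : Ideal W} (hI : ¬ IsAss I (maximalIdeal W))
    (hJ : ¬ IsAss J (maximalIdeal W)) : ∃ z ∈ maximalIdeal W, NZ I z ∧ NZ J z := by
  have hfin : ({P | IsAss I P} ∪ {P | IsAss J P}).Finite := (finite_ass I).union (finite_ass J)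
  have h := Ideal.subset_union_prime_finite hfin (f := id) (⊤ : Ideal W) (⊤ : Ideal W)
    (by rintro P (hP | hP) _ _ <;> exact hP.1) (I := maximalIdeal W)
  have hno : ¬ ∃ P ∈ ({P | IsAss I P} ∪ {P | IsAss J P}), maximalIdeal W ≤ id P := by
    rintro ⟨P, hP, hle⟩
    have hpr : P.IsPrime := by rcases hP with hP | hP <;> exact hP.1
    have : P = maximalIdeal W := le_antisymm (IsLocalRing.le_maximalIdeal hpr.ne_top) hle
    subst this
    rcases hP with hP | hP
    · exact hI hP
    · exact hJ hP
  rw [← h] at hno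
  obtain ⟨z, hz, hz'⟩ := Set.not_subset.1 hno
  simp only [Set.mem_iUnion, not_exists] at hz'
  exact ⟨z, hz, nz_of_forall_ass fun P hP hzP => hz' P (Or.inl hP) hzP,
    nz_of_forall_ass fun P hP hzP => hz' P (Or.inr hP) hzP⟩

lemma exchange (n : ℕ) (I : Ideal W) (y : W) (hD : DD (n + 1) I) (hym : y ∈ maximalIdeal W)
    (hy : NZ I y) : DD n (I ⊔ Ideal.span {y}) := by
  induction n generalizing I y with
  | zero => trivial
  | succ n ih =>
    obtain ⟨x, hxm, hx, hDx⟩ := hD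
    have h1 : ¬ IsAss (I ⊔ Ideal.span {x}) (maximalIdeal W) := by
      intro h
      have := dim_ass_ge _ _ _ hDx h
      rw [dim_quot_max] at this
      norm_cast at this
    have h2 : ¬ IsAss (I ⊔ Ideal.span {y}) (maximalIdeal W) := by
      rintro ⟨hp, u, hu⟩
      apply h1
      have huI : u ∉ I ⊔ Ideal.span {y} := by
        intro h
        exact hp.ne_top ((Ideal.eq_top_iff_one _).2 ((hu 1).2 (by simpa using h)))
      obtain ⟨v, hv⟩ := mem_sup_span.1 ((hu x).1 hxm)
      have hvn : v ∉ I ⊔ Ideal.span {x} := by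
        intro h
        obtain ⟨w, hw⟩ := mem_sup_span.1 h
        apply huI
        rw [mem_sup_span]
        refine ⟨w, hx _ ?_⟩
        have : x * (u - y * w) = (x * u - y * v) + y * (v - x * w) := by ring
        rw [this]; exact add_mem hv (Ideal.mul_mem_left _ _ hw)
      have hle : ∀ a ∈ maximalIdeal W, a * v ∈ I ⊔ Ideal.span {x} := by
        intro a ha
        obtain ⟨b, hb⟩ := mem_sup_span.1 ((hu a).1 ha)
        rw [mem_sup_span]
        refine ⟨b, hy _ ?_⟩
        have : y * (a * v - x * b) = x * (a * u - y * b) - a * (x * u - y * v) := by ring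
        rw [this]; exact sub_mem (Ideal.mul_mem_left _ _ hb) (Ideal.mul_mem_left _ _ hv)
      refine ⟨hp, v, fun a => ⟨hle a, fun h => ?_⟩⟩
      by_contra hna
      have hua : IsUnit a := by
        rw [mem_maximalIdeal, mem_nonunits_iff, not_not] at hna; exact hna
      exact hvn ((Ideal.unit_mul_mem_iff_mem _ hua).1 h)
    obtain ⟨z, hzm, hzx, hzy⟩ := exists_common_nz h1 h2
    have hz : NZ I z := nz_swap_left hxm hx hzx
    have hDz : DD (n + 1) (I ⊔ Ideal.span {z}) := by
      refine ⟨x, hxm, nz_swap_right hx hzx, ?_⟩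
      have := ih _ z hDx hzm hzx
      rwa [sup_assoc, sup_comm (Ideal.span {x}), ← sup_assoc] at this
    refine ⟨z, hzm, hzy, ?_⟩
    have := ih _ y hDz hym (nz_swap_right hy hzy)
    rwa [sup_assoc, sup_comm (Ideal.span {z}), ← sup_assoc] at this

/-- A sequence regular modulo `I`. -/
def RegMod : Ideal W → List W → Prop
  | _, [] => True
  | I, y :: ys => NZ I y ∧ RegMod (I ⊔ Ideal.span {y}) ys

lemma dim_quot_le_length (P : Ideal W) [P.IsPrime] (ys : List W)
    (h : maximalIdeal W ≤ (P ⊔ Ideal.ofList ys).radical) (hm : Ideal.ofList ys ≤ maximalIdeal W) :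
    ringKrullDim (W ⧸ P) ≤ ys.length := by
  classical
  have : IsLocalRing (W ⧸ P) :=
    IsLocalRing.of_surjective' (Ideal.Quotient.mk P) Ideal.Quotient.mk_surjective
  rw [← IsLocalRing.maximalIdeal_height_eq_ringKrullDim]
  have hmap : (P ⊔ Ideal.ofList ys).map (Ideal.Quotient.mk P) =
      Ideal.span ((ys.map (Ideal.Quotient.mk P)).toFinset : Set (W ⧸ P)) := by
    rw [Ideal.map_sup, Ideal.map_quotient_self, bot_sup_eq, Ideal.ofList, Ideal.map_span]
    congr 1
    ext a; simp
  have hmin : maximalIdeal (W ⧸ P) ∈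
      (Ideal.span ((ys.map (Ideal.Quotient.mk P)).toFinset : Set (W ⧸ P))).minimalPrimes := by
    rw [← hmap]
    have hmc : maximalIdeal (W ⧸ P) = (maximalIdeal W).map (Ideal.Quotient.mk P) := by
      have hl : IsLocalHom (Ideal.Quotient.mk P) :=
        IsLocalHom.of_surjective _ Ideal.Quotient.mk_surjective
      rw [← IsLocalRing.maximalIdeal_comap (Ideal.Quotient.mk P),
        Ideal.map_comap_of_surjective _ Ideal.Quotient.mk_surjective]
    refine ⟨⟨inferInstance, ?_⟩, ?_⟩
    · rw [hmc]
      exact Ideal.map_mono (sup_le (IsLocalRing.le_maximalIdeal (Ideal.IsPrime.ne_top inferInstance)) hm)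
    · rintro Q ⟨hQ, hle⟩ _
      rw [hmc, Ideal.map_le_iff_le_comap]
      refine h.trans ?_
      have hc : (Q.comap (Ideal.Quotient.mk P)).IsPrime := Ideal.comap_isPrime _ _
      rw [hc.radical_le_iff]
      exact Ideal.map_le_iff_le_comap.1 hle
  have := Ideal.height_le_card_of_mem_minimalPrimes_span_finset hmin
  have h2 : (ys.map (Ideal.Quotient.mk P)).toFinset.card ≤ ys.length := by
    simpa using List.toFinset_card_le (ys.map (Ideal.Quotient.mk P))
  exact_mod_cast this.trans (by exact_mod_cast h2)

/-- In a Cohen-Macaulay situation, a system of parameters is a regular sequence. -/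
lemma regMod_of_DD (I : Ideal W) (ys : List W) (hD : DD ys.length I)
    (h : maximalIdeal W ≤ (I ⊔ Ideal.ofList ys).radical) (hm : Ideal.ofList ys ≤ maximalIdeal W) :
    RegMod I ys := by
  induction ys generalizing I with
  | nil => trivial
  | cons y ys ih =>
    have hle : Ideal.ofList ys ≤ maximalIdeal W := by
      refine le_trans ?_ hm
      rw [Ideal.ofList_cons]; exact le_sup_right
    have hy : NZ I y := by
      apply nz_of_forall_ass
      intro P hP hyP
      have h1 := dim_ass_ge _ _ _ hD hP
      have hPp := hP.1
      obtain ⟨_, u, hu⟩ := hP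
      have hIP : I ≤ P := fun a ha => (hu a).2 (Ideal.mul_mem_right _ _ ha)
      have h2 := dim_quot_le_length P ys (h.trans (Ideal.radical_mono ?_)) hle
      · have := h1.trans h2
        rw [List.length_cons] at this
        norm_cast at this
        omega
      · rw [Ideal.ofList_cons]
        refine sup_le (hIP.trans le_sup_left) (sup_le ?_ le_sup_right)
        rw [Ideal.span_singleton_le_iff_mem]
        exact Ideal.mem_sup_left hyP
    refine ⟨hy, ih _ (exchange _ _ _ hD (hm (Ideal.subset_span (by simp))) hy) ?_ hle⟩
    rwa [Ideal.ofList_cons, ← sup_assoc] at h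

end depth

end TCB

end

section
/-! ### Regular quotients of a Noetherian local ring -/

namespace TCB

section regular

variable {C : Type*} [CommRing C]

lemma range_succAbove {n : ℕ} (s : Fin (n + 1) → C) (j : Fin (n + 1)) :
    Set.range s = insert (s j) (Set.range fun i => s (j.succAbove i)) := by
  ext a
  constructor
  · rintro ⟨i, rfl⟩
    rcases Fin.eq_self_or_eq_succAbove j i with h | ⟨k, h⟩
    · left; rw [h]
    · right; exact ⟨k, by rw [h]⟩
  · rintro (h | ⟨k, rfl⟩)
    · exact ⟨j, h.symm⟩
    · exact ⟨_, rfl⟩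

variable [IsLocalRing C]

/-- Exchange: an element outside `I + m ^ 2` can replace a generator of `m` modulo `I`. -/
lemma gen_exchange {n : ℕ} (I : Ideal C) (s : Fin (n + 1) → C)
    (hs : maximalIdeal C = I ⊔ Ideal.span (Set.range s)) (z : C) (hz : z ∈ maximalIdeal C)
    (hz' : z ∉ I ⊔ maximalIdeal C ^ 2) :
    ∃ s' : Fin n → C, maximalIdeal C = (I ⊔ Ideal.span {z}) ⊔ Ideal.span (Set.range s') := by
  have hz0 := hz
  rw [hs] at hz
  obtain ⟨i, hi, w, hw, e⟩ := Submodule.mem_sup.1 hz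
  obtain ⟨c, rfl⟩ := Ideal.mem_span_range_iff_exists_fun.1 hw
  have hsm : ∀ i, s i ∈ maximalIdeal C := fun i => by
    rw [hs]; exact Ideal.mem_sup_right (Ideal.subset_span ⟨i, rfl⟩)
  obtain ⟨j, hj⟩ : ∃ j, IsUnit (c j) := by
    by_contra hcon
    push Not at hcon
    apply hz'
    rw [← e]
    refine add_mem (Ideal.mem_sup_left hi) (Ideal.mem_sup_right (Submodule.sum_mem _ fun k _ => ?_))
    rw [pow_two]
    exact Ideal.mul_mem_mul ((mem_maximalIdeal _).2 (hcon k)) (hsm k)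
  refine ⟨fun i => s (j.succAbove i), le_antisymm ?_ ?_⟩
  · have hsj : s j ∈ (I ⊔ Ideal.span {z}) ⊔ Ideal.span (Set.range fun i => s (j.succAbove i)) := by
      rw [← Ideal.unit_mul_mem_iff_mem _ hj]
      rw [Fin.sum_univ_succAbove _ j] at e
      have : c j * s j = (z - i) - ∑ k, c (j.succAbove k) * s (j.succAbove k) := by
        rw [← e]; ring
      rw [this]
      refine sub_mem (sub_mem ?_ ?_) ?_
      · exact Ideal.mem_sup_left (Ideal.mem_sup_right (Ideal.mem_span_singleton_self z))
      · exact Ideal.mem_sup_left (Ideal.mem_sup_left hi)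
      · exact Ideal.mem_sup_right (Ideal.mem_span_range_iff_exists_fun.2 ⟨_, rfl⟩)
    rw [hs, range_succAbove s j]
    refine sup_le (le_sup_left.trans le_sup_left) (Ideal.span_le.2 ?_)
    rintro a (rfl | ha)
    · exact hsj
    · exact Ideal.mem_sup_right (Ideal.subset_span ha)
  · refine sup_le (sup_le ?_ ?_) ?_
    · conv_rhs => rw [hs]
      exact le_sup_left
    · rwa [Ideal.span_singleton_le_iff_mem]
    · rw [Ideal.span_le]; rintro _ ⟨i, rfl⟩; exact hsm _

variable [IsNoetherianRing C]

lemma dim_quot_le_succ (I : Ideal C) (z : C) (hI : I ≠ ⊤) (hz : z ∈ maximalIdeal C) :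
    ringKrullDim (C ⧸ I) ≤ ringKrullDim (C ⧸ (I ⊔ Ideal.span {z})) + 1 := by
  have : Nontrivial (C ⧸ I) := Ideal.Quotient.nontrivial_iff.2 hI
  have : IsLocalRing (C ⧸ I) :=
    IsLocalRing.of_surjective' (Ideal.Quotient.mk I) Ideal.Quotient.mk_surjective
  have hz' : Ideal.Quotient.mk I z ∈ maximalIdeal (C ⧸ I) := by
    rw [← IsLocalRing.map_maximalIdeal_of_surjective _ (Ideal.Quotient.mk_surjective (I := I))]
    exact Ideal.mem_map_of_mem _ hz
  have h := ringKrullDim_le_ringKrullDim_add_card (S := {Ideal.Quotient.mk I z}) (by simpa using hz')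
  rw [Finset.card_singleton, Finset.coe_singleton, ← Set.image_singleton, ← Ideal.map_span] at h
  rw [ringKrullDim_eq_of_ringEquiv (DoubleQuot.quotQuotEquivQuotSup I (Ideal.span {z}))] at h
  exact_mod_cast h

lemma dim_quot_prime_lt (P : Ideal C) (h : P = maximalIdeal C) : ringKrullDim (C ⧸ P) = 0 := by
  subst h; exact dim_quot_max

lemma dim_quot_le_of_minimalPrimes (I : Ideal C) (k : WithBot ℕ∞) (h : ∀ P ∈ I.minimalPrimes,
    ringKrullDim (C ⧸ P) ≤ k) : ringKrullDim (C ⧸ I) ≤ k := by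
  rw [ringKrullDim_quotient]
  refine iSup_le fun l => ?_
  obtain ⟨P, hP, hle⟩ := Ideal.exists_minimalPrimes_le (I := I) (J := l.head.1.asIdeal)
    (show (I : Set C) ⊆ _ from l.head.2)
  refine le_trans ?_ (h P hP)
  rw [ringKrullDim_quotient]
  let lser : LTSeries (PrimeSpectrum.zeroLocus (P : Set C)) :=
    { length := l.length
      toFun := fun i => ⟨(l i).1, by
        have : l.head ≤ l i := LTSeries.head_le _ _
        exact (hle.trans this : P ≤ (l i).1.asIdeal)⟩
      step := fun i => l.step i }
  exact le_iSup (fun p : LTSeries (PrimeSpectrum.zeroLocus (P : Set C)) => (p.length : WithBot ℕ∞)) lser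

/-- Regular local rings are Cohen-Macaulay domains (relative version). -/
lemma regular_prime (n : ℕ) (I : Ideal C) (s : Fin n → C)
    (hs : maximalIdeal C = I ⊔ Ideal.span (Set.range s))
    (hdim : (n : WithBot ℕ∞) ≤ ringKrullDim (C ⧸ I)) : I.IsPrime ∧ DD n I := by
  induction n generalizing I with
  | zero =>
    have : I = maximalIdeal C := by
      rw [hs]; simp
    exact ⟨this ▸ inferInstance, trivial⟩
  | succ n ih =>
    have hIm : I ≤ maximalIdeal C := by rw [hs]; exact le_sup_left
    have hIt : I ≠ ⊤ := ne_top_of_le_ne_top (Ideal.IsPrime.ne_top inferInstance) hIm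
    have hdI : ¬ ringKrullDim (C ⧸ I) ≤ 0 := by
      intro h
      have := hdim.trans h
      norm_cast at this
    -- choose z
    obtain ⟨z, hzm, hzP, hz2⟩ : ∃ z ∈ maximalIdeal C, (∀ P ∈ I.minimalPrimes, z ∉ P) ∧
        z ∉ I ⊔ maximalIdeal C ^ 2 := by
      have hfin : (insert (I ⊔ maximalIdeal C ^ 2) I.minimalPrimes).Finite :=
        (Ideal.finite_minimalPrimes_of_isNoetherianRing C I).insert _
      have h := Ideal.subset_union_prime_finite hfin (f := id) (I ⊔ maximalIdeal C ^ 2)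
        (I ⊔ maximalIdeal C ^ 2)
        (by
          rintro P (hP | hP) h _
          · exact absurd hP h
          · exact Ideal.IsMinimalPrime.isPrime hP) (I := maximalIdeal C)
      have hno : ¬ ∃ P ∈ (insert (I ⊔ maximalIdeal C ^ 2) I.minimalPrimes),
          maximalIdeal C ≤ id P := by
        have hmax : maximalIdeal C ∈ I.minimalPrimes → False := by
          intro h
          apply hdI
          apply dim_quot_le_of_minimalPrimes
          intro P hP
          have hPp := Ideal.IsMinimalPrime.isPrime hP
          have : P = maximalIdeal C :=
            le_antisymm (IsLocalRing.le_maximalIdeal hPp.ne_top)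
              (h.2 ⟨hPp, hP.1.2⟩ (IsLocalRing.le_maximalIdeal hPp.ne_top))
          rw [dim_quot_prime_lt P this]
        rintro ⟨P, (rfl | hP), hle⟩
        · have h2 : maximalIdeal C ≤ I := by
            refine Submodule.le_of_le_smul_of_le_jacobson_bot (I := maximalIdeal C)
              (IsNoetherian.noetherian _) (IsLocalRing.maximalIdeal_le_jacobson _) ?_
            rw [smul_eq_mul, ← pow_two]; exact hle
          have h3 : I = maximalIdeal C := le_antisymm hIm h2
          apply hdI
          rw [dim_quot_prime_lt I h3]
        · have hPp := Ideal.IsMinimalPrime.isPrime hP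
          have : P = maximalIdeal C := le_antisymm (IsLocalRing.le_maximalIdeal hPp.ne_top) hle
          exact hmax (this ▸ hP)
      rw [← h] at hno
      obtain ⟨z, hz, hz'⟩ := Set.not_subset.1 hno
      simp only [Set.mem_iUnion, not_exists] at hz'
      exact ⟨z, hz, fun P hP => hz' P (Or.inr hP), hz' _ (Or.inl rfl)⟩
    obtain ⟨s', hs'⟩ := gen_exchange I s hs z hzm hz2
    have hd : (n : WithBot ℕ∞) ≤ ringKrullDim (C ⧸ (I ⊔ Ideal.span {z})) := by
      have h1 := hdim.trans (dim_quot_le_succ I z hIt hzm)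
      push_cast at h1
      generalize ringKrullDim (C ⧸ (I ⊔ Ideal.span {z})) = D at h1
      cases D with
      | bot => simp at h1
      | coe D =>
        norm_cast at h1 ⊢
        cases D with
        | top => exact le_top
        | coe D => norm_cast at h1 ⊢; omega
    obtain ⟨hprime, hDD⟩ := ih _ s' hs' hd
    obtain ⟨P, hP, hle⟩ := Ideal.exists_minimalPrimes_le (I := I) (J := I ⊔ Ideal.span {z})
      le_sup_left
    have hPp := Ideal.IsMinimalPrime.isPrime hP
    have hPI : P ≤ I := by
      refine Submodule.le_of_le_smul_of_le_jacobson_bot (I := maximalIdeal C)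
        (IsNoetherian.noetherian _) (IsLocalRing.maximalIdeal_le_jacobson _) ?_
      intro a ha
      obtain ⟨v, hv⟩ := mem_sup_span.1 (hle ha)
      have h1 : z * v ∈ P := by
        have : z * v = a - (a - z * v) := by ring
        rw [this]; exact sub_mem ha (hP.1.2 hv)
      have h2 : v ∈ P := (hPp.mem_or_mem h1).resolve_left (hzP P hP)
      have : a = (a - z * v) + z * v := by ring
      rw [this]
      exact add_mem (Ideal.mem_sup_left hv) (Ideal.mem_sup_right (Ideal.mul_mem_mul hzm h2))
    have hIP : I = P := le_antisymm hP.1.2 hPI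
    refine ⟨hIP ▸ hPp, z, hzm, ?_, hDD⟩
    intro u hu
    rw [hIP] at hu ⊢
    exact (hPp.mem_or_mem hu).resolve_left (hzP P hP)

end regular

end TCB

end

section
/-! ### Selection of generators by prime avoidance -/

namespace TCB

section select

variable {W : Type*} [CommRing W] [IsLocalRing W] [IsNoetherianRing W]

/-- All primes containing `I` have coheight at most `k`. -/
def Bnd (k : ℕ) (I : Ideal W) : Prop :=
  ∀ P : Ideal W, P.IsPrime → I ≤ P → ringKrullDim (W ⧸ P) ≤ k

lemma avoid (J I E : Ideal W) (h : maximalIdeal W ≤ (J ⊔ I).radical) :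
    ∃ g ∈ J, (∀ P ∈ I.minimalPrimes, P ≠ maximalIdeal W → g ∉ P) ∧ (¬ J ≤ E → g ∉ E) := by
  classical
  have hfin : ({P ∈ I.minimalPrimes | P ≠ maximalIdeal W} ∪ {F | F = E ∧ ¬ J ≤ E}).Finite :=
    ((Ideal.finite_minimalPrimes_of_isNoetherianRing W I).subset (Set.sep_subset _ _)).union
      ((Set.finite_singleton E).subset (fun F hF => hF.1))
  have hs := Ideal.subset_union_prime_finite hfin (f := id) E E
    (by
      rintro P (hP | hP) h _
      · exact Ideal.IsMinimalPrime.isPrime hP.1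
      · exact absurd hP.1 h) (I := J)
  have hno : ¬ ∃ P ∈ ({P ∈ I.minimalPrimes | P ≠ maximalIdeal W} ∪ {F | F = E ∧ ¬ J ≤ E}),
      J ≤ id P := by
    rintro ⟨P, (hP | hP), hle⟩
    · have hPp := Ideal.IsMinimalPrime.isPrime hP.1
      have h2 : maximalIdeal W ≤ P := h.trans (hPp.radical_le_iff.2 (sup_le hle hP.1.1.2))
      exact hP.2 (le_antisymm (IsLocalRing.le_maximalIdeal hPp.ne_top) h2)
    · exact hP.2 (hP.1 ▸ hle)
  rw [← hs] at hno
  obtain ⟨z, hz, hz'⟩ := Set.not_subset.1 hno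
  simp only [Set.mem_iUnion, not_exists] at hz'
  exact ⟨z, hz, fun P hP hPm => hz' P (Or.inl ⟨hP, hPm⟩), fun h => hz' _ (Or.inr ⟨rfl, h⟩)⟩

lemma bnd_step {k : ℕ} {I : Ideal W} (hb : Bnd (k + 1) I) {g : W}
    (hg : ∀ P ∈ I.minimalPrimes, P ≠ maximalIdeal W → g ∉ P) : Bnd k (Ideal.span {g} ⊔ I) := by
  intro P hP hle
  obtain ⟨P₀, hP₀, hle₀⟩ := Ideal.exists_minimalPrimes_le (I := I) (J := P) (le_sup_right.trans hle)
  have hPp := Ideal.IsMinimalPrime.isPrime hP₀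
  by_cases hm : P₀ = maximalIdeal W
  · have : P = maximalIdeal W :=
      le_antisymm (IsLocalRing.le_maximalIdeal hP.ne_top) (hm ▸ hle₀)
    rw [this, dim_quot_max]
    exact_mod_cast Nat.zero_le k
  · have hlt : P₀ < P := by
      refine lt_of_le_of_ne hle₀ ?_
      rintro rfl
      exact hg _ hP₀ hm (hle (Ideal.mem_sup_left (Ideal.mem_span_singleton_self g)))
    have h1 := dim_quot_succ_le hlt
    have h2 := h1.trans (hb P₀ hPp hP₀.1.2)
    generalize ringKrullDim (W ⧸ P) = D at h2
    cases D with
    | bot => exact bot_le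
    | coe D =>
      norm_cast at h2 ⊢
      cases D with
      | top => norm_cast at h2
      | coe D => norm_cast at h2 ⊢; omega

variable {C : Type*} [CommRing C] [IsLocalRing C] [IsNoetherianRing C]

lemma select (φ : W →+* C) (J I : Ideal W) (hrad : maximalIdeal W ≤ (J ⊔ I).radical)
    (hJ : J.map φ ≤ maximalIdeal C) (h : ℕ) (hb : Bnd h I) {r δ : ℕ} (s : Fin r → C)
    (hs : maximalIdeal C = Ideal.span (Set.range s)) (s' : Fin δ → C)
    (hs' : maximalIdeal C = J.map φ ⊔ Ideal.span (Set.range s')) (i : ℕ) (hi : i ≤ h) :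
    ∃ gs : List W, gs.length = i ∧ Ideal.ofList gs ≤ J ∧ Bnd (h - i) (Ideal.ofList gs ⊔ I) ∧
      ∃ (a : ℕ) (w : Fin a → C), (a ≤ δ ∨ a + i ≤ r) ∧
        maximalIdeal C = (Ideal.ofList gs).map φ ⊔ Ideal.span (Set.range w) := by
  induction i with
  | zero => exact ⟨[], rfl, by simp, by simpa using hb, r, s, Or.inr le_rfl, by simpa using hs⟩
  | succ i ih =>
    obtain ⟨gs, hlen, hgJ, hbd, a, w, haw, hw⟩ := ih (by omega)
    set G := Ideal.ofList gs with hG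
    obtain ⟨g, hgJ', hgP, hgE⟩ := avoid J (G ⊔ I) ((G.map φ ⊔ maximalIdeal C ^ 2).comap φ)
      (hrad.trans (Ideal.radical_mono (sup_le_sup_left le_sup_right _)))
    have hof : Ideal.ofList (g :: gs) = Ideal.span {g} ⊔ G := by
      rw [Ideal.ofList_cons]
    have hmap : (Ideal.ofList (g :: gs)).map φ = G.map φ ⊔ Ideal.span {φ g} := by
      rw [hof, Ideal.map_sup, Ideal.map_span, Set.image_singleton, sup_comm]
    have hφg : φ g ∈ maximalIdeal C := hJ (Ideal.mem_map_of_mem φ hgJ')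
    have hpad : ∀ {b : ℕ} (v : Fin b → C), maximalIdeal C = G.map φ ⊔ Ideal.span (Set.range v) →
        maximalIdeal C = (Ideal.ofList (g :: gs)).map φ ⊔ Ideal.span (Set.range v) := by
      intro b v hv
      rw [hmap, sup_right_comm, ← hv]
      exact (sup_eq_left.2 ((Ideal.span_singleton_le_iff_mem _).2 hφg)).symm
    refine ⟨g :: gs, by simp [hlen], ?_, ?_, ?_⟩
    · rw [hof]; exact sup_le ((Ideal.span_singleton_le_iff_mem _).2 hgJ') hgJ
    · rw [hof, sup_assoc]
      refine bnd_step ?_ hgP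
      have : h - (i + 1) + 1 = h - i := by omega
      rwa [this]
    · rcases haw with ha | ha
      · exact ⟨a, w, Or.inl ha, hpad w hw⟩
      by_cases hJE : J ≤ (G.map φ ⊔ maximalIdeal C ^ 2).comap φ
      · refine ⟨δ, s', Or.inl le_rfl, hpad s' ?_⟩
        have h1 : J.map φ ≤ G.map φ ⊔ maximalIdeal C ^ 2 := Ideal.map_le_iff_le_comap.2 hJE
        have hle : G.map φ ⊔ Ideal.span (Set.range s') ≤ maximalIdeal C := by
          refine sup_le ((Ideal.map_mono hgJ).trans hJ) ?_
          conv_rhs => rw [hs']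
          exact le_sup_right
        refine le_antisymm ?_ hle
        refine Submodule.le_of_le_smul_of_le_jacobson_bot (I := maximalIdeal C)
          (IsNoetherian.noetherian _) (IsLocalRing.maximalIdeal_le_jacobson _) ?_
        rw [smul_eq_mul, ← pow_two]
        calc maximalIdeal C = J.map φ ⊔ Ideal.span (Set.range s') := hs'
          _ ≤ (G.map φ ⊔ maximalIdeal C ^ 2) ⊔ Ideal.span (Set.range s') := sup_le_sup_right h1 _
          _ = _ := sup_right_comm _ _ _
      · have hgE' : φ g ∉ G.map φ ⊔ maximalIdeal C ^ 2 := hgE hJE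
        cases a with
        | zero =>
          exfalso
          apply hgE'
          refine Ideal.mem_sup_left ?_
          have : maximalIdeal C = G.map φ := by rw [hw]; simp
          rwa [← this]
        | succ a =>
          obtain ⟨v, hv⟩ := gen_exchange _ w hw (φ g) hφg hgE'
          exact ⟨a, v, Or.inr (by omega), by rw [hmap]; exact hv⟩

lemma dim_quot_le_add (I : Ideal C) (l : List C) (hl : Ideal.ofList l ≤ maximalIdeal C)
    (hI : I ≤ maximalIdeal C) :
    ringKrullDim (C ⧸ I) ≤ ringKrullDim (C ⧸ (Ideal.ofList l ⊔ I)) + l.length := by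
  induction l with
  | nil => rw [Ideal.ofList_nil, bot_sup_eq]; simp
  | cons z l ih =>
    rw [Ideal.ofList_cons] at hl
    have h1 := ih (le_sup_right.trans hl)
    have h2 : Ideal.ofList l ⊔ I ≤ maximalIdeal C := sup_le (le_sup_right.trans hl) hI
    have h3 := dim_quot_le_succ (Ideal.ofList l ⊔ I) z
      (ne_top_of_le_ne_top (Ideal.IsPrime.ne_top inferInstance) h2)
      ((Ideal.span_singleton_le_iff_mem _).1 (le_sup_left.trans hl))
    rw [Ideal.ofList_cons]
    have h4 : Ideal.span {z} ⊔ Ideal.ofList l ⊔ I = Ideal.ofList l ⊔ I ⊔ Ideal.span {z} := by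
      rw [sup_assoc, sup_comm]
    rw [h4]
    refine h1.trans ((add_le_add_left h3 _).trans (le_of_eq ?_))
    push_cast [List.length_cons]
    rw [add_assoc, add_comm (1 : WithBot ℕ∞)]

lemma regMod_append {I : Ideal W} {l l' : List W} (h : RegMod I (l ++ l')) :
    RegMod (I ⊔ Ideal.ofList l) l' := by
  induction l generalizing I with
  | nil => simpa using h
  | cons a l ih =>
    rw [Ideal.ofList_cons, ← sup_assoc]
    exact ih h.2

lemma regMod_ofFn {d : ℕ} {I : Ideal W} {x : Fin d → W} (h : RegMod I (List.ofFn x)) (i : Fin d)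
    (u : W) (hu : u * x i ∈ I ⊔ Ideal.span (x '' {j | j < i})) :
    u ∈ I ⊔ Ideal.span (x '' {j | j < i}) := by
  induction d generalizing I with
  | zero => exact i.elim0
  | succ d ih =>
    rw [List.ofFn_succ] at h
    revert hu
    refine Fin.cases ?_ (fun i => ?_) i
    · intro hu
      have : {j : Fin (d + 1) | j < 0} = ∅ := by ext j; simp
      rw [this, Set.image_empty, Ideal.span_empty, sup_bot_eq] at hu ⊢
      exact h.1 u (by rwa [mul_comm])
    · have hset : x '' {j | j < i.succ} = insert (x 0) ((fun k => x (Fin.succ k)) '' {j | j < i}) := by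
        ext a
        constructor
        · rintro ⟨j, hj, rfl⟩
          refine Fin.cases (fun _ => Or.inl rfl) (fun j hj => Or.inr ⟨j, ?_, rfl⟩) j hj
          simpa using hj
        · rintro (rfl | ⟨j, hj, rfl⟩)
          · exact ⟨0, by simp, rfl⟩
          · exact ⟨j.succ, by simpa using hj, rfl⟩
      intro hu
      rw [hset, Ideal.span_insert, ← sup_assoc] at hu ⊢
      exact ih h.2 i hu

/-- The key lemma: uniform colon killers from generic complete intersections. -/
theorem key {d h : ℕ} (hD : DD (h + d) (⊥ : Ideal W)) (J : Ideal W) (x : Fin d → W)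
    (hxm : ∀ i, x i ∈ maximalIdeal W)
    (hrad : maximalIdeal W ≤ (J ⊔ Ideal.span (Set.range x)).radical)
    (hb : Bnd h (Ideal.span (Set.range x)))
    (hJd : ∀ P ∈ J.minimalPrimes, ringKrullDim (W ⧸ P) = d)
    (Q : Ideal W) [Q.IsPrime] (hJQ : J ≤ Q)
    {r δ : ℕ} (s : Fin r → Localization.AtPrime Q)
    (hs : maximalIdeal (Localization.AtPrime Q) = Ideal.span (Set.range s))
    (hr : (r : WithBot ℕ∞) ≤ ringKrullDim (Localization.AtPrime Q))
    (s' : Fin δ → Localization.AtPrime Q)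
    (hs' : maximalIdeal (Localization.AtPrime Q) =
      J.map (algebraMap W (Localization.AtPrime Q)) ⊔ Ideal.span (Set.range s'))
    (hδ : (δ : WithBot ℕ∞) ≤
      ringKrullDim (Localization.AtPrime Q ⧸ J.map (algebraMap W (Localization.AtPrime Q)))) :
    ∃ t ∉ Q, ∀ N : ℕ, 0 < N → ∀ (i : Fin d) (u : W),
      u * x i ^ N ∈ J ⊔ Ideal.span ((fun j => x j ^ N) '' {j | j < i}) →
      t * u ∈ J ⊔ Ideal.span ((fun j => x j ^ N) '' {j | j < i}) := by
  classical
  let C := Localization.AtPrime Q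
  let φ : W →+* C := algebraMap W C
  have : IsNoetherianRing C := IsLocalization.isNoetherianRing Q.primeCompl C inferInstance
  have hJ : J.map φ ≤ maximalIdeal C := by rw [hs']; exact le_sup_left
  obtain ⟨gs, hlen, hgJ, hbd, a, w, haw, hw⟩ :=
    select φ J _ hrad hJ h hb s hs s' hs' h le_rfl
  rw [Nat.sub_self] at hbd
  set G := Ideal.ofList gs with hG
  have hGJ : G.map φ ≤ J.map φ := Ideal.map_mono hgJ
  have hGm : G.map φ ≤ maximalIdeal C := hGJ.trans hJ
  -- dimension bound
  have hdim : (a : WithBot ℕ∞) ≤ ringKrullDim (C ⧸ G.map φ) := by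
    rcases haw with ha | ha
    · refine le_trans (le_trans (by exact_mod_cast ha) hδ) ?_
      exact ringKrullDim_le_of_surjective (Ideal.Quotient.factor hGJ)
        (Ideal.Quotient.factor_surjective hGJ)
    · have h1 := dim_quot_le_add (⊥ : Ideal C) (gs.map φ)
        (by rw [← Ideal.map_ofList]; exact hGm) bot_le
      rw [← Ideal.map_ofList, sup_bot_eq, ringKrullDim_eq_of_ringEquiv (RingEquiv.quotientBot C),
        List.length_map, hlen] at h1
      have h2 := hr.trans h1
      have h3 : ((a + h : ℕ) : WithBot ℕ∞) ≤ ringKrullDim (C ⧸ G.map φ) + h :=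
        le_trans (by exact_mod_cast ha) h2
      generalize ringKrullDim (C ⧸ G.map φ) = D at h3
      cases D with
      | bot => simp at h3
      | coe D =>
        norm_cast at h3 ⊢
        cases D with
        | top => exact le_top
        | coe D => norm_cast at h3 ⊢; omega
  have hGp : (G.map φ).IsPrime := (regular_prime a _ w hw hdim).1
  have hJp : (J.map φ).IsPrime := (regular_prime δ _ s' hs' hδ).1
  have hmin : (J.map φ).comap φ ∈ J.minimalPrimes := by
    refine ⟨⟨Ideal.comap_isPrime φ _, Ideal.le_comap_map⟩, ?_⟩
    rintro P ⟨hP, hJP⟩ hPle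
    have hPQ : P ≤ Q := by
      refine hPle.trans ((Ideal.comap_mono hJ).trans ?_)
      exact (Localization.AtPrime.comap_maximalIdeal (I := Q)).le
    have hdis : Disjoint (Q.primeCompl : Set W) P :=
      Set.disjoint_left.2 fun z hz hzP => hz (hPQ hzP)
    have := IsLocalization.under_map_of_isPrime_disjoint Q.primeCompl C hP hdis
    calc (J.map φ).comap φ ≤ (P.map φ).comap φ := Ideal.comap_mono (Ideal.map_mono hJP)
      _ = P := this
      _ ≤ P := le_rfl
  -- every prime over G + (x) is maximal
  have hradG : maximalIdeal W ≤ (G ⊔ Ideal.span (Set.range x)).radical := by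
    rw [Ideal.radical_eq_sInf]
    refine le_sInf fun P hP => ?_
    have hPp : P.IsPrime := hP.2
    have h0 := hbd P hP.2 hP.1
    by_contra hn
    have hlt : P < maximalIdeal W :=
      lt_of_le_of_ne (IsLocalRing.le_maximalIdeal hPp.ne_top) (fun h => hn h.ge)
    have h1 := (dim_quot_succ_le hlt).trans h0
    rw [dim_quot_max] at h1
    norm_num at h1
  have hxl : Ideal.ofList (List.ofFn x) = Ideal.span (Set.range x) := by
    unfold Ideal.ofList; congr 1; ext a; simp [List.mem_ofFn]
  have hxle : Ideal.span (Set.range x) ≤ maximalIdeal W := by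
    rw [Ideal.span_le]; rintro _ ⟨i, rfl⟩; exact hxm i
  have hpJ : (G.map φ).comap φ = (J.map φ).comap φ := by
    by_contra hne
    have hlt : (G.map φ).comap φ < (J.map φ).comap φ :=
      lt_of_le_of_ne (Ideal.comap_mono hGJ) hne
    have hp : ((G.map φ).comap φ).IsPrime := Ideal.comap_isPrime φ _
    have h1 := dim_quot_succ_le hlt
    rw [hJd _ hmin] at h1
    have h2 := dim_quot_le_length ((G.map φ).comap φ) (List.ofFn x)
      (by
        rw [hxl]
        exact hradG.trans (Ideal.radical_mono (sup_le_sup_right Ideal.le_comap_map _)))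
      (by rw [hxl]; exact hxle)
    rw [List.length_ofFn] at h2
    have h3 := h1.trans h2
    norm_cast at h3
    omega
  have hJG : J ≤ (G.map φ).comap φ := by rw [hpJ]; exact Ideal.le_comap_map
  -- clear denominators
  obtain ⟨t, htQ, ht⟩ : ∃ t ∉ Q, ∀ z ∈ J, t * z ∈ G := by
    have hz : ∀ z ∈ J, ∃ t ∉ Q, t * z ∈ G := by
      intro z hz
      obtain ⟨t, ht⟩ := (IsLocalization.algebraMap_mem_map_algebraMap_iff Q.primeCompl C G z).1
        (hJG hz)
      exact ⟨t, ht.1, ht.2⟩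
    obtain ⟨S, hS⟩ := (IsNoetherian.noetherian J : J.FG)
    have hS' : ∀ z ∈ S, ∃ t ∉ Q, t * z ∈ G := fun z hzS => hz z (hS ▸ Submodule.subset_span hzS)
    choose! τ hτQ hτ using hS'
    refine ⟨∏ z ∈ S, τ z, ?_, ?_⟩
    · exact (Submonoid.prod_mem Q.primeCompl (fun z hzS => hτQ z hzS))
    · have : J ≤ Submodule.comap (LinearMap.mulLeft W (∏ z ∈ S, τ z)) G := by
        rw [← hS, Submodule.span_le]
        intro z hzS
        show (∏ z ∈ S, τ z) * z ∈ G
        rw [← Finset.mul_prod_erase S τ hzS, mul_right_comm]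
        exact G.mul_mem_right _ (hτ z hzS)
      exact fun z hz => this hz
  refine ⟨t, htQ, fun N hN i u hu => ?_⟩
  have hreg : RegMod (⊥ : Ideal W) (gs ++ List.ofFn fun j => x j ^ N) := by
    have hxl' : Ideal.ofList (List.ofFn fun j => x j ^ N) =
        Ideal.span (Set.range fun j => x j ^ N) := by
      unfold Ideal.ofList; congr 1; ext a; simp [List.mem_ofFn]
    refine regMod_of_DD _ _ (by simpa [hlen] using hD) ?_ ?_
    · rw [bot_sup_eq, Ideal.ofList_append, hxl']
      rw [← Ideal.radical_idem]
      refine hradG.trans ((Ideal.radical_isRadical _).radical_le_iff.2 (sup_le ?_ ?_))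
      · exact le_sup_left.trans (Ideal.le_radical.trans Ideal.le_radical)
      · rw [Ideal.span_le]
        rintro _ ⟨j, rfl⟩
        refine Ideal.le_radical ⟨N, Ideal.mem_sup_right (Ideal.subset_span ⟨j, rfl⟩)⟩
    · rw [Ideal.ofList_append, hxl']
      refine sup_le (hgJ.trans (hJQ.trans (IsLocalRing.le_maximalIdeal
        (Ideal.IsPrime.ne_top inferInstance)))) ?_
      rw [Ideal.span_le]; rintro _ ⟨j, rfl⟩
      exact Ideal.pow_mem_of_mem _ (hxm j) N hN
  have hreg' := regMod_append hreg
  rw [bot_sup_eq] at hreg'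
  refine sup_le_sup_right hgJ _ (regMod_ofFn hreg' i (t * u) ?_)
  obtain ⟨z, hz, v, hv, hzv⟩ := Submodule.mem_sup.1 hu
  rw [mul_assoc, ← hzv, mul_add]
  exact add_mem (Ideal.mem_sup_left (ht z hz)) (Ideal.mem_sup_right (Ideal.mul_mem_left _ _ hv))

end select

end TCB

end

section
/-! ### Power series rings -/

namespace TCB

section cohen

variable {K T : Type*} [Field K] [CommRing T] [Algebra K T]

/-- The evaluation of power series modulo `I ^ k`. -/
noncomputable def evTrunc (I : Ideal T) {n : ℕ} (t : Fin n → T) (ht : ∀ i, t i ∈ I) (k : ℕ) :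
    MvPowerSeries (Fin n) K →+* T ⧸ I ^ k :=
  (Ideal.quotientMap (I ^ k) (MvPolynomial.aeval (R := K) t).toRingHom (by
    rw [← Ideal.map_le_iff_le_comap, Ideal.map_pow]
    refine Ideal.pow_right_mono ?_ k
    rw [MvPolynomial.idealOfVars, Ideal.map_span, Ideal.span_le]
    rintro _ ⟨_, ⟨i, rfl⟩, rfl⟩
    simpa using ht i)).comp (MvPowerSeries.truncTotalAlgHom (Fin n) K k).toRingHom

lemma evTrunc_apply (I : Ideal T) {n : ℕ} (t : Fin n → T) (ht : ∀ i, t i ∈ I) (k : ℕ)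
    (f : MvPowerSeries (Fin n) K) : evTrunc I t ht k f =
      Ideal.Quotient.mk (I ^ k) (MvPolynomial.aeval t (MvPowerSeries.truncTotal k f)) := rfl

lemma evTrunc_coe (I : Ideal T) {n : ℕ} (t : Fin n → T) (ht : ∀ i, t i ∈ I) (k : ℕ)
    (f : MvPolynomial (Fin n) K) : evTrunc I t ht k (f : MvPowerSeries (Fin n) K) =
      Ideal.Quotient.mk (I ^ k) (MvPolynomial.aeval t f) := by
  have h := (MvPowerSeries.truncTotalAlgHom (Fin n) K k).commutes f
  unfold evTrunc
  rw [RingHom.comp_apply]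
  refine (congrArg _ h).trans ?_
  rfl

lemma evTrunc_compat (I : Ideal T) {n : ℕ} (t : Fin n → T) (ht : ∀ i, t i ∈ I) {k l : ℕ}
    (hkl : k ≤ l) : (Ideal.Quotient.factorPow I hkl).comp (evTrunc (K := K) I t ht l) =
      evTrunc I t ht k := by
  ext f
  rw [RingHom.comp_apply, evTrunc_apply, evTrunc_apply]
  have h1 := MvPowerSeries.truncTotal_sub_truncTotal_mem_pow_idealOfVars hkl le_rfl f
  show Ideal.Quotient.mk (I ^ k) _ = _
  rw [Ideal.Quotient.eq, ← map_sub]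
  have h2 : (MvPolynomial.idealOfVars (Fin n) K ^ k).map (MvPolynomial.aeval (R := K) t).toRingHom
      ≤ I ^ k := by
    rw [Ideal.map_pow]
    refine Ideal.pow_right_mono ?_ k
    rw [MvPolynomial.idealOfVars, Ideal.map_span, Ideal.span_le]
    rintro _ ⟨_, ⟨i, rfl⟩, rfl⟩
    simpa using ht i
  exact h2 (Ideal.mem_map_of_mem _ h1)

theorem cohen (I : Ideal T) [IsAdicComplete I T] {n : ℕ} (t : Fin n → T)
    (hI : I = Ideal.span (Set.range t)) (hK : ∀ a : T, ∃ c : K, a - algebraMap K T c ∈ I) :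
    ∃ φ : MvPowerSeries (Fin n) K →+* T, Function.Surjective φ ∧
      ∀ i, φ (MvPowerSeries.X i) = t i := by
  have ht : ∀ i, t i ∈ I := fun i => by rw [hI]; exact Ideal.subset_span ⟨i, rfl⟩
  let φ : MvPowerSeries (Fin n) K →+* T :=
    IsAdicComplete.liftRingHom I (evTrunc I t ht) (fun h => evTrunc_compat I t ht h)
  have hφ : ∀ k f, Ideal.Quotient.mk (I ^ k) (φ f) = evTrunc I t ht k f :=
    fun k f => IsAdicComplete.mk_liftRingHom I _ _ k f
  have hpoly : ∀ f : MvPolynomial (Fin n) K, φ f = MvPolynomial.aeval t f := by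
    intro f
    rw [← sub_eq_zero]
    refine IsHausdorff.haus (inferInstance : IsHausdorff I T) _ fun k => ?_
    rw [SModEq.zero, smul_eq_mul, Ideal.mul_top, ← Ideal.Quotient.eq, hφ, evTrunc_coe]
  have hX : ∀ i, φ (MvPowerSeries.X i) = t i := by
    intro i
    rw [← MvPolynomial.coe_X, hpoly]; simp
  have hmap : (Ideal.span (Set.range MvPowerSeries.X) : Ideal (MvPowerSeries (Fin n) K)).map φ = I := by
    rw [Ideal.map_span, hI, ← Set.range_comp]
    congr 2
    ext i; exact hX i
  refine ⟨φ, ?_, hX⟩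
  have : IsHausdorff ((Ideal.span (Set.range MvPowerSeries.X) :
      Ideal (MvPowerSeries (Fin n) K)).map φ) T := by rw [hmap]; infer_instance
  apply surjective_of_mk_map_comp_surjective φ (I := Ideal.span (Set.range MvPowerSeries.X))
  intro a
  obtain ⟨a, rfl⟩ := Ideal.Quotient.mk_surjective a
  obtain ⟨c, hc⟩ := hK a
  refine ⟨MvPowerSeries.C c, ?_⟩
  rw [RingHom.comp_apply, Ideal.Quotient.eq, hmap, ← MvPolynomial.coe_C, hpoly,
    MvPolynomial.aeval_C, ← neg_mem_iff, neg_sub]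
  exact hc

end cohen

end TCB

end

section
/-! ### Regularity of power series rings -/

namespace TCB

theorem reg_of_gens {C : Type*} [CommRing C] [IsLocalRing C] [IsNoetherianRing C] {r : ℕ}
    (s : Fin r → C) (hs : maximalIdeal C = Ideal.span (Set.range s))
    (hr : (r : WithBot ℕ∞) ≤ ringKrullDim C) : IsRegularLocalRing C := by
  apply IsRegularLocalRing.of_spanFinrank_maximalIdeal_le
  refine le_trans ?_ hr
  rw [Nat.cast_le, hs]
  refine (Submodule.spanFinrank_span_le_ncard_of_finite (Set.finite_range s)).trans ?_
  rw [← Set.image_univ]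
  refine (Set.ncard_image_le Set.finite_univ).trans ?_
  simp

theorem gens_of_reg (C : Type*) [CommRing C] [IsRegularLocalRing C] :
    ∃ (r : ℕ) (s : Fin r → C), maximalIdeal C = Ideal.span (Set.range s) ∧
      (r : WithBot ℕ∞) = ringKrullDim C := by
  have h := (isRegularLocalRing_iff C).mp inferInstance
  obtain ⟨t, ht, ht'⟩ :=
    Submodule.FG.exists_span_finset_card_eq_spanFinrank (maximalIdeal C).fg_of_isNoetherianRing
  refine ⟨t.card, fun i => (t.equivFin.symm i : C), ?_, ?_⟩
  · rw [← ht', Ideal.span]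
    congr 1
    ext x
    constructor
    · intro hx
      exact ⟨t.equivFin ⟨x, hx⟩, by simp⟩
    · rintro ⟨i, rfl⟩
      exact (t.equivFin.symm i).2
  · rw [← h, ht]

attribute [local instance] Polynomial.algebra Polynomial.isLocalization in
open Polynomial in
theorem poly_height {A : Type*} [CommRing A] [IsNoetherianRing A] (P : Ideal (Polynomial A))
    [P.IsPrime] : P.height ≤ (P.comap Polynomial.C).height + 1 := by
  set p := P.comap Polynomial.C with hp
  let Rₚ := Localization.AtPrime p
  let P' : Ideal Rₚ[X] := P.map (algebraMap A[X] Rₚ[X])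
  have disj : Disjoint (p.primeCompl.map C : Set A[X]) P := by
    refine Set.disjoint_left.mpr fun a ⟨b, hb⟩ ha ↦ hb.1 ?_
    rw [hp, SetLike.mem_coe, Ideal.mem_comap]
    have h2 : Polynomial.C b = a := hb.2
    rw [h2]
    exact ha
  have hP' : P'.IsPrime :=
    IsLocalization.isPrime_of_isPrime_disjoint (p.primeCompl.map C) _ _ ‹_› disj
  have eq2 : P.height = P'.height := by
    rw [IsLocalization.height_map_of_disjoint (Submonoid.map C <| p.primeCompl) _ disj]
  have h1 := Ideal.height_le_ringKrullDim_of_ne_top hP'.ne_top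
  rw [Polynomial.ringKrullDim_of_isNoetherianRing] at h1
  have h2 : ringKrullDim Rₚ = p.height := by
    rw [IsLocalization.AtPrime.ringKrullDim_eq_height p Rₚ]
  rw [h2] at h1
  rw [eq2]
  exact_mod_cast h1

theorem ps_mem_map {A : Type*} [CommRing A] [IsNoetherianRing A] (I : Ideal A) (f : PowerSeries A)
    (hf : ∀ n, PowerSeries.coeff n f ∈ I) : f ∈ I.map (PowerSeries.C (R := A)) := by
  obtain ⟨n, s, hs⟩ := Submodule.fg_iff_exists_fin_generating_family.mp I.fg_of_isNoetherianRing
  have h : ∀ k, ∃ c : Fin n → A, ∑ i, c i • s i = PowerSeries.coeff k f := by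
    intro k
    have := hf k
    rw [← hs] at this
    exact (Submodule.mem_span_range_iff_exists_fun A).mp this
  choose c hc using h
  have : f = ∑ i, PowerSeries.mk (fun k => c k i) * PowerSeries.C (s i) := by
    ext k
    rw [map_sum, ← hc k]
    refine Finset.sum_congr rfl fun i _ => ?_
    rw [PowerSeries.coeff_mul_C, PowerSeries.coeff_mk, smul_eq_mul]
  rw [this]
  refine Ideal.sum_mem _ fun i _ => Ideal.mul_mem_left _ _ (Ideal.mem_map_of_mem _ ?_)
  rw [← hs]
  exact Submodule.subset_span ⟨i, rfl⟩

theorem ps_height {A : Type*} [CommRing A] [IsNoetherianRing A] (Q : Ideal (PowerSeries A))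
    [Q.IsPrime] (F : Polynomial A) (hF : F.Monic) (hFQ : (F : PowerSeries A) ∈ Q) :
    (Q.comap (PowerSeries.C (R := A))).height + 1 ≤ Q.height := by
  have hQ' : (Q.comap (PowerSeries.C (R := A))).IsPrime := inferInstance
  let φ : PrimeSpectrum A → PrimeSpectrum (PowerSeries A) := fun p =>
    ⟨RingHom.ker (PowerSeries.map (Ideal.Quotient.mk p.asIdeal)), by
      have := p.2
      exact RingHom.ker_isPrime _⟩
  have hmem : ∀ p f, f ∈ (φ p).asIdeal ↔ ∀ n, PowerSeries.coeff n f ∈ p.asIdeal := by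
    intro p f
    change f ∈ RingHom.ker (PowerSeries.map (Ideal.Quotient.mk p.asIdeal)) ↔ _
    rw [RingHom.mem_ker, PowerSeries.ext_iff]
    simp [Ideal.Quotient.eq_zero_iff_mem]
  have hmono : Monotone φ := by
    intro p q hpq f hf
    have hf' := (hmem _ _).1 hf
    refine (hmem _ _).2 ?_
    exact fun n => hpq (hf' n)
  have hinj : Function.Injective φ := by
    intro p q hpq
    ext a
    have h : ∀ p : PrimeSpectrum A, PowerSeries.C a ∈ (φ p).asIdeal ↔ a ∈ p.asIdeal := by
      intro p
      rw [hmem]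
      constructor
      · intro h; simpa using h 0
      · intro h n
        rw [PowerSeries.coeff_C]
        split_ifs
        · exact h
        · exact zero_mem _
    rw [← h, hpq, h]
  have h1 := Order.height_le_height_apply_of_strictMono φ (hmono.strictMono_of_injective hinj)
    ⟨_, hQ'⟩
  set q := φ ⟨_, hQ'⟩ with hq
  have h2 : q.asIdeal < Q := by
    refine lt_of_le_of_ne ?_ ?_
    · intro f hf
      have := ps_mem_map (Q.comap (PowerSeries.C (R := A))) f ((hmem _ _).1 hf)
      exact Ideal.map_comap_le this
    · intro h
      rw [← h, hmem] at hFQ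
      have := hFQ F.natDegree
      rw [Polynomial.coeff_coe, hF.coeff_natDegree] at this
      exact hQ'.ne_top ((Ideal.eq_top_iff_one _).2 this)
  have hqp : q.asIdeal.IsPrime := q.2
  have h3 := Ideal.height_add_one_le_of_lt_of_isPrime h2
  refine le_trans ?_ h3
  gcongr
  rw [← PrimeSpectrum.height_eq_orderHeight, ← PrimeSpectrum.height_eq_orderHeight] at h1
  exact h1

theorem ps_reg {A : Type*} [CommRing A] [IsLocalRing A] [IsRegularRing A]
    [IsAdicComplete (maximalIdeal A) A] (Q : Ideal (PowerSeries A)) [Q.IsPrime]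
    [IsNoetherianRing (PowerSeries A)]
    (g : PowerSeries A) (hgQ : g ∈ Q) (hg : g.map (residue A) ≠ 0) :
    IsRegularLocalRing (Localization.AtPrime Q) := by
  obtain ⟨F, u, hFu⟩ := PowerSeries.exists_isWeierstrassFactorization hg
  have hFQ : (F : PowerSeries A) ∈ Q := by
    rw [hFu.eq_mul, mul_comm] at hgQ
    exact (Ideal.unit_mul_mem_iff_mem _ hFu.isUnit).1 hgQ
  have hF := hFu.isDistinguishedAt.monic
  set ι := Polynomial.coeToPowerSeries.ringHom (R := A) with hι
  set P := Q.comap ι with hP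
  have hQP : Q = P.map ι := by
    refine le_antisymm ?_ Ideal.map_comap_le
    intro f hf
    obtain ⟨q, r, hqr⟩ := PowerSeries.exists_isWeierstrassDivision (f := f) hg
    have hr : r ∈ P := by
      change (r : PowerSeries A) ∈ Q
      have : (r : PowerSeries A) = f - g * q := by rw [hqr.eq_mul_add]; ring
      rw [this]
      exact sub_mem hf (Ideal.mul_mem_right _ _ hgQ)
    rw [hqr.eq_mul_add, hFu.eq_mul]
    refine add_mem (Ideal.mul_mem_right _ _ (Ideal.mul_mem_right _ _ ?_)) ?_
    · exact Ideal.mem_map_of_mem ι (show F ∈ P from hFQ)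
    · exact Ideal.mem_map_of_mem ι hr
  have hcomap : P.comap Polynomial.C = Q.comap (PowerSeries.C (R := A)) := by
    ext a
    simp [hP, hι, Ideal.mem_comap]
  obtain ⟨r, s, hs, hr⟩ := gens_of_reg (Localization.AtPrime P)
  let θ : Localization.AtPrime P →+* Localization.AtPrime Q :=
    Localization.localRingHom P Q ι rfl
  refine reg_of_gens (fun i => θ (s i)) ?_ ?_
  · have h1 : Ideal.span (Set.range fun i => θ (s i)) = (maximalIdeal _).map θ := by
      rw [hs, Ideal.map_span, ← Set.range_comp]
      rfl
    rw [h1, ← Localization.AtPrime.map_eq_maximalIdeal (I := P),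
      ← Localization.AtPrime.map_eq_maximalIdeal (I := Q), Ideal.map_map]
    have h2 : θ.comp (algebraMap _ _) = (algebraMap _ (Localization.AtPrime Q)).comp ι := by
      refine RingHom.ext fun a => ?_
      exact Localization.localRingHom_to_map P Q ι rfl a
    rw [h2, ← Ideal.map_map, ← hQP]
  · rw [hr, IsLocalization.AtPrime.ringKrullDim_eq_height P (Localization.AtPrime P),
      IsLocalization.AtPrime.ringKrullDim_eq_height Q (Localization.AtPrime Q)]
    have h1 := poly_height P
    rw [hcomap] at h1
    exact_mod_cast h1.trans (ps_height Q F hF hFQ)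

end TCB

end

section
namespace TCB

lemma ofList_ofFn {W : Type*} [CommRing W] {n : ℕ} (x : Fin n → W) :
    Ideal.ofList (List.ofFn x) = Ideal.span (Set.range x) := by
  unfold Ideal.ofList; congr 1; ext a; simp only [List.mem_ofFn', Set.mem_ofPred_eq]

section mps
variable (K : Type*) [Field K]

lemma mps_mem_span (n : ℕ) : ∀ f : MvPowerSeries (Fin n) K, MvPowerSeries.constantCoeff f = 0 →
    f ∈ Ideal.span (Set.range (MvPowerSeries.X (R := K) (σ := Fin n))) := by
  induction n with
  | zero =>
    intro f hf
    have : f = 0 := by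
      ext m
      rw [Subsingleton.elim m 0]
      simpa using hf
    rw [this]; exact zero_mem _
  | succ n ih =>
    intro f hf
    let e := MvPowerSeries.finSuccEquiv K n
    set F := e f with hF
    obtain ⟨G, hG⟩ : ∃ G, F - PowerSeries.C (PowerSeries.constantCoeff F) = PowerSeries.X * G := by
      have := (PowerSeries.X_dvd_iff (φ := F - PowerSeries.C (PowerSeries.constantCoeff F))).2
        (by simp)
      exact this
    have h0 : MvPowerSeries.constantCoeff (PowerSeries.constantCoeff F) = 0 := by
      have := MvPowerSeries.coeff_coeff_finSuccEquiv f (k := 0) (x := 0)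
      rw [← hf]
      rw [← PowerSeries.coeff_zero_eq_constantCoeff_apply,
        ← MvPowerSeries.coeff_zero_eq_constantCoeff_apply,
        ← MvPowerSeries.coeff_zero_eq_constantCoeff_apply, hF, this]
      congr 1
      simp
    have h1 := ih _ h0
    have h2 : e.symm (PowerSeries.C (PowerSeries.constantCoeff F)) ∈
        Ideal.span (Set.range (MvPowerSeries.X (R := K) (σ := Fin (n+1)))) := by
      have h3 := Ideal.mem_map_of_mem (e.symm.toRingEquiv.toRingHom.comp PowerSeries.C) h1
      rw [Ideal.map_span] at h3
      refine (Ideal.span_le.2 ?_) h3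
      rintro _ ⟨_, ⟨j, rfl⟩, rfl⟩
      refine Ideal.subset_span ⟨j.succ, ?_⟩
      change _ = e.symm (PowerSeries.C (MvPowerSeries.X j))
      rw [AlgEquiv.eq_symm_apply]
      exact MvPowerSeries.finSuccEquiv_X_succ j
    have h4 : f = MvPowerSeries.X 0 * e.symm G +
        e.symm (PowerSeries.C (PowerSeries.constantCoeff F)) := by
      apply e.injective
      rw [map_add, map_mul, AlgEquiv.apply_symm_apply, AlgEquiv.apply_symm_apply]
      have : e (MvPowerSeries.X 0) = PowerSeries.X := MvPowerSeries.finSuccEquiv_X_zero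
      rw [this, ← hG]; ring
    rw [h4]
    exact add_mem (Ideal.mul_mem_right _ _ (Ideal.subset_span ⟨0, rfl⟩)) h2

lemma mps_max (n : ℕ) : maximalIdeal (MvPowerSeries (Fin n) K) =
    Ideal.span (Set.range (MvPowerSeries.X (R := K) (σ := Fin n))) := by
  refine le_antisymm ?_ ?_
  · intro f hf
    apply mps_mem_span
    by_contra h
    rw [mem_maximalIdeal, mem_nonunits_iff, MvPowerSeries.isUnit_iff_constantCoeff] at hf
    exact hf (isUnit_iff_ne_zero.2 h)
  · rw [Ideal.span_le]
    rintro _ ⟨i, rfl⟩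
    rw [SetLike.mem_coe, mem_maximalIdeal, mem_nonunits_iff, MvPowerSeries.isUnit_iff_constantCoeff]
    simp

instance mps_complete (n : ℕ) : IsAdicComplete (maximalIdeal (MvPowerSeries (Fin n) K))
    (MvPowerSeries (Fin n) K) := by
  rw [mps_max]; infer_instance

lemma ps_dim (A : Type*) [CommRing A] [IsLocalRing A] [IsNoetherianRing A] :
    ringKrullDim A + 1 ≤ ringKrullDim (PowerSeries A) := by
  have hX : ((Polynomial.X : Polynomial A) : PowerSeries A) ∈ maximalIdeal (PowerSeries A) := by
    rw [mem_maximalIdeal, mem_nonunits_iff, Polynomial.coe_X, PowerSeries.isUnit_iff_constantCoeff]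
    simp
  have h := ps_height (maximalIdeal (PowerSeries A)) Polynomial.X Polynomial.monic_X hX
  have h1 : (maximalIdeal (PowerSeries A)).comap (PowerSeries.C (R := A)) = maximalIdeal A := by
    ext a
    rw [Ideal.mem_comap, mem_maximalIdeal, mem_maximalIdeal, mem_nonunits_iff, mem_nonunits_iff,
      PowerSeries.isUnit_iff_constantCoeff]
    simp
  rw [h1] at h
  rw [← maximalIdeal_height_eq_ringKrullDim, ← maximalIdeal_height_eq_ringKrullDim]
  exact_mod_cast h

lemma mps_dim (n : ℕ) : (n : WithBot ℕ∞) ≤ ringKrullDim (MvPowerSeries (Fin n) K) := by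
  induction n with
  | zero => exact ringKrullDim_nonneg_of_nontrivial
  | succ n ih =>
    rw [ringKrullDim_eq_of_ringEquiv (MvPowerSeries.finSuccEquiv K n).toRingEquiv]
    refine le_trans ?_ (ps_dim _)
    push_cast
    gcongr

lemma bnd_of_rad {W : Type*} [CommRing W] [IsLocalRing W] [IsNoetherianRing W] (I : Ideal W)
    (h : Bnd 0 I) : maximalIdeal W ≤ I.radical := by
  rw [Ideal.radical_eq_sInf]
  refine le_sInf fun P hP => ?_
  have hp := hP.2
  by_contra hn
  have hlt : P < maximalIdeal W := lt_of_le_of_ne (le_maximalIdeal hp.ne_top) (fun h => hn h.ge)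
  have h1 := dim_quot_succ_le hlt
  have h2 := h P hp hP.1
  rw [dim_quot_max] at h1
  have := h1.trans h2
  norm_num at this

theorem mps_reg (n : ℕ) : IsRegularRing (MvPowerSeries (Fin n) K) := by
  induction n with
  | zero =>
    exact IsRegularRing.of_ringEquiv (MvPowerSeries.isEmptyEquiv (σ := Fin 0) (R := K)).toRingEquiv.symm
  | succ n ih =>
    rw [isRegularRing_iff]
    intro Q hQ
    by_cases hQ0 : Q = ⊥
    · subst hQ0
      refine reg_of_gens (r := 0) Fin.elim0 ?_ ringKrullDim_nonneg_of_nontrivial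
      rw [← Localization.AtPrime.map_eq_maximalIdeal, Ideal.map_bot]
      simp
    let W := MvPowerSeries (Fin (n+1)) K
    obtain ⟨f, hfQ, hf0⟩ : ∃ f : W, f ∈ Q ∧ f ≠ 0 := Submodule.exists_mem_ne_zero_of_ne_bot hQ0
    have hdimle : ringKrullDim W ≤ (n + 1 : ℕ) := by
      have h := dim_quot_le_length (⊥ : Ideal W) (List.ofFn (MvPowerSeries.X (R := K))) (by
        rw [bot_sup_eq]
        refine le_trans (le_of_eq ?_) Ideal.le_radical
        rw [mps_max, ofList_ofFn]) (by
        rw [mps_max, ofList_ofFn])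
      rw [List.length_ofFn] at h
      rwa [ringKrullDim_eq_of_ringEquiv (RingEquiv.quotientBot W)] at h
    have hb : Bnd n (Ideal.span {f}) := by
      intro P hP hfP
      have hlt : (⊥ : Ideal W) < P := by
        rw [bot_lt_iff_ne_bot]
        rintro rfl
        exact hf0 (by simpa using hfP)
      have h1 := dim_quot_succ_le hlt
      rw [ringKrullDim_eq_of_ringEquiv (RingEquiv.quotientBot W)] at h1
      have h2 := h1.trans hdimle
      generalize ringKrullDim (W ⧸ P) = D at h2
      cases D with
      | bot => exact bot_le
      | coe D =>
        norm_cast at h2 ⊢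
        exact (ENat.add_le_add_iff_right (k := 1) (by simp)).1 (by exact_mod_cast h2)
    obtain ⟨gs, hlen, -, hb0, a, w, haw, hw⟩ := select (RingHom.id W) (maximalIdeal W)
      (Ideal.span {f}) (le_sup_left.trans Ideal.le_radical) (by rw [Ideal.map_id]) n hb
      (MvPowerSeries.X (R := K)) (mps_max K (n+1)) (δ := 0) Fin.elim0 (by simp [Ideal.map_id]) n le_rfl
    rw [Ideal.map_id] at hw
    obtain ⟨z, hz⟩ : ∃ z, Ideal.span (Set.range w) = Ideal.span {z} := by
      have : a = 0 ∨ a = 1 := by omega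
      rcases this with rfl | rfl
      · exact ⟨0, by simp⟩
      · refine ⟨w 0, ?_⟩
        congr 1
        ext x; simp [Set.range_unique]
    rw [hz] at hw
    let t : Fin (n+1) → W := Fin.cons z (fun j => gs.get (j.cast hlen.symm))
    have hofl : Ideal.ofList gs = Ideal.span (Set.range fun j : Fin n => gs.get (j.cast hlen.symm)) := by
      unfold Ideal.ofList; congr 1
      ext x
      constructor
      · intro hx
        obtain ⟨i, rfl⟩ := List.get_of_mem hx
        exact ⟨i.cast hlen, rfl⟩
      · rintro ⟨i, rfl⟩
        exact List.get_mem _ _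
    have ht : maximalIdeal W = Ideal.span (Set.range t) := by
      rw [Fin.range_cons, Ideal.span_insert, hw, hofl, sup_comm]
    obtain ⟨φ, hφs, hφX⟩ := cohen (K := K) (maximalIdeal W) t ht (by
      intro a
      refine ⟨MvPowerSeries.constantCoeff a, ?_⟩
      rw [mps_max]
      apply mps_mem_span
      rw [MvPowerSeries.algebraMap_apply]
      simp)
    have hφi : Function.Injective φ := by
      rw [RingHom.injective_iff_ker_eq_bot]
      by_contra hne
      have h1 := dim_quot_succ_le (bot_lt_iff_ne_bot.2 hne)
      rw [ringKrullDim_eq_of_ringEquiv (RingHom.quotientKerEquivOfSurjective hφs),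
        ringKrullDim_eq_of_ringEquiv (RingEquiv.quotientBot W),
        le_antisymm hdimle (mps_dim K (n+1))] at h1
      norm_cast at h1
      omega
    let e : W ≃+* W := RingEquiv.ofBijective φ ⟨hφi, hφs⟩
    let ψ : PowerSeries (MvPowerSeries (Fin n) K) ≃+* W :=
      (MvPowerSeries.finSuccEquiv K n).symm.toRingEquiv.trans e
    have hψ : ∀ j, ψ (PowerSeries.C (MvPowerSeries.X j)) = gs.get (j.cast hlen.symm) := by
      intro j
      change φ ((MvPowerSeries.finSuccEquiv K n).symm (PowerSeries.C (MvPowerSeries.X j))) = _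
      rw [← MvPowerSeries.finSuccEquiv_X_succ, AlgEquiv.symm_apply_apply, hφX]
      rfl
    have hg : (ψ.symm f).map (residue _) ≠ 0 := by
      intro h0
      have h1 := ps_mem_map (maximalIdeal (MvPowerSeries (Fin n) K)) (ψ.symm f) (by
        intro k
        have := congrArg (PowerSeries.coeff k) h0
        rw [PowerSeries.coeff_map, map_zero] at this
        exact (residue_eq_zero_iff _).1 this)
      have h2 := Ideal.mem_map_of_mem ψ.toRingHom h1
      rw [Ideal.map_map, mps_max, Ideal.map_span, ← Set.range_comp] at h2
      have h3 : f ∈ Ideal.ofList gs := by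
        rw [hofl]
        have h3' : f = ψ.toRingHom (ψ.symm f) := (ψ.apply_symm_apply f).symm
        rw [h3']
        refine (Ideal.span_mono ?_) h2
        rintro _ ⟨j, rfl⟩
        exact ⟨j, (hψ j).symm⟩
      have h4 : Ideal.ofList gs ⊔ Ideal.span {f} = Ideal.ofList gs := by
        rw [sup_eq_left, Ideal.span_le]; simpa using h3
      rw [h4, Nat.sub_self] at hb0
      have h5 := dim_quot_le_length (⊥ : Ideal W) gs (by
        rw [bot_sup_eq]; exact bnd_of_rad _ hb0) (by rw [hw]; exact le_sup_left)
      rw [ringKrullDim_eq_of_ringEquiv (RingEquiv.quotientBot W), hlen] at h5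
      have h6 := (mps_dim K (n+1)).trans h5
      rw [Nat.cast_le] at h6
      omega
    have hreg := ps_reg (Q.comap ψ.toRingHom) (ψ.symm f) (by
      rw [Ideal.mem_comap]
      change ψ (ψ.symm f) ∈ Q
      rwa [ψ.apply_symm_apply]) hg
    exact IsRegularLocalRing.of_ringEquiv
      (Localization.localRingEquiv (Q.comap ψ.toRingHom) Q ψ rfl)

theorem mps_DD (n : ℕ) : DD n (⊥ : Ideal (MvPowerSeries (Fin n) K)) := by
  refine (regular_prime n ⊥ (MvPowerSeries.X (R := K)) (by rw [mps_max, bot_sup_eq]) ?_).2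
  rw [ringKrullDim_eq_of_ringEquiv (RingEquiv.quotientBot _)]
  exact mps_dim K n

end mps

end TCB

end

section
/-! ### Descent of colon killers -/

namespace TCB

lemma ker_loc {W T : Type*} [CommRing W] [CommRing T] (φ : W →+* T) (hφ : Function.Surjective φ)
    (Q : Ideal T) [Q.IsPrime] (w : Localization.AtPrime (Q.comap φ))
    (hw : Localization.localRingHom (Q.comap φ) Q φ rfl w = 0) :
    w ∈ (RingHom.ker φ).map (algebraMap W (Localization.AtPrime (Q.comap φ))) := by
  obtain ⟨a, s, rfl⟩ := IsLocalization.exists_mk'_eq (Q.comap φ).primeCompl w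
  rw [Localization.localRingHom_mk', IsLocalization.mk'_eq_zero_iff] at hw
  obtain ⟨c, hc⟩ := hw
  obtain ⟨c', hc'⟩ := hφ c
  have hcQ : c' ∈ (Q.comap φ).primeCompl := by
    intro h
    have h2 : φ c' ∈ Q := h
    rw [hc'] at h2
    exact c.2 h2
  have h1 : c' * a ∈ RingHom.ker φ := by
    rw [RingHom.mem_ker, map_mul, hc', hc]
  have h2 := Ideal.mem_map_of_mem (algebraMap W (Localization.AtPrime (Q.comap φ))) h1
  rw [map_mul] at h2
  have h3 := (Ideal.unit_mul_mem_iff_mem _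
    (IsLocalization.map_units (Localization.AtPrime (Q.comap φ)) (⟨c', hcQ⟩ :
      (Q.comap φ).primeCompl))).1 h2
  rw [IsLocalization.mk'_eq_mul_mk'_one]
  exact Ideal.mul_mem_right _ _ h3

/-- The elements killing all the colons of powers of `x`. -/
def killer {T : Type*} [CommRing T] {d : ℕ} (x : Fin d → T) : Ideal T where
  carrier := {t | ∀ N : ℕ, 0 < N → ∀ (i : Fin d) (u : T),
    u * x i ^ N ∈ Ideal.span ((fun j => x j ^ N) '' {j | j < i}) →
    t * u ∈ Ideal.span ((fun j => x j ^ N) '' {j | j < i})}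
  add_mem' := by
    intro a b ha hb N hN i u hu
    rw [add_mul]
    exact add_mem (ha N hN i u hu) (hb N hN i u hu)
  zero_mem' := by
    intro N hN i u hu
    rw [zero_mul]; exact zero_mem _
  smul_mem' := by
    intro c a ha N hN i u hu
    rw [smul_eq_mul, mul_assoc]
    exact Ideal.mul_mem_left _ _ (ha N hN i u hu)

theorem killer_of_regular {K T : Type*} [Field K] [CommRing T] [IsLocalRing T]
    [IsNoetherianRing T] [Algebra K T]
    [IsAdicComplete (maximalIdeal T) T] (hK : ∀ a : T, ∃ c : K, a - algebraMap K T c ∈ maximalIdeal T)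
    {d : ℕ} (hequi : ∀ P ∈ minimalPrimes T, ringKrullDim (T ⧸ P) = d)
    (x : Fin d → T) (hxm : ∀ i, x i ∈ maximalIdeal T)
    (hx : maximalIdeal T ≤ (Ideal.span (Set.range x)).radical)
    (Q : Ideal T) [Q.IsPrime] [hreg : IsRegularLocalRing (Localization.AtPrime Q)] :
    ∃ t ∉ Q, t ∈ killer x := by
  obtain ⟨e, y, hy⟩ :=
    Submodule.fg_iff_exists_fin_generating_family.mp (maximalIdeal T).fg_of_isNoetherianRing
  have hy' : maximalIdeal T = Ideal.span (Set.range y) := hy.symm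
  have hgen : maximalIdeal T = Ideal.span (Set.range (Fin.append x y)) := by
    refine le_antisymm ?_ ?_
    · rw [hy']
      refine Ideal.span_mono ?_
      rintro _ ⟨i, rfl⟩
      exact ⟨Fin.natAdd d i, by simp⟩
    · rw [Ideal.span_le]
      rintro _ ⟨i, rfl⟩
      refine Fin.addCases (fun i => ?_) (fun i => ?_) i
      · simpa using hxm i
      · rw [Fin.append_right, hy']
        exact Ideal.subset_span ⟨i, rfl⟩
  obtain ⟨φ, hφs, hφX⟩ := cohen (K := K) (maximalIdeal T) (Fin.append x y) hgen hK
  let W := MvPowerSeries (Fin (d + e)) K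
  let J : Ideal W := RingHom.ker φ
  let x' : Fin d → W := fun i => MvPowerSeries.X (Fin.castAdd e i)
  have hφx : ∀ i, φ (x' i) = x i := fun i => by
    change φ (MvPowerSeries.X _) = _
    rw [hφX, Fin.append_left]
  have hXm : ∀ i, (MvPowerSeries.X i : W) ∈ maximalIdeal W := fun i => by
    rw [mps_max]; exact Ideal.subset_span ⟨i, rfl⟩
  have hmaxφ : ∀ w ∈ maximalIdeal W, φ w ∈ maximalIdeal T := by
    intro w hw
    have : (maximalIdeal W).map φ ≤ maximalIdeal T := by
      rw [mps_max, Ideal.map_span, Ideal.span_le]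
      rintro _ ⟨_, ⟨i, rfl⟩, rfl⟩
      rw [hφX, hgen]
      exact Ideal.subset_span ⟨i, rfl⟩
    exact this (Ideal.mem_map_of_mem φ hw)
  have hcomap : ∀ I : Ideal W, (I.map φ).comap φ = J ⊔ I := by
    intro I
    rw [Ideal.comap_map_of_surjective φ hφs, sup_comm]
    rfl
  have hspan : ∀ s : Set (Fin d), ∀ N : ℕ,
      (Ideal.span ((fun j => x' j ^ N) '' s)).map φ = Ideal.span ((fun j => x j ^ N) '' s) := by
    intro s N
    rw [Ideal.map_span, ← Set.image_comp]
    congr 2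
    ext j
    simp [hφx]
  have hmemiff : ∀ s : Set (Fin d), ∀ (N : ℕ) (w : W),
      φ w ∈ Ideal.span ((fun j => x j ^ N) '' s) ↔
        w ∈ J ⊔ Ideal.span ((fun j => x' j ^ N) '' s) := by
    intro s N w
    rw [← hcomap, hspan, Ideal.mem_comap]
  have hreg' := mps_reg K (d + e)
  have hJQ : J ≤ Q.comap φ := by
    intro w hw
    rw [Ideal.mem_comap, (RingHom.mem_ker).1 hw]; exact zero_mem _
  have hregQ : IsRegularLocalRing (Localization.AtPrime (Q.comap φ)) :=
    isRegularRing_iff.mp hreg' _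
  obtain ⟨r, s, hs, hr⟩ := gens_of_reg (Localization.AtPrime (Q.comap φ))
  obtain ⟨δ, s₀, hs₀, hδ⟩ := gens_of_reg (Localization.AtPrime Q)
  let θ := Localization.localRingHom (Q.comap φ) Q φ rfl
  have hθs : Function.Surjective θ := by
    intro z
    obtain ⟨a, b, rfl⟩ := IsLocalization.exists_mk'_eq Q.primeCompl z
    obtain ⟨a', ha'⟩ := hφs a
    obtain ⟨b', hb'⟩ := hφs b
    have hb : b' ∈ (Q.comap φ).primeCompl := by
      intro h
      have h2 : φ b' ∈ Q := h
      rw [hb'] at h2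
      exact b.2 h2
    refine ⟨IsLocalization.mk' _ a' ⟨b', hb⟩, ?_⟩
    change Localization.localRingHom (Q.comap φ) Q φ rfl _ = _
    rw [Localization.localRingHom_mk']
    subst ha'
    congr 1
    exact Subtype.ext hb'
  choose s' hs' using fun i => hθs (s₀ i)
  have hJθ : J.map (algebraMap W (Localization.AtPrime (Q.comap φ))) = RingHom.ker θ := by
    refine le_antisymm ?_ (fun w hw => ker_loc φ hφs Q w hw)
    rw [Ideal.map_le_iff_le_comap]
    intro w hw
    rw [Ideal.mem_comap, RingHom.mem_ker]
    change Localization.localRingHom (Q.comap φ) Q φ rfl _ = _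
    rw [Localization.localRingHom_to_map, (RingHom.mem_ker).1 hw, map_zero]
  have hmθ : maximalIdeal (Localization.AtPrime (Q.comap φ)) =
      (maximalIdeal (Localization.AtPrime Q)).comap θ := by
    have := Localization.isLocalHom_localRingHom (Q.comap φ) Q φ rfl
    have : IsLocalHom θ := this
    exact (IsLocalRing.maximalIdeal_comap θ).symm
  have hDD : ∀ k, k = d + e → DD k (⊥ : Ideal W) := by
    rintro _ rfl
    exact mps_DD K (d + e)
  obtain ⟨t, htQ, ht⟩ := key (W := W) (h := e) (hDD _ (add_comm e d)) J x'
    (fun i => hXm _) (by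
      intro w hw
      obtain ⟨k, hk⟩ := hx (hmaxφ w hw)
      refine ⟨k, ?_⟩
      rw [← hcomap, Ideal.mem_comap, map_pow, Ideal.map_span, ← Set.range_comp]
      convert hk using 4
      ext i; exact hφx i) (by
      intro P hP hxP
      have hle : Ideal.ofList (List.ofFn fun i : Fin e => (MvPowerSeries.X (Fin.natAdd d i) : W)) ≤
          maximalIdeal W := by
        rw [ofList_ofFn, Ideal.span_le]
        rintro _ ⟨i, rfl⟩
        exact hXm _
      have := dim_quot_le_length P
        (List.ofFn fun i : Fin e => (MvPowerSeries.X (Fin.natAdd d i) : W)) (by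
          refine le_trans ?_ Ideal.le_radical
          rw [mps_max, Ideal.span_le, ofList_ofFn]
          rintro _ ⟨i, rfl⟩
          refine Fin.addCases (fun i => ?_) (fun i => ?_) i
          · exact Ideal.mem_sup_left (hxP (Ideal.subset_span ⟨i, rfl⟩))
          · exact Ideal.mem_sup_right (Ideal.subset_span ⟨i, rfl⟩)) hle
      rwa [List.length_ofFn] at this) (by
      intro P hP
      have hJ : J = (⊥ : Ideal T).comap φ := rfl
      rw [hJ, Ideal.comap_minimalPrimes_eq_of_surjective hφs] at hP
      obtain ⟨P', hP', rfl⟩ := hP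
      rw [← hequi P' hP']
      have hsur : Function.Surjective ((Ideal.Quotient.mk P').comp φ) :=
        Ideal.Quotient.mk_surjective.comp hφs
      have hker : RingHom.ker ((Ideal.Quotient.mk P').comp φ) = P'.comap φ := by
        rw [← RingHom.comap_ker, Ideal.mk_ker]
      rw [← hker]
      exact ringKrullDim_eq_of_ringEquiv (RingHom.quotientKerEquivOfSurjective hsur))
    (Q.comap φ) hJQ s hs hr.le s' (by
      rw [hJθ, hmθ, hs₀]
      have : Ideal.span (Set.range s₀) = (Ideal.span (Set.range s')).map θ := by
        rw [Ideal.map_span, ← Set.range_comp]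
        congr 2
        ext1 i
        exact (hs' i).symm
      rw [this, Ideal.comap_map_of_surjective θ hθs, sup_comm]
      rfl) (by
      rw [hδ, hJθ]
      exact (ringKrullDim_eq_of_ringEquiv (RingHom.quotientKerEquivOfSurjective hθs)).ge)
  refine ⟨φ t, htQ, ?_⟩
  intro N hN i u hu
  obtain ⟨u', rfl⟩ := hφs u
  rw [← hφx, ← map_pow, ← map_mul, hmemiff] at hu
  have := ht N hN i u' hu
  rwa [← hmemiff, map_mul] at this

theorem colonKill_of {R T : Type*} [CommRing R] [IsNoetherianRing R] [CommRing T]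
    (j : R →+* T) (hj : ∀ I : Ideal R, (I.map j).comap j = I) {d : ℕ} (x : Fin d → R)
    (hQ : ∀ Q : Ideal T, Q.IsPrime → Q.comap j ∈ minimalPrimes R →
      ∃ t ∉ Q, t ∈ killer (fun i => j (x i))) :
    ∃ c ∈ circ R, ∀ (N : ℕ) (_ : 0 < N) (i : Fin d) (u : R),
      u * x i ^ N ∈ Ideal.span ((fun j => x j ^ N) '' {j | j < i}) →
      c * u ∈ Ideal.span ((fun j => x j ^ N) '' {j | j < i}) := by
  obtain ⟨c, hc, hck⟩ : ∃ c ∈ circ R, j c ∈ killer (fun i => j (x i)) := by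
    by_contra! hcon
    obtain ⟨Q, hQp, hle, hdis⟩ := Ideal.exists_le_prime_disjoint (killer fun i => j (x i))
      ((circ R).map j) (by
        rw [Set.disjoint_left]
        rintro _ h1 ⟨c, hc, rfl⟩
        exact hcon c hc h1)
    have hsub : ((Q.comap j : Ideal R) : Set R) ⊆ ⋃ P ∈ minimalPrimes R, (P : Set R) := by
      intro c hc
      by_contra hn
      have : c ∈ circ R := by
        rw [mem_circ]
        intro P hP hcP
        exact hn (Set.mem_biUnion hP hcP)
      exact Set.disjoint_left.1 hdis hc ⟨c, this, rfl⟩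
    have := (Ideal.subset_union_prime_finite (minimalPrimes.finite_of_isNoetherianRing R) (f := id)
      (⊤ : Ideal R) (⊤ : Ideal R) (fun P hP _ _ => Ideal.IsMinimalPrime.isPrime hP)).1 hsub
    obtain ⟨P, hP, hle'⟩ := this
    have heq : Q.comap j = P :=
      le_antisymm hle' (hP.2 ⟨Ideal.comap_isPrime j Q, bot_le⟩ hle')
    obtain ⟨t, ht, htk⟩ := hQ Q hQp (by rw [heq]; exact hP)
    exact ht (hle htk)
  have hspan : ∀ s : Set (Fin d), ∀ N : ℕ,
      (Ideal.span ((fun j => x j ^ N) '' s)).map j = Ideal.span ((fun i => j (x i) ^ N) '' s) := by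
    intro s N
    rw [Ideal.map_span, ← Set.image_comp]
    congr 2
    ext i
    simp
  refine ⟨c, hc, fun N hN i u hu => ?_⟩
  rw [← hj (Ideal.span _), Ideal.mem_comap, hspan, map_mul] at hu ⊢
  refine hck N hN i (j u) ?_
  rwa [map_pow] at hu

end TCB

end

section
/-! ### Coefficient fields -/

namespace TCB

theorem section_of_sq_zero (p : ℕ) [hp : Fact p.Prime] {P : Type*} {K : Type*} [CommRing P] [Field K]
    [CharP P p] (ρ : P →+* K) (hρ : Function.Surjective ρ)
    (hsq : ∀ x y, ρ x = 0 → ρ y = 0 → x * y = 0) : ∃ s : K →+* P, ∀ k, ρ (s k) = k := by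
  have hKc : CharP K p := by
    haveI : CharP P p := inferInstance
    refine (CharP.charP_iff_prime_eq_zero hp.out).2 ?_
    rw [← map_natCast ρ, CharP.cast_eq_zero, map_zero]
  have hpow : ∀ x, ρ x = 0 → x ^ p = 0 := fun x hx => by
    obtain ⟨n, hn⟩ := Nat.exists_eq_add_of_le hp.out.two_le
    rw [hn, pow_add, pow_two, hsq x x hx hx, zero_mul]
  let S : Set (Subring P) := {G | (frobenius P p).range ≤ G ∧ ∀ x ∈ G, ρ x = 0 → x = 0}
  have h0 : (frobenius P p).range ∈ S := by
    refine ⟨le_rfl, ?_⟩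
    rintro _ ⟨x, rfl⟩ hx
    rw [frobenius_def] at hx ⊢
    rw [map_pow] at hx
    exact hpow x (eq_zero_of_pow_eq_zero hx)
  obtain ⟨G, -, hG⟩ := zorn_le_nonempty₀ S (fun c hc hch y hy => by
    refine ⟨sSup c, ⟨(hc hy).1.trans (le_sSup hy), fun x hx h => ?_⟩, fun z hz => le_sSup hz⟩
    obtain ⟨z, hz, hxz⟩ := (Subring.mem_sSup_of_directedOn ⟨y, hy⟩ hch.directedOn).1 hx
    exact (hc hz).2 x hxz h) _ h0
  have hGF : ∀ x : P, x ^ p ∈ G := fun x => hG.prop.1 ⟨x, rfl⟩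
  have hG0 : ∀ x ∈ G, ρ x = 0 → x = 0 := hG.prop.2
  have hunit : ∀ x : P, ρ x ≠ 0 → ∃ y, x * y = 1 := fun x hx => by
    obtain ⟨z, hz⟩ := hρ (ρ x)⁻¹
    have h1 : ρ (1 - x * z) = 0 := by rw [map_sub, map_mul, hz, map_one, mul_inv_cancel₀ hx, sub_self]
    refine ⟨z * (1 + (1 - x * z)), ?_⟩
    linear_combination -hsq _ _ h1 h1
  haveI : Nontrivial P := ⟨0, 1, fun h => by simpa using congrArg ρ h⟩
  have hfield : IsField G := by
    refine ⟨⟨0, 1, zero_ne_one⟩, mul_comm, fun {a} ha => ?_⟩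
    have ha' : ρ a ≠ 0 := fun h => ha (Subtype.ext (hG0 a a.2 h))
    obtain ⟨y, hy⟩ := hunit a ha'
    obtain ⟨n, hn⟩ := Nat.exists_eq_add_of_le hp.out.one_le
    refine ⟨⟨(a : P) ^ n * y ^ p, G.mul_mem (G.pow_mem a.2 n) (hGF y)⟩, Subtype.ext ?_⟩
    change (a : P) * ((a : P) ^ n * y ^ p) = 1
    rw [← mul_assoc, ← pow_succ', add_comm n 1, ← hn, ← mul_pow, hy, one_pow]
  letI : Field G := hfield.toField
  let σ : G →+* K := ρ.comp G.subtype
  have hσ : Function.Surjective σ := by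
    intro k
    obtain ⟨b, rfl⟩ := hρ k
    by_contra hb
    push Not at hb
    let c : G := ⟨b ^ p, hGF b⟩
    have hirr : Irreducible (Polynomial.X ^ p - Polynomial.C c) := by
      refine X_pow_sub_C_irreducible_of_prime hp.out fun g hg => hb g ?_
      have h2 : (ρ g) ^ p = (ρ b) ^ p := by
        rw [← map_pow, ← map_pow]
        exact congrArg ρ (congrArg Subtype.val hg)
      exact frobenius_inj K p h2
    let ev := Polynomial.eval₂RingHom G.subtype b
    have hev0 : ev (Polynomial.X ^ p - Polynomial.C c) = 0 := by
      simp [ev, c]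
    have hle : G ≤ ev.range := fun x hx => ⟨Polynomial.C ⟨x, hx⟩, by simp [ev]⟩
    have hmem : ev.range ∈ S := by
      refine ⟨hG.prop.1.trans hle, ?_⟩
      rintro _ ⟨f, rfl⟩ hf
      by_cases hd : (Polynomial.X ^ p - Polynomial.C c) ∣ f
      · obtain ⟨q, rfl⟩ := hd
        rw [map_mul, hev0, zero_mul]
      · obtain ⟨u, v, huv⟩ := (hirr.coprime_iff_not_dvd).2 hd
        have := congrArg (fun t => ρ (ev t)) huv
        simp only [map_add, map_mul, hev0, hf, mul_zero, map_zero, add_zero, map_one] at this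
        exact absurd this zero_ne_one
    have hbG : b ∈ G := hG.le_of_ge hmem hle ⟨Polynomial.X, by simp [ev]⟩
    exact hb ⟨b, hbG⟩ rfl
  let e := RingEquiv.ofBijective σ ⟨σ.injective, hσ⟩
  refine ⟨G.subtype.comp e.symm.toRingHom, fun k => ?_⟩
  exact e.apply_symm_apply k

theorem smooth_of_field (p : ℕ) [hp : Fact p.Prime] (K : Type u) [Field K] [Algebra (ZMod p) K] :
    Algebra.FormallySmooth (ZMod p) K := by
  rw [Algebra.FormallySmooth.iff_comp_surjective]
  intro B _ _ I hI h
  rcases subsingleton_or_nontrivial B with hnt | hnt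
  · refine ⟨⟨⟨⟨⟨fun _ => 0, Subsingleton.elim _ _⟩, fun _ _ => Subsingleton.elim _ _⟩,
      Subsingleton.elim _ _, fun _ _ => Subsingleton.elim _ _⟩, fun _ => Subsingleton.elim _ _⟩, ?_⟩
    have : Subsingleton (B ⧸ I) := Ideal.Quotient.mk_surjective.subsingleton
    exact AlgHom.ext fun _ => Subsingleton.elim _ _
  have hI' : I ≠ ⊤ := by
    rintro rfl
    rw [pow_two, Ideal.top_mul] at hI
    exact bot_ne_top hI.symm
  have : Nontrivial (B ⧸ I) := Ideal.Quotient.nontrivial_iff.2 hI'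
  have hinj : Function.Injective h := h.toRingHom.injective
  let π := Ideal.Quotient.mkₐ (ZMod p) I
  let P : Subalgebra (ZMod p) B := h.range.comap π
  let e : K ≃ₐ[ZMod p] h.range := AlgEquiv.ofInjective h hinj
  let ρ0 : P →ₐ[ZMod p] h.range := (π.comp P.val).codRestrict h.range fun x => x.2
  let ρ : P →+* K := e.symm.toRingHom.comp ρ0.toRingHom
  have hρ1 : ∀ x : P, h (ρ x) = Ideal.Quotient.mk I x := fun x => by
    have h1 : e (ρ x) = ρ0 x := e.apply_symm_apply _
    exact congrArg Subtype.val h1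
  have : CharP P p := charP_of_injective_ringHom (algebraMap (ZMod p) P).injective p
  obtain ⟨s, hs⟩ := section_of_sq_zero p ρ (fun k => by
    obtain ⟨b, hb⟩ := Ideal.Quotient.mk_surjective (h k)
    refine ⟨⟨b, ⟨k, hb.symm⟩⟩, hinj ?_⟩
    rw [hρ1]; exact hb) (fun x y hx hy => by
    have h2 : ∀ z : P, ρ z = 0 → (z : B) ∈ I := fun z hz => by
      rw [← Ideal.Quotient.eq_zero_iff_mem, ← hρ1, hz, map_zero]
    have h3 : (x : B) * y ∈ I ^ 2 := by rw [pow_two]; exact Ideal.mul_mem_mul (h2 x hx) (h2 y hy)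
    rw [hI] at h3
    exact Subtype.ext h3)
  let t : K →+* B := P.val.toRingHom.comp s
  refine ⟨⟨t, fun r => RingHom.congr_fun (Subsingleton.elim (t.comp (algebraMap (ZMod p) K)) (algebraMap (ZMod p) B)) r⟩,
    AlgHom.ext fun k => ?_⟩
  have := hρ1 (s k)
  rw [hs] at this
  exact this.symm

theorem coeff_field (p : ℕ) [Fact p.Prime] (T : Type u) [CommRing T] [IsLocalRing T] [CharP T p]
    [IsAdicComplete (maximalIdeal T) T] :
    ∃ g : ResidueField T →+* T, ∀ a : T, a - g (residue T a) ∈ maximalIdeal T := by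
  letI : Algebra (ZMod p) T := ZMod.algebra T p
  letI : Algebra (ZMod p) (T ⧸ maximalIdeal T) := inferInstance
  letI : Field (T ⧸ maximalIdeal T) := Ideal.Quotient.field _
  have : Algebra.FormallySmooth (ZMod p) (T ⧸ maximalIdeal T) := smooth_of_field p _
  obtain ⟨g, hg⟩ := Algebra.FormallySmooth.exists_mkₐ_comp_eq_of_isAdicComplete (R := ZMod p)
    (A := T ⧸ maximalIdeal T) (S := T) (I := maximalIdeal T) (AlgHom.id _ _)
  refine ⟨g.toRingHom, fun a => ?_⟩
  have := congrArg (fun f => f (Ideal.Quotient.mk _ a)) hg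
  rw [← Ideal.Quotient.eq]
  exact this.symm

end TCB

end

section
/-! ### The completion -/

namespace TCB

variable (R : Type u) [CommRing R] [IsLocalRing R] [IsNoetherianRing R]

theorem colonKill_final (p : ℕ) [Fact p.Prime] [CharP R p]
    (hequi : IsEquidimensional (AdicCompletion (maximalIdeal R) R))
    (hreg : ∀ (Q : Ideal (AdicCompletion (maximalIdeal R) R)) [Q.IsPrime],
      Q.comap (algebraMap R _) ∈ minimalPrimes R → IsRegularLocalRing (Localization.AtPrime Q)) :
    ColonKill R := by
  let T := AdicCompletion (maximalIdeal R) R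
  let j := algebraMap R T
  have hmT : maximalIdeal T = (maximalIdeal R).map j := AdicCompletion.maximalIdeal_eq_map
  have hff : Module.FaithfullyFlat R T := Module.FaithfullyFlat.of_flat_of_isLocalHom
  have hj : ∀ I : Ideal R, (I.map j).comap j = I :=
    fun I => Ideal.comap_map_eq_self_of_faithfullyFlat (B := T) I
  have hinj : Function.Injective j := by
    rw [RingHom.injective_iff_ker_eq_bot, RingHom.ker_eq_comap_bot, ← Ideal.map_bot (f := j), hj]
  have hchar : CharP T p := charP_of_injective_ringHom hinj p
  obtain ⟨g, hg⟩ := coeff_field p T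
  letI : Algebra (ResidueField T) T := g.toAlgebra
  have hK : ∀ a : T, ∃ c : ResidueField T, a - algebraMap _ T c ∈ maximalIdeal T :=
    fun a => ⟨_, hg a⟩
  have hnoeth : IsNoetherianRing T := by
    obtain ⟨e, y, hy⟩ :=
      Submodule.fg_iff_exists_fin_generating_family.mp (maximalIdeal R).fg_of_isNoetherianRing
    have hy' : maximalIdeal R = Ideal.span (Set.range y) := hy.symm
    obtain ⟨φ, hφ, -⟩ := cohen (K := ResidueField T) (maximalIdeal T) (fun i => j (y i)) (by
      refine hmT.trans (((congrArg (Ideal.map j) hy').trans (Ideal.map_span j _)).trans ?_)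
      rw [← Set.range_comp]; rfl) hK
    exact isNoetherianRing_of_surjective _ _ φ hφ
  intro d x hx
  have hxm : ∀ i, x i ∈ maximalIdeal R := fun i => by
    rw [← hx.2]; exact Ideal.le_radical (Ideal.subset_span ⟨i, rfl⟩)
  have hjxm : ∀ i, j (x i) ∈ maximalIdeal T := fun i => by
    rw [hmT]; exact Ideal.mem_map_of_mem _ (hxm i)
  have hrad : maximalIdeal T ≤ (Ideal.span (Set.range fun i => j (x i))).radical := by
    refine (hmT.trans (congrArg (Ideal.map j) hx.2.symm)).le.trans ?_
    refine (Ideal.map_radical_le j).trans ?_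
    rw [Ideal.map_span, ← Set.range_comp]
    rfl
  have hdimT : ringKrullDim T = d := by
    refine le_antisymm ?_ ?_
    · obtain ⟨P, hP⟩ := Ideal.nonempty_minimalPrimes (bot_ne_top (α := Ideal T))
      have hPp : P.IsPrime := hP.1.1
      have h := dim_quot_le_length P (List.ofFn fun i => j (x i)) (by
        rw [ofList_ofFn]; exact hrad.trans (Ideal.radical_mono le_sup_right)) (by
        rw [ofList_ofFn, Ideal.span_le]
        rintro _ ⟨i, rfl⟩
        exact hjxm i)
      rw [List.length_ofFn, hequi P hP] at h
      exact h
    · rw [← hx.1, ← maximalIdeal_height_eq_ringKrullDim, ← maximalIdeal_height_eq_ringKrullDim]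
      have : (maximalIdeal T).LiesOver (maximalIdeal R) :=
        ⟨(IsLocalRing.maximalIdeal_comap (algebraMap R T)).symm⟩
      rw [Ideal.height_eq_height_add_of_liesOver_of_hasGoingDown (maximalIdeal R) (maximalIdeal T)]
      exact_mod_cast le_self_add
  refine colonKill_of j hj x fun Q hQp hQ => ?_
  have := hreg Q hQ
  exact killer_of_regular (K := ResidueField T) hK (fun P hP => (hequi P hP).trans hdimT)
    (fun i => j (x i)) hjxm hrad Q

end TCB

end

section
/-! ### Regularity of the generic formal fibres -/

namespace TCB

theorem reg_of_regLocal (C : Type*) [CommRing C] (h : IsRegularLocal C) : IsRegularLocalRing C := by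
  obtain ⟨h1, h2, d, x, hd, hx⟩ := h
  refine reg_of_gens x ?_ hd.ge
  rw [hx, IsLocalRing.jacobson_eq_maximalIdeal ⊥ bot_ne_top]

/-- The compatible family of maps defining the map between completions. -/
noncomputable def complFam {A A' : Type*} [CommRing A] [CommRing A'] (I : Ideal A) (I' : Ideal A')
    (e : A →+* A') (h : I ≤ I'.comap e) (n : ℕ) : AdicCompletion I A →+* A' ⧸ I' ^ n :=
  (Ideal.quotientMap (I' ^ n) e (by
      rw [← Ideal.map_le_iff_le_comap, Ideal.map_pow]
      exact Ideal.pow_right_mono (Ideal.map_le_iff_le_comap.2 h) n)).comp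
      (AdicCompletion.evalₐ I n).toRingHom

theorem complFam_compat {A A' : Type*} [CommRing A] [CommRing A'] (I : Ideal A) (I' : Ideal A')
    (e : A →+* A') (h : I ≤ I'.comap e) {m n : ℕ} (hmn : m ≤ n) :
    (Ideal.Quotient.factorPow I' hmn).comp (complFam I I' e h n) = complFam I I' e h m := by
  unfold complFam
  refine RingHom.ext fun x => ?_
  obtain ⟨a, rfl⟩ := AdicCompletion.mk_surjective I A x
  have h2 : a.1 n - a.1 m ∈ I ^ m := by
    have := a.2 hmn
    rw [SModEq.sub_mem] at this
    rw [← neg_sub, Ideal.neg_mem_iff]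
    simpa using this
  have h3 : e (a.1 n) - e (a.1 m) ∈ I' ^ m := by
    rw [← map_sub]
    have h4 := Ideal.mem_map_of_mem e h2
    rw [Ideal.map_pow] at h4
    exact Ideal.pow_right_mono (Ideal.map_le_iff_le_comap.2 h) m h4
  have h5 : ∀ k, (AdicCompletion.evalₐ I k).toRingHom (AdicCompletion.mk I A a) =
    Ideal.Quotient.mk _ (a.1 k) := fun k => AdicCompletion.evalₐ_mk I k a
  simp only [RingHom.comp_apply, h5, Ideal.quotientMap_mk]
  exact Ideal.Quotient.eq.2 h3

/-- Completion transport along a ring homomorphism. -/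
noncomputable def complMap {A A' : Type*} [CommRing A] [CommRing A'] (I : Ideal A) (I' : Ideal A')
    (e : A →+* A') (h : I ≤ I'.comap e) : AdicCompletion I A →+* AdicCompletion I' A' :=
  AdicCompletion.liftRingHom I' (complFam I I' e h) (complFam_compat I I' e h)

theorem complMap_eval {A A' : Type*} [CommRing A] [CommRing A'] (I : Ideal A) (I' : Ideal A')
    (e : A →+* A') (h : I ≤ I'.comap e) (x : AdicCompletion.AdicCauchySequence I A) (n : ℕ) :
    AdicCompletion.evalₐ I' n (complMap I I' e h (AdicCompletion.mk I A x)) =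
      Ideal.Quotient.mk _ (e (x.1 n)) := by
  refine (AdicCompletion.evalₐ_liftRingHom I' (complFam I I' e h) (complFam_compat I I' e h) n _).trans ?_
  have h5 : (AdicCompletion.evalₐ I n).toRingHom (AdicCompletion.mk I A x) =
      Ideal.Quotient.mk _ (x.1 n) := AdicCompletion.evalₐ_mk I n x
  simp only [complFam, RingHom.comp_apply, h5, Ideal.quotientMap_mk]

theorem complMap_inv {A A' : Type*} [CommRing A] [CommRing A'] (I : Ideal A) (I' : Ideal A')
    (e : A →+* A') (h : I ≤ I'.comap e) (e' : A' →+* A) (h' : I' ≤ I.comap e')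
    (hee : ∀ a, e' (e a) = a) (x : AdicCompletion I A) :
    complMap I' I e' h' (complMap I I' e h x) = x := by
  refine AdicCompletion.ext_evalₐ fun n => ?_
  obtain ⟨a, rfl⟩ := AdicCompletion.mk_surjective I A x
  obtain ⟨b, hb⟩ := AdicCompletion.mk_surjective I' A' (complMap I I' e h (AdicCompletion.mk I A a))
  have h1 := complMap_eval I I' e h a n
  rw [← hb, AdicCompletion.evalₐ_mk, Ideal.Quotient.eq] at h1
  rw [← hb, complMap_eval, AdicCompletion.evalₐ_mk, Ideal.Quotient.eq]
  have h2 := Ideal.mem_map_of_mem e' h1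
  rw [Ideal.map_pow] at h2
  have h3 := Ideal.pow_right_mono (Ideal.map_le_iff_le_comap.2 h') n h2
  rwa [map_sub, hee] at h3

theorem complMap_alg {A A' : Type*} [CommRing A] [CommRing A'] (I : Ideal A) (I' : Ideal A')
    (e : A →+* A') (h : I ≤ I'.comap e) (a : A) :
    complMap I I' e h (algebraMap A _ a) = algebraMap A' _ (e a) := by
  refine AdicCompletion.ext_evalₐ fun n => ?_
  refine (AdicCompletion.evalₐ_liftRingHom I' (complFam I I' e h) (complFam_compat I I' e h) n _).trans ?_
  rfl

section fiber

open TensorProduct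

attribute [local instance] Algebra.TensorProduct.rightAlgebra

theorem fiber_reg (A : Type u) (S : Type u) [CommRing A] [CommRing S] [Algebra A S]
    (q : Ideal A) [q.IsPrime] (hq : IsField (Localization.AtPrime q))
    (hgeo : IsGeometricallyRegular (ResidueField (Localization.AtPrime q))
      ((ResidueField (Localization.AtPrime q)) ⊗[A] S))
    (Q : Ideal S) [Q.IsPrime] (hQ : Q.comap (algebraMap A S) = q) :
    IsRegularLocalRing (Localization.AtPrime Q) := by
  let κ := ResidueField (Localization.AtPrime q)
  have hbij : Function.Bijective (residue (Localization.AtPrime q)) := by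
    refine ⟨?_, residue_surjective⟩
    letI := hq.toField
    exact (residue (Localization.AtPrime q)).injective
  let eκ : Localization.AtPrime q ≃ₐ[A] κ :=
    AlgEquiv.ofBijective (IsScalarTower.toAlgHom A (Localization.AtPrime q) κ) hbij
  have hloc : IsLocalization q.primeCompl κ := IsLocalization.isLocalization_of_algEquiv _ eκ
  let E := κ ⊗[A] S
  let M := Algebra.algebraMapSubmonoid S q.primeCompl
  have hE : IsLocalization M E := IsLocalization.tensorRight κ q.primeCompl
  have hdisj : Disjoint (M : Set S) (Q : Set S) := by
    rw [Set.disjoint_left]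
    rintro _ ⟨a, ha, rfl⟩ h
    exact ha (hQ ▸ h)
  let QE := Q.map (algebraMap S E)
  have hQE : QE.IsPrime := IsLocalization.isPrime_of_isPrime_disjoint M E Q ‹_› hdisj
  have hQc : QE.comap (algebraMap S E) = Q :=
    IsLocalization.under_map_of_isPrime_disjoint M E ‹_› hdisj
  have h1 := hgeo κ inferInstance
  let l : κ ⊗[κ] E ≃+* E := (Algebra.TensorProduct.lid κ E).toRingEquiv
  have h2 := reg_of_regLocal _ (h1.2 (QE.comap l) inferInstance)
  have h3 : IsRegularLocalRing (Localization.AtPrime QE) :=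
    IsRegularLocalRing.of_ringEquiv (R := Localization.AtPrime (QE.comap l))
      (Localization.localRingEquiv (QE.comap l) QE l rfl)
  have h4 : IsLocalization.AtPrime (Localization.AtPrime QE) (QE.comap (algebraMap S E)) :=
    IsLocalization.isLocalization_isLocalization_atPrime_isLocalization M _ QE
  have h5 : IsLocalization.AtPrime (Localization.AtPrime QE) Q := by
    simpa only [hQc] using h4
  exact IsRegularLocalRing.of_ringEquiv
    (IsLocalization.algEquiv Q.primeCompl (Localization.AtPrime QE) (Localization.AtPrime Q)).toRingEquiv

end fiber

theorem isField_of_min (A : Type*) [CommRing A] [IsReduced A] (q : Ideal A) [q.IsPrime]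
    (hq : q ∈ minimalPrimes A) : IsField (Localization.AtPrime q) := by
  have : Ring.KrullDimLE 0 (Localization.AtPrime q) := by
    rw [Ring.krullDimLE_iff, IsLocalization.AtPrime.ringKrullDim_eq_height q]
    have : q.height = 0 := Ideal.height_eq_zero_iff.2 hq
    simp [this]
  exact Ring.KrullDimLE.isField_of_isReduced

theorem reg_of_GRing (R : Type u) [CommRing R] [IsLocalRing R] [IsReduced R] (hG : IsGRing R)
    (Q : Ideal (AdicCompletion (maximalIdeal R) R)) [Q.IsPrime]
    (hQ : Q.comap (algebraMap R _) ∈ minimalPrimes R) :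
    IsRegularLocalRing (Localization.AtPrime Q) := by
  let A := Localization.AtPrime (maximalIdeal R)
  let e : R ≃ₐ[R] A := IsLocalization.atUnits R (maximalIdeal R).primeCompl fun x hx => by
    have : IsUnit x := by simpa [Ideal.primeCompl] using hx
    exact this
  let T := AdicCompletion (maximalIdeal R) R
  let T' := AdicCompletion (maximalIdeal A) A
  have hl : IsLocalHom e.toRingEquiv.toRingHom := ⟨fun a h => (MulEquiv.isUnit_map e).1 h⟩
  have hl' : IsLocalHom e.symm.toRingEquiv.toRingHom :=
    ⟨fun a h => (MulEquiv.isUnit_map e.symm).1 h⟩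
  have h1 : maximalIdeal R ≤ (maximalIdeal A).comap e.toRingEquiv.toRingHom :=
    ((IsLocalRing.maximalIdeal_comap e.toRingEquiv.toRingHom)).ge
  have h2 : maximalIdeal A ≤ (maximalIdeal R).comap e.symm.toRingEquiv.toRingHom :=
    ((IsLocalRing.maximalIdeal_comap e.symm.toRingEquiv.toRingHom)).ge
  let φ : T' →+* T := complMap _ _ e.symm.toRingEquiv.toRingHom h2
  let ψ : T →+* T' := complMap _ _ e.toRingEquiv.toRingHom h1
  let Φ : T' ≃+* T := RingEquiv.ofRingHom φ ψ
    (RingHom.ext fun x => complMap_inv _ _ _ _ _ _ (fun a => e.symm_apply_apply a) x)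
    (RingHom.ext fun x => complMap_inv _ _ _ _ _ _ (fun a => e.apply_symm_apply a) x)
  let Q' : Ideal T' := Q.comap Φ
  let q : Ideal A := Q'.comap (algebraMap A T')
  have hAred : IsReduced A := inferInstance
  have hqe : q.comap e.toRingEquiv.toRingHom = Q.comap (algebraMap R T) := by
    ext r
    change φ (algebraMap A T' (e r)) ∈ Q ↔ algebraMap R T r ∈ Q
    have := complMap_alg _ _ e.symm.toRingEquiv.toRingHom h2 (e r)
    have h3 : φ (algebraMap A T' (e r)) = algebraMap R T r :=
      this.trans (congrArg (algebraMap R T) (e.symm_apply_apply r))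
    rw [h3]
  have hq : q ∈ minimalPrimes A := by
    refine ⟨⟨inferInstance, bot_le⟩, fun J hJ hJq => ?_⟩
    have := hJ.1
    have h4 : J.comap e.toRingEquiv.toRingHom ≤ Q.comap (algebraMap R T) := by
      rw [← hqe]; exact Ideal.comap_mono hJq
    have h5 := hQ.2 ⟨inferInstance, bot_le⟩ h4
    intro a ha
    have h6 : e.symm a ∈ Q.comap (algebraMap R T) := by
      rw [← hqe]
      change e (e.symm a) ∈ q
      rwa [e.apply_symm_apply]
    have h7 : e (e.symm a) ∈ J := h5 h6
    rwa [e.apply_symm_apply] at h7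
  have h8 : IsRegularLocalRing (Localization.AtPrime Q') :=
    fiber_reg A T' q (isField_of_min A q hq) (hG (maximalIdeal R) inferInstance q inferInstance) Q' rfl
  exact IsRegularLocalRing.of_ringEquiv (R := Localization.AtPrime Q')
    (Localization.localRingEquiv Q' Q Φ rfl)

end TCB

end

/-- **Remark 2.3.** For an excellent local ring `R` of characteristic `p > 0` with `R̂`
reduced and equidimensional, there is a balanced big Cohen–Macaulay `R`-algebra `B`
with `I* = I^B` for all ideals `I`; in particular `B` satisfies (†) and the tight
Hilbert coefficients coincide with the BCM Hilbert coefficients with respect to `B`. -/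
theorem stmt16 (R : Type u) [CommRing R] [IsLocalRing R]
    (p : ℕ) (hp : p.Prime) [CharP R p]
    (hexc : IsExcellentRing R)
    (hred : IsReduced (AdicCompletion (maximalIdeal R) R))
    (hequi : IsEquidimensional (AdicCompletion (maximalIdeal R) R))
    (d : ℕ) (hd : ringKrullDim R = (d : WithBot ℕ∞)) :
    ∃ (B : Type u) (_ : CommRing B) (f : R →+* B),
      IsBalancedBigCMHom R f ∧
      (∀ I : Ideal R, tightClSet R p I = (contractedExt R f I : Set R)) ∧
      SatisfiesDagger R f ∧
      (∀ I : Ideal R, I.radical = maximalIdeal R →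
        ∀ (Jstar : ℕ → Ideal R), (∀ n, (Jstar n : Set R) = tightClSet R p (I ^ n)) →
        ∀ e : ℕ → ℤ,
          (HasHilbertSeries R d Jstar e ↔
            HasHilbertSeries R d (fun n => contractedExt R f (I ^ n)) e)) := by
  have hpf : Fact p.Prime := ⟨hp⟩
  have hN : IsNoetherianRing R := hexc.1
  have hRed : IsReduced R := by
    have hff : Module.FaithfullyFlat R (AdicCompletion (maximalIdeal R) R) :=
      Module.FaithfullyFlat.of_flat_of_isLocalHom
    have hj : ∀ I : Ideal R, (I.map (algebraMap R (AdicCompletion (maximalIdeal R) R))).comap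
        (algebraMap R (AdicCompletion (maximalIdeal R) R)) = I :=
      fun I => Ideal.comap_map_eq_self_of_faithfullyFlat I
    refine isReduced_of_injective (algebraMap R (AdicCompletion (maximalIdeal R) R)) ?_
    rw [RingHom.injective_iff_ker_eq_bot, RingHom.ker_eq_comap_bot,
      ← Ideal.map_bot (f := algebraMap R (AdicCompletion (maximalIdeal R) R)), hj]
  have hck : TCB.ColonKill R := TCB.colonKill_final R p hequi
    fun Q _ hQ => TCB.reg_of_GRing R hexc.2.1 Q hQ
  refine ⟨TCB.bigB R, inferInstance, TCB.bigF R p, TCB.bigCM R p hck, fun I => TCB.tight_eq R p I,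
    TCB.bigDagger p, ?_⟩
  intro I hI Jstar hJ e
  have h : Jstar = fun n => contractedExt R (TCB.bigF R p) (I ^ n) :=
    funext fun n => SetLike.coe_injective ((hJ n).trans (TCB.tight_eq R p (I ^ n)))
  rw [h]
end

section
/- Let k be a field, R = k[[x, xy, y², y³]] ⊆ k[[x,y]], and Q = (x, y²)R. Then for every n ≥ 0, ℓ(R/overline{Q^{n+1}}) = 2·binom(n+2,2) − 1; in particular the first normal Hilbert coefficient satisfies ē₁(Q) = 0, although R is a two-dimensional complete local domain that is neither regular nor S₂ (its S₂-ification is k[[x,y]], with k[[x,y]]/R ≅ k). -/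
open IsLocalRing

universe u

open MvPowerSeries

/-- The subring `R = k[[x, xy, y², y³]] ⊆ k[[x,y]]`: all power series with vanishing
coefficient of `y` (here `x = X 0`, `y = X 1`). -/
def weirdRing (k : Type u) [Field k] : Subalgebra k (MvPowerSeries (Fin 2) k) where
  carrier := { f | MvPowerSeries.coeff (R := k) (Finsupp.single 1 1) f = 0 }
  zero_mem' := by simp
  add_mem' := by
    intro a b ha hb
    simp only [Set.mem_setOf_eq, map_add] at *
    rw [ha, hb, add_zero]
  one_mem' := by
    simp [MvPowerSeries.coeff_one, Finsupp.single_eq_zero]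
  mul_mem' := by
    intro a b ha hb
    simp only [Set.mem_setOf_eq] at *
    rw [MvPowerSeries.coeff_mul, Finsupp.antidiagonal_single, Finset.sum_map]
    rw [show (Finset.HasAntidiagonal.antidiagonal (1 : ℕ)) = {(0,1),(1,0)} from rfl]
    simp [ha, hb]
  algebraMap_mem' := by
    intro r
    simp [MvPowerSeries.algebraMap_apply, MvPowerSeries.coeff_C, Finsupp.single_eq_zero]

/-- The element `x ∈ R`. -/
noncomputable def weirdX (k : Type u) [Field k] : ↥(weirdRing k) :=
  ⟨MvPowerSeries.X 0, by
    show MvPowerSeries.coeff (R := k) _ _ = 0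
    rw [MvPowerSeries.coeff_X, if_neg]
    simp [Finsupp.single_eq_single_iff]⟩

/-- The element `y² ∈ R`. -/
noncomputable def weirdY2 (k : Type u) [Field k] : ↥(weirdRing k) :=
  ⟨MvPowerSeries.X 1 ^ 2, by
    show MvPowerSeries.coeff (R := k) _ _ = 0
    rw [MvPowerSeries.coeff_X_pow, if_neg]
    simp [Finsupp.single_eq_single_iff]⟩


namespace WR
variable {k : Type u} [Field k]

abbrev S (k : Type u) [Field k] := MvPowerSeries (Fin 2) k

noncomputable def ord (f : S k) : ℕ∞ := f.weightedOrder ![2, 1]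

noncomputable abbrev ey : Fin 2 →₀ ℕ := Finsupp.single 1 1

lemma weight_eq (e : Fin 2 →₀ ℕ) : Finsupp.weight ![2, 1] e = 2 * e 0 + e 1 := by
  rw [Finsupp.weight_apply, Finsupp.sum_fintype _ _ (by simp)]
  simp [Fin.sum_univ_two]; ring

lemma le_ord_iff {n : ℕ} {f : S k} :
    (n : ℕ∞) ≤ ord f ↔ ∀ e : Fin 2 →₀ ℕ, 2 * e 0 + e 1 < n → coeff e f = 0 := by
  constructor
  · intro h e he
    apply coeff_eq_zero_of_lt_weightedOrder ![2, 1]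
    refine lt_of_lt_of_le ?_ h
    rw [weight_eq]; exact_mod_cast he
  · intro h
    apply nat_le_weightedOrder
    intro e he
    rw [weight_eq] at he
    exact h e he

lemma ord_mul (f g : S k) : ord (f * g) = ord f + ord g := weightedOrder_mul _ f g

lemma mem_iff (f : S k) : f ∈ weirdRing k ↔ coeff ey f = 0 := Iff.rfl

lemma exp_ext {e f : Fin 2 →₀ ℕ} (h0 : e 0 = f 0) (h1 : e 1 = f 1) : e = f := by
  ext i; fin_cases i <;> assumption

lemma coeff_ey_mul (f g : S k) :
    coeff ey (f * g) = coeff 0 f * coeff ey g + coeff ey f * coeff 0 g := by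
  rw [MvPowerSeries.coeff_mul, Finsupp.antidiagonal_single, Finset.sum_map]
  rw [show (Finset.HasAntidiagonal.antidiagonal (1 : ℕ)) = {(0,1),(1,0)} from rfl]
  simp

lemma coeff_zero_mul (f g : S k) : coeff 0 (f * g) = coeff 0 f * coeff 0 g := by
  simp [coeff_zero_eq_constantCoeff_apply]

lemma coeff_ey_y : coeff ey (X 1 : S k) = 1 := by
  rw [coeff_X, if_pos rfl]

lemma coeff_zero_y : coeff 0 (X 1 : S k) = 0 := by
  simp

/-- Decomposition of `S` as `R + k y`. -/
lemma decomp (f : S k) : ∃ r : weirdRing k, f = (r : S k) + C (coeff ey f) * (X 1 : S k) := by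
  refine ⟨⟨f - C (coeff ey f) * X 1, ?_⟩, ?_⟩
  · rw [mem_iff, map_sub, coeff_C_mul, coeff_ey_y]; ring
  · simp

/-- The ideals of the weighted filtration. -/
noncomputable def J (k : Type u) [Field k] (n : ℕ) : Ideal (weirdRing k) where
  carrier := { f | (n : ℕ∞) ≤ ord (f : S k) }
  zero_mem' := by simp [ord]
  add_mem' := by
    intro a b ha hb
    simp only [Set.mem_ofPred_eq, le_ord_iff] at *
    intro e he
    simp [ha e he, hb e he]
  smul_mem' := by
    intro c a ha
    simp only [Set.mem_ofPred_eq] at *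
    change _ ≤ ord ((c : S k) * (a : S k))
    rw [ord_mul]
    exact ha.trans le_add_self

lemma mem_J {n : ℕ} {f : weirdRing k} : f ∈ J k n ↔ (n : ℕ∞) ≤ ord (f : S k) := Iff.rfl

lemma J_mul_le (m n : ℕ) : J k m * J k n ≤ J k (m + n) := by
  rw [Ideal.mul_le]
  intro a ha b hb
  rw [mem_J] at *
  change _ ≤ ord ((a : S k) * (b : S k))
  rw [ord_mul]; push_cast
  exact add_le_add ha hb

lemma J_pow_le (m n : ℕ) : J k m ^ n ≤ J k (n * m) := by
  induction n with
  | zero => intro f _; rw [mem_J]; simp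
  | succ n ih =>
    rw [pow_succ, Nat.succ_mul]
    exact (Ideal.mul_mono_left ih).trans (J_mul_le _ _)

noncomputable abbrev Q (k : Type u) [Field k] : Ideal (weirdRing k) := Ideal.span {weirdX k, weirdY2 k}

lemma Q_le : Q k ≤ J k 2 := by
  rw [Ideal.span_le]
  rintro f (rfl | rfl)
  · rw [SetLike.mem_coe, mem_J, le_ord_iff]
    intro e he
    change coeff e (X 0) = _
    rw [coeff_X, if_neg]
    rintro rfl
    simp at he
  · rw [SetLike.mem_coe, mem_J, le_ord_iff]
    intro e he
    change coeff e (X 1 ^ 2) = _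
    rw [coeff_X_pow, if_neg]
    rintro rfl
    simp at he

lemma Q_pow_le (n : ℕ) : Q k ^ n ≤ J k (2 * n) := by
  rw [mul_comm]
  exact (Ideal.pow_right_mono Q_le n).trans (J_pow_le _ _)

/-- division step -/
lemma div_step (m : ℕ) (f : S k) (hf : ((2 * (m + 1) : ℕ) : ℕ∞) ≤ ord f) :
    ∃ g h : S k, ((2 * m : ℕ) : ℕ∞) ≤ ord g ∧ ((2 * m : ℕ) : ℕ∞) ≤ ord h ∧
      f = X 0 * g + X 1 ^ 2 * h := by
  rw [le_ord_iff] at hf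
  let g : S k := fun e => coeff (e + Finsupp.single 0 1) f
  let h : S k := fun e => if e 0 = 0 then coeff (e + Finsupp.single 1 2) f else 0
  have hg : ∀ e, coeff e g = coeff (e + Finsupp.single 0 1) f := fun e => rfl
  have hh : ∀ e, coeff e h = if e 0 = 0 then coeff (e + Finsupp.single 1 2) f else 0 :=
    fun e => rfl
  refine ⟨g, h, ?_, ?_, ?_⟩
  · rw [le_ord_iff]
    intro e he
    rw [hg]; apply hf; simp; omega
  · rw [le_ord_iff]
    intro e he
    rw [hh]; split_ifs
    · apply hf; simp; omega
    · rfl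
  · ext e
    rw [map_add, X_pow_eq, ← pow_one (X 0 : S k), X_pow_eq, coeff_monomial_mul,
      coeff_monomial_mul, one_mul, one_mul, hg, hh]
    by_cases h0 : e 0 = 0
    · rw [if_neg]
      swap
      · intro hle
        have := hle 0
        simp at this; omega
      by_cases h1 : 2 ≤ e 1
      · have hle : Finsupp.single 1 2 ≤ e := by simpa using h1
        rw [if_pos hle, if_pos (by simp [h0]), tsub_add_cancel_of_le hle, zero_add]
      · rw [if_neg (by simpa using h1), hf e (by omega), add_zero]
    · have hle : Finsupp.single 0 1 ≤ e := by
        simp; omega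
      rw [if_pos hle, tsub_add_cancel_of_le hle]
      simp [h0]

lemma exists_QS (m : ℕ) (f : S k) (hf : ((2 * m : ℕ) : ℕ∞) ≤ ord f) :
    ∃ a ∈ Q k ^ m, ∃ b ∈ Q k ^ m, f = (a : S k) + (b : S k) * (X 1 : S k) := by
  induction m generalizing f with
  | zero =>
    obtain ⟨r, hr⟩ := decomp f
    refine ⟨r, by simp, algebraMap k _ (coeff ey f), by simp, ?_⟩
    exact hr
  | succ m ih =>
    obtain ⟨g, h, hg, hh, rfl⟩ := div_step m f hf
    obtain ⟨a, ha, b, hb, rfl⟩ := ih g hg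
    obtain ⟨c, hc, d, hd, rfl⟩ := ih h hh
    have hX : weirdX k ∈ Q k := Ideal.subset_span (by simp)
    have hY : weirdY2 k ∈ Q k := Ideal.subset_span (by simp)
    refine ⟨weirdX k * a + weirdY2 k * c, ?_, weirdX k * b + weirdY2 k * d, ?_, ?_⟩
    · rw [pow_succ']
      exact add_mem (Ideal.mul_mem_mul hX ha) (Ideal.mul_mem_mul hY hc)
    · rw [pow_succ']
      exact add_mem (Ideal.mul_mem_mul hX hb) (Ideal.mul_mem_mul hY hd)
    · change _ = ((X 0 : S k) * (a : S k) + X 1 ^ 2 * (c : S k)) + (X 0 * (b : S k) + X 1 ^ 2 * (d : S k)) * X 1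
      ring

lemma intCl_eq (n : ℕ) :
    intClSet (weirdRing k) (Q k ^ n) = (J k (2 * n) : Set (weirdRing k)) := by
  ext f
  constructor
  · rintro ⟨N, hN, a, ha, heq⟩
    rw [SetLike.mem_coe, mem_J]
    by_contra hlt
    push Not at hlt
    obtain ⟨v, hv⟩ := ENat.ne_top_iff_exists.mp (ne_top_of_lt hlt)
    rw [← hv] at hlt
    have hlt' : v < 2 * n := by exact_mod_cast hlt
    have hpow : ∀ i : ℕ, ord ((f : S k) ^ i) = ((i * v : ℕ) : ℕ∞) := by
      intro i
      induction i with
      | zero => simp [ord]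
      | succ i ih => rw [pow_succ, ord_mul, ih, ← hv]; push_cast; ring
    have hf : f ^ N = - ∑ k ∈ Finset.Icc 1 N, a k * f ^ (N - k) := eq_neg_of_add_eq_zero_left heq
    have hmem : f ^ N ∈ J k (N * v + 1) := by
      rw [hf]
      refine neg_mem (sum_mem ?_)
      intro i hi
      have h1 := ha i hi
      rw [← pow_mul] at h1
      have h2 := Q_pow_le _ h1
      rw [Finset.mem_Icc] at hi
      rw [mem_J] at h2 ⊢
      change _ ≤ ord ((a i : S k) * (f : S k) ^ (N - i))
      rw [ord_mul, hpow]
      refine le_trans ?_ (add_le_add_left h2 _)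
      norm_cast
      obtain ⟨j, rfl⟩ := Nat.exists_eq_add_of_le hi.2
      rw [Nat.add_sub_cancel_left]
      nlinarith [hi.1, Nat.mul_le_mul_left i hlt']
    rw [mem_J] at hmem
    change _ ≤ ord ((f : S k) ^ N) at hmem
    rw [hpow] at hmem
    have : N * v + 1 ≤ N * v := by exact_mod_cast hmem
    omega
  · intro hf
    rw [SetLike.mem_coe, mem_J] at hf
    obtain ⟨a, ha, b, hb, h1⟩ := exists_QS n (f : S k) hf
    obtain ⟨c, hc, d, hd, h2⟩ := exists_QS n ((f : S k) * X 1) (by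
      rw [ord_mul]; exact hf.trans le_self_add)
    refine ⟨2, by norm_num, fun i => if i = 1 then - (a + d) else a * d - b * c, ?_, ?_⟩
    · intro i hi
      rw [Finset.mem_Icc] at hi
      obtain ⟨hi1, hi2⟩ := hi
      interval_cases i
      · simpa using neg_mem (add_mem ha hd)
      · simp only [OfNat.ofNat_ne_one, if_false]
        rw [pow_two]
        exact sub_mem (Ideal.mul_mem_mul ha hd) (Ideal.mul_mem_mul hb hc)
    · have : Finset.Icc 1 2 = {1, 2} := rfl
      rw [this, Finset.sum_pair (by norm_num)]
      apply Subtype.ext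
      simp
      linear_combination ((f : S k) - d) * h1 + (b : S k) * h2

end WR

namespace WR
variable {k : Type u} [Field k]

lemma coe_mul' (a b : weirdRing k) : ((a * b : weirdRing k) : S k) = (a : S k) * (b : S k) := rfl

lemma isUnit_iff (f : weirdRing k) : IsUnit f ↔ coeff 0 (f : S k) ≠ 0 := by
  constructor
  · intro h h0
    obtain ⟨g, hg⟩ := h.exists_right_inv
    have := congrArg (fun t : weirdRing k => coeff 0 (t : S k)) hg
    simp only [coe_mul', coeff_zero_mul, h0, zero_mul] at this
    simp at this
  · intro h
    have hinv : (f : S k) * (f : S k)⁻¹ = 1 := MvPowerSeries.mul_inv_cancel _ h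
    have hm : (f : S k)⁻¹ ∈ weirdRing k := by
      rw [mem_iff]
      have := congrArg (coeff ey) hinv
      rw [coeff_ey_mul, (mem_iff _).1 f.2, zero_mul, add_zero, coeff_one, if_neg (by simp)] at this
      exact (mul_eq_zero.1 this).resolve_left h
    exact IsUnit.of_mul_eq_one ⟨_, hm⟩ (Subtype.ext hinv)

instance isLocal : IsLocalRing (weirdRing k) := by
  refine IsLocalRing.of_nonunits_add ?_
  intro a b ha hb
  simp only [mem_nonunits_iff, isUnit_iff, not_not] at *
  change coeff 0 ((a : S k) + (b : S k)) = 0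
  rw [map_add, ha, hb, add_zero]

lemma mem_max_iff (f : weirdRing k) : f ∈ maximalIdeal (weirdRing k) ↔ coeff 0 (f : S k) = 0 := by
  rw [mem_maximalIdeal, mem_nonunits_iff, isUnit_iff, not_not]

lemma max_eq : maximalIdeal (weirdRing k) = J k 2 := by
  ext f
  rw [mem_max_iff, mem_J, le_ord_iff]
  constructor
  · intro h e he
    by_cases h1 : e 1 = 0
    · rw [exp_ext (e := e) (f := 0) (by simp; omega) (by simpa using h1)]; exact h
    · rw [exp_ext (e := e) (f := ey) (by simp; omega) (by simp; omega)]; exact f.2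
  · intro h; exact h 0 (by simp)

/-- `m S ⊆ R` -/
lemma max_mul_mem (f : weirdRing k) (hf : coeff 0 (f : S k) = 0) (g : S k) :
    (f : S k) * g ∈ weirdRing k := by
  rw [mem_iff, coeff_ey_mul, hf, (mem_iff _).1 f.2]; ring

lemma J_le_pow (n : ℕ) : J k (2 * n) ≤ maximalIdeal (weirdRing k) ^ n := by
  cases n with
  | zero => simp
  | succ m =>
    intro f hf
    obtain ⟨g, h, hg, hh, hgh⟩ := div_step m (f : S k) hf
    obtain ⟨a, ha, b, hb, rfl⟩ := exists_QS m g hg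
    obtain ⟨c, hc, d, hd, rfl⟩ := exists_QS m h hh
    have hQ : Q k ^ m ≤ maximalIdeal (weirdRing k) ^ m := by
      apply Ideal.pow_right_mono; rw [max_eq]; exact Q_le
    have hX : coeff 0 (X 0 : S k) = 0 := by simp
    have hY : coeff 0 (X 1 ^ 2 : S k) = 0 := by simp
    have hxX : weirdX k ∈ maximalIdeal (weirdRing k) := by rw [mem_max_iff]; exact hX
    have hyY : weirdY2 k ∈ maximalIdeal (weirdRing k) := by rw [mem_max_iff]; exact hY
    let u : weirdRing k := ⟨X 0 * X 1, max_mul_mem (weirdX k) hX _⟩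
    let v : weirdRing k := ⟨X 1 ^ 2 * X 1, max_mul_mem (weirdY2 k) hY _⟩
    have hu : u ∈ maximalIdeal (weirdRing k) := by
      rw [mem_max_iff]; change coeff 0 (X 0 * X 1 : S k) = 0; rw [coeff_zero_mul, hX, zero_mul]
    have hv : v ∈ maximalIdeal (weirdRing k) := by
      rw [mem_max_iff]; change coeff 0 (X 1 ^ 2 * X 1 : S k) = 0; rw [coeff_zero_mul, hY, zero_mul]
    have : f = weirdX k * a + u * b + (weirdY2 k * c + v * d) := by
      apply Subtype.ext
      rw [hgh]
      change _ = (X 0 : S k) * (a : S k) + X 0 * X 1 * (b : S k) +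
        (X 1 ^ 2 * (c : S k) + X 1 ^ 2 * X 1 * (d : S k))
      ring
    rw [this, pow_succ']
    exact add_mem (add_mem (Ideal.mul_mem_mul hxX (hQ ha)) (Ideal.mul_mem_mul hu (hQ hb)))
      (add_mem (Ideal.mul_mem_mul hyY (hQ hc)) (Ideal.mul_mem_mul hv (hQ hd)))

lemma pow_le_J (n : ℕ) : maximalIdeal (weirdRing k) ^ n ≤ J k n := by
  rw [max_eq]
  refine (J_pow_le 2 n).trans ?_
  intro f hf
  rw [mem_J] at *
  refine le_trans ?_ hf
  norm_cast
  omega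

lemma eq_zero_of_J (f : weirdRing k) (h : ∀ n, f ∈ J k n) : f = 0 := by
  apply Subtype.ext
  ext e
  have := h (2 * e 0 + e 1 + 1)
  rw [mem_J, le_ord_iff] at this
  simpa using this e (by omega)

lemma complete : IsAdicComplete (maximalIdeal (weirdRing k)) (weirdRing k) where
  haus' := by
    intro f hf
    apply eq_zero_of_J
    intro n
    have := hf n
    rw [SModEq.zero, smul_eq_mul, Ideal.mul_top] at this
    exact pow_le_J n this
  prec' := by
    intro f hf
    have hf' : ∀ {m n}, m ≤ n → f m - f n ∈ maximalIdeal (weirdRing k) ^ m := by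
      intro m n hmn
      have := hf hmn
      rwa [SModEq.sub_mem, smul_eq_mul, Ideal.mul_top] at this
    have hc : ∀ (e : Fin 2 →₀ ℕ) (n : ℕ), 2 * e 0 + e 1 < n →
        coeff e (f n : S k) = coeff e (f (2 * e 0 + e 1 + 1) : S k) := by
      intro e n hn
      have := pow_le_J _ (hf' (show 2 * e 0 + e 1 + 1 ≤ n by omega))
      rw [mem_J, le_ord_iff] at this
      have := this e (by omega)
      change coeff e ((f (2 * e 0 + e 1 + 1) : S k) - (f n : S k)) = 0 at this
      rw [map_sub, sub_eq_zero] at this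
      exact this.symm
    let g : S k := fun e => coeff e (f (2 * e 0 + e 1 + 1) : S k)
    have hg : ∀ e, coeff e g = coeff e (f (2 * e 0 + e 1 + 1) : S k) := fun e => rfl
    refine ⟨⟨g, ?_⟩, ?_⟩
    · rw [mem_iff, hg]
      exact (f _).2
    · intro n
      rw [SModEq.sub_mem, smul_eq_mul, Ideal.mul_top]
      have h1 := hf' (show n ≤ 2 * n by omega)
      have h2 : f (2 * n) - ⟨g, by rw [mem_iff, hg]; exact (f _).2⟩ ∈ J k (2 * n) := by
        rw [mem_J, le_ord_iff]
        intro e he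
        change coeff e ((f (2 * n) : S k) - g) = 0
        rw [map_sub, hg, hc e _ he, sub_self]
      have := add_mem h1 (J_le_pow n h2)
      simpa using this

lemma sq_mem_Q (f : weirdRing k) (hf : f ∈ maximalIdeal (weirdRing k)) : f ^ 2 ∈ Q k := by
  rw [max_eq, mem_J] at hf
  obtain ⟨a, ha, b, hb, h⟩ := exists_QS 1 (f : S k) hf
  rw [pow_one] at ha hb
  have : f ^ 2 = a * (2 * f - a) + b * (b * weirdY2 k) := by
    apply Subtype.ext
    change (f : S k) ^ 2 = (a : S k) * (2 * (f : S k) - (a : S k)) +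
      (b : S k) * ((b : S k) * X 1 ^ 2)
    rw [h]; ring
  rw [this]
  exact add_mem (Ideal.mul_mem_right _ _ ha) (Ideal.mul_mem_right _ _ hb)

instance noeth : IsNoetherianRing (weirdRing k) := by
  rw [isNoetherianRing_iff_ideal_fg]
  intro I
  have hfg : (Ideal.span ((fun r : weirdRing k => (r : S k)) '' (I : Set (weirdRing k)))).FG :=
    IsNoetherian.noetherian _
  obtain ⟨t, ht, hspan⟩ := Submodule.fg_span_iff_fg_span_finset_subset _ |>.1 hfg
  classical
  obtain ⟨t', ht', rfl⟩ := Finset.subset_set_image_iff.1 ht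
  -- the finite-dimensional space of error terms
  let W : Submodule k (S k) := Submodule.span k ((fun r : weirdRing k => (r : S k) * X 1) '' (t' : Set (weirdRing k)))
  let IS : Submodule k (S k) := (I.restrictScalars k).map (weirdRing k).val.toLinearMap
  have hWfin : FiniteDimensional k W :=
    FiniteDimensional.span_of_finite k (t'.finite_toSet.image _)
  have hfin : FiniteDimensional k (IS ⊓ W : Submodule k (S k)) :=
    Submodule.finiteDimensional_inf_right _ _
  obtain ⟨u, hu⟩ : (IS ⊓ W : Submodule k (S k)).FG := Module.Finite.iff_fg.1 hfin
  have hu_sub : (u : Set (S k)) ⊆ (fun r : weirdRing k => (r : S k)) '' (I : Set (weirdRing k)) := by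
    intro z hz
    have : z ∈ IS ⊓ W := by rw [← hu]; exact Submodule.subset_span hz
    obtain ⟨r, hr, rfl⟩ := this.1
    exact ⟨r, hr, rfl⟩
  obtain ⟨u', hu', rfl⟩ := Finset.subset_set_image_iff.1 hu_sub
  refine ⟨t' ∪ u', le_antisymm ?_ ?_⟩
  · rw [Submodule.span_le]
    intro z hz
    rw [Finset.coe_union] at hz
    rcases hz with hz | hz
    · exact ht' hz
    · exact hu' hz
  · set I' : Ideal (weirdRing k) := Ideal.span ((t' ∪ u' : Finset (weirdRing k)) : Set (weirdRing k)) with hI'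
    -- every element of `S t'` is an element of `I'` plus an element of `W`
    have key : ∀ s : S k, s ∈ Ideal.span ((fun r : weirdRing k => (r : S k)) '' (t' : Set (weirdRing k))) →
        ∃ r ∈ Ideal.span (t' : Set (weirdRing k)), ∃ w ∈ W, s = (r : S k) + w := by
      intro s hs
      induction hs using Submodule.closure_induction with
      | zero => exact ⟨0, zero_mem _, 0, zero_mem _, by simp⟩
      | add x y _ _ hx hy =>
        obtain ⟨r, hr, w, hw, rfl⟩ := hx
        obtain ⟨r', hr', w', hw', rfl⟩ := hy
        refine ⟨r + r', add_mem hr hr', w + w', add_mem hw hw', ?_⟩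
        change _ = ((r : S k) + (r' : S k)) + _
        ring
      | smul_mem a x hx =>
        obtain ⟨r, hr, rfl⟩ := hx
        obtain ⟨b, hb⟩ := decomp a
        refine ⟨b * r, Ideal.mul_mem_left _ _ (Ideal.subset_span hr),
          coeff ey a • ((r : S k) * X 1),
          Submodule.smul_mem _ _ (Submodule.subset_span ⟨r, hr, rfl⟩), ?_⟩
        rw [smul_eq_C_mul, coe_mul', smul_eq_mul]
        linear_combination (r : S k) * hb
    intro z hz
    have hz' : (z : S k) ∈ Ideal.span ((fun r : weirdRing k => (r : S k)) ''
        (t' : Set (weirdRing k))) := by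
      have h1 : (z : S k) ∈ Ideal.span ((fun r : weirdRing k => (r : S k)) ''
        (I : Set (weirdRing k))) := Ideal.subset_span ⟨z, hz, rfl⟩
      rw [Ideal.span, hspan, Finset.coe_image] at h1
      exact h1
    obtain ⟨r, hr, w, hw, hzw⟩ := key _ hz'
    have hrI' : r ∈ I' := Ideal.span_mono (by simp) hr
    have hrI : r ∈ I := (Ideal.span_le.2 ht') hr
    have hw' : w ∈ IS ⊓ W := by
      refine ⟨⟨z - r, sub_mem hz hrI, ?_⟩, hw⟩
      change (z : S k) - (r : S k) = w
      rw [hzw]; ring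
    have hsub : (IS ⊓ W : Submodule k (S k)) ≤
        (I'.restrictScalars k).map (weirdRing k).val.toLinearMap := by
      rw [← hu, Submodule.span_le]
      intro x hx
      rw [Finset.coe_image] at hx
      obtain ⟨q, hq, rfl⟩ := hx
      exact ⟨q, Ideal.subset_span (by rw [Finset.coe_union]; exact Or.inr hq), rfl⟩
    obtain ⟨q, hq, hqw⟩ := hsub hw'
    have : z = r + q := by
      apply Subtype.ext
      rw [hzw, ← hqw]; rfl
    rw [this]
    exact add_mem hrI' hq

/-- The order in `x`. -/
noncomputable def ordx (f : S k) : ℕ∞ := f.weightedOrder ![1, 0]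

lemma ordx_mul (f g : S k) : ordx (f * g) = ordx f + ordx g := weightedOrder_mul _ f g

/-- The prime `xS ∩ R`. -/
noncomputable def px (k : Type u) [Field k] : Ideal (weirdRing k) where
  carrier := { f | 1 ≤ ordx (f : S k) }
  zero_mem' := by simp [ordx]
  add_mem' := by
    intro a b ha hb
    simp only [Set.mem_ofPred_eq] at *
    exact (le_min ha hb).trans (min_weightedOrder_le_add _)
  smul_mem' := by
    intro c a ha
    simp only [Set.mem_ofPred_eq] at *
    change _ ≤ ordx ((c : S k) * (a : S k))
    rw [ordx_mul]
    exact ha.trans le_add_self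

lemma mem_px {f : weirdRing k} : f ∈ px k ↔ 1 ≤ ordx (f : S k) := Iff.rfl

lemma px_prime : (px k).IsPrime := by
  refine ⟨?_, ?_⟩
  · rw [Ideal.ne_top_iff_one, mem_px]
    change ¬ (1 ≤ ordx (1 : S k))
    simp [ordx]
  · intro a b h
    rw [mem_px] at *
    rw [mem_px]
    change 1 ≤ ordx ((a : S k) * (b : S k)) at h
    rw [ordx_mul] at h
    by_contra hc
    push Not at hc
    rw [ENat.lt_one_iff_eq_zero, ENat.lt_one_iff_eq_zero] at hc
    rw [hc.1, hc.2] at h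
    simp at h

lemma dim_eq : ringKrullDim (weirdRing k) = (2 : WithBot ℕ∞) := by
  apply le_antisymm
  · rw [← IsLocalRing.maximalIdeal_height_eq_ringKrullDim]
    have hmin : maximalIdeal (weirdRing k) ∈ (Q k).minimalPrimes := by
      refine ⟨⟨inferInstance, by rw [max_eq]; exact Q_le⟩, ?_⟩
      rintro P ⟨hP, hQP⟩ _ f hf
      exact hP.mem_of_pow_mem 2 (hQP (sq_mem_Q f hf))
    have h := Ideal.height_le_spanRank_toENat_of_mem_minimalPrimes _ _ hmin
    have h2 : (Submodule.spanRank (Q k)).toENat ≤ 2 := by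
      refine (Cardinal.toENat.monotone' (Submodule.spanRank_span_le_card (R := weirdRing k)
        ({weirdX k, weirdY2 k} : Set (weirdRing k)))).trans ?_
      change Set.encard _ ≤ 2
      exact (Set.encard_insert_le _ _).trans (by rw [Set.encard_singleton]; norm_num)
    exact WithBot.coe_le_coe.2 (h.trans h2)
  · have hP := px_prime (k := k)
    have h1 : (⊥ : Ideal (weirdRing k)) < px k := by
      rw [bot_lt_iff_ne_bot]
      intro h
      have : weirdX k ∈ px k := by
        rw [mem_px]
        change 1 ≤ weightedOrder ![1, 0] (X 0 : S k)
        rw [X, weightedOrder_monomial_of_ne_zero _ one_ne_zero]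
        simp [Finsupp.weight_single]
      rw [h, Ideal.mem_bot] at this
      have := congrArg (fun t : weirdRing k => coeff (Finsupp.single 0 1) (t : S k)) this
      change coeff _ (X 0) = coeff _ 0 at this
      rw [coeff_X, if_pos rfl, map_zero] at this
      exact one_ne_zero this
    have h2 : px k < maximalIdeal (weirdRing k) := by
      refine lt_of_le_of_ne (IsLocalRing.le_maximalIdeal hP.ne_top) ?_
      intro h
      have : weirdY2 k ∈ px k := by
        rw [h, mem_max_iff]
        change coeff 0 (X 1 ^ 2 : S k) = 0
        simp
      rw [mem_px] at this
      change 1 ≤ weightedOrder ![1, 0] (X 1 ^ 2 : S k) at this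
      rw [X_pow_eq, weightedOrder_monomial_of_ne_zero _ one_ne_zero] at this
      simp [Finsupp.weight_single] at this
    let s : LTSeries (PrimeSpectrum (weirdRing k)) :=
      { length := 2
        toFun := ![⟨⊥, Ideal.isPrime_bot⟩, ⟨px k, hP⟩, ⟨maximalIdeal _, inferInstance⟩]
        step := by
          intro i
          fin_cases i
          · exact h1
          · exact h2 }
    exact Order.LTSeries.length_le_krullDim s
end WR

namespace WR
variable {k : Type u} [Field k]

/-- The exponents of weight `v` other than that of `y`. -/
noncomputable def Mon (v : ℕ) : Finset (Fin 2 →₀ ℕ) :=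
  ((Finset.range (v / 2 + 1)).image
    (fun a => Finsupp.single 0 a + Finsupp.single 1 (v - 2 * a))).filter (· ≠ ey)

lemma mem_Mon {v : ℕ} {e : Fin 2 →₀ ℕ} : e ∈ Mon v ↔ 2 * e 0 + e 1 = v ∧ e ≠ ey := by
  rw [Mon, Finset.mem_filter, Finset.mem_image]
  refine and_congr_left fun _ => ?_
  constructor
  · rintro ⟨a, ha, rfl⟩
    rw [Finset.mem_range] at ha
    simp; omega
  · intro h
    refine ⟨e 0, by rw [Finset.mem_range]; omega, ?_⟩
    apply exp_ext <;> simp; omega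

lemma card_Mon (v : ℕ) : (Mon v).card = if v = 1 then 0 else v / 2 + 1 := by
  split_ifs with h
  · rw [Finset.card_eq_zero, Finset.eq_empty_iff_forall_notMem]
    intro e he
    rw [mem_Mon] at he
    exact he.2 (exp_ext (by simp; omega) (by simp; omega))
  · rw [Mon, Finset.filter_true_of_mem, Finset.card_image_of_injective, Finset.card_range]
    · intro a b hab
      have := congrArg (fun e : Fin 2 →₀ ℕ => e 0) hab
      simpa using this
    · intro e he
      rw [Finset.mem_image] at he
      obtain ⟨a, ha, rfl⟩ := he
      intro hc
      rw [Finset.mem_range] at ha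
      have h0 := congrArg (fun e : Fin 2 →₀ ℕ => e 0) hc
      have h1 := congrArg (fun e : Fin 2 →₀ ℕ => e 1) hc
      simp at h0 h1
      omega

lemma sum_card (n : ℕ) :
    ∑ v ∈ Finset.range (2 * (n + 1)), (Mon v).card + 1 = 2 * (n + 2).choose 2 := by
  induction n with
  | zero => simp [Finset.sum_range_succ, card_Mon]
  | succ n ih =>
    rw [show 2 * (n + 1 + 1) = 2 * (n + 1) + 1 + 1 by ring, Finset.sum_range_succ,
      Finset.sum_range_succ, card_Mon, card_Mon, if_neg (by omega), if_neg (by omega),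
      show n + 1 + 2 = (n + 2) + 1 by ring, Nat.choose_succ_succ' (n + 2) 1,
      Nat.choose_one_right, show 1 + 1 = 2 from rfl]
    omega

/-- Intermediate ideals. -/
noncomputable def JT (k : Type u) [Field k] (v : ℕ) (T : Finset (Fin 2 →₀ ℕ)) (hT : T ⊆ Mon v) :
    Ideal (weirdRing k) where
  carrier := { f | f ∈ J k v ∧ ∀ e ∈ T, coeff e (f : S k) = 0 }
  zero_mem' := ⟨zero_mem _, by simp⟩
  add_mem' := by
    rintro a b ⟨ha, ha'⟩ ⟨hb, hb'⟩
    refine ⟨add_mem ha hb, fun e he => ?_⟩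
    change coeff e ((a : S k) + (b : S k)) = 0
    rw [map_add, ha' e he, hb' e he, add_zero]
  smul_mem' := by
    rintro c a ⟨ha, ha'⟩
    refine ⟨Ideal.mul_mem_left _ _ ha, fun e he => ?_⟩
    change coeff e ((c : S k) * (a : S k)) = 0
    classical
    rw [coeff_mul]
    refine Finset.sum_eq_zero ?_
    rintro ⟨p, q⟩ hpq
    rw [Finset.HasAntidiagonal.mem_antidiagonal] at hpq
    subst hpq
    have := (mem_Mon.1 (hT he)).1
    simp only [Finsupp.add_apply] at this
    by_cases hq : 2 * q 0 + q 1 < v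
    · simp only
      rw [le_ord_iff.1 ha q hq, mul_zero]
    · have hp : p = 0 := exp_ext (by simp; omega) (by simp; omega)
      subst hp
      rw [zero_add] at he
      simp only
      rw [ha' q he, mul_zero]

lemma JT_lt (v : ℕ) (T : Finset (Fin 2 →₀ ℕ)) (e : Fin 2 →₀ ℕ) (he : e ∉ T)
    (hT : T ⊆ Mon v) (hT' : insert e T ⊆ Mon v) : JT k v (insert e T) hT' < JT k v T hT := by
  have heM := mem_Mon.1 (hT' (Finset.mem_insert_self e T))
  rw [SetLike.lt_iff_le_and_exists]
  constructor
  · rintro f ⟨h1, h2⟩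
    exact ⟨h1, fun e' he' => h2 e' (Finset.mem_insert_of_mem he')⟩
  · classical
    refine ⟨⟨monomial e 1, ?_⟩, ⟨?_, ?_⟩, ?_⟩
    · rw [mem_iff, coeff_monomial, if_neg (Ne.symm heM.2)]
    · rw [mem_J, le_ord_iff]
      intro e' he'
      rw [coeff_monomial, if_neg]
      rintro rfl
      omega
    · intro e' he'
      rw [coeff_monomial, if_neg]
      rintro rfl
      exact he he'
    · rintro ⟨_, h⟩
      have := h e (Finset.mem_insert_self e T)
      rw [coeff_monomial, if_pos rfl] at this
      exact one_ne_zero this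

lemma coheight_JT (v : ℕ) (T : Finset (Fin 2 →₀ ℕ)) (hT : T ⊆ Mon v) :
    Order.coheight (J k v) + T.card ≤ Order.coheight (JT k v T hT) := by
  induction T using Finset.induction_on with
  | empty =>
    have : JT k v ∅ hT = J k v := by
      ext f; constructor
      · rintro ⟨h, _⟩; exact h
      · intro h; exact ⟨h, by simp⟩
    rw [this]; simp
  | insert e T he ih =>
    have hT' : T ⊆ Mon v := (Finset.subset_insert e T).trans hT
    rw [Finset.card_insert_of_notMem he]
    push_cast
    rw [← add_assoc]
    exact (add_le_add_left (ih hT') 1).trans (Order.coheight_add_one_le (JT_lt v T e he hT' hT))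

lemma JT_full (v : ℕ) : JT k v (Mon v) le_rfl = J k (v + 1) := by
  ext f
  constructor
  · rintro ⟨h1, h2⟩
    rw [mem_J, le_ord_iff] at *
    intro e he
    by_cases h : 2 * e 0 + e 1 < v
    · exact h1 e h
    · by_cases hy : e = ey
      · rw [hy]; exact f.2
      · exact h2 e (mem_Mon.2 ⟨by omega, hy⟩)
  · intro h
    rw [mem_J, le_ord_iff] at h
    refine ⟨?_, ?_⟩
    · rw [mem_J, le_ord_iff]
      intro e he
      exact h e (by omega)
    · intro e he
      exact h e (by have := (mem_Mon.1 he).1; omega)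

lemma coheight_ge (v : ℕ) :
    ((∑ u ∈ Finset.range v, (Mon u).card : ℕ) : ℕ∞) ≤ Order.coheight (J k v) := by
  induction v with
  | zero => simp
  | succ v ih =>
    rw [Finset.sum_range_succ, ← JT_full]
    push_cast
    push_cast at ih
    exact (add_le_add_left ih _).trans (coheight_JT v _ le_rfl)

lemma moduleLength_eq_coheight {A : Type*} [CommRing A] (I : Ideal A) :
    moduleLength A (A ⧸ I) = (Order.coheight I : WithBot ℕ∞) := by
  rw [moduleLength, Order.coheight_eq_krullDim_Ici]
  exact Order.krullDim_eq_of_orderIso (Submodule.comapMkQRelIso I)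

lemma coheight_le (v : ℕ) :
    (Order.coheight (J k v) : WithBot ℕ∞) ≤
      ((∑ u ∈ Finset.range v, (Mon u).card : ℕ) : WithBot ℕ∞) := by
  classical
  rw [Order.coheight_eq_krullDim_Ici]
  let L := (Finset.range v).biUnion Mon
  let φ : weirdRing k →ₗ[k] (L → k) :=
    LinearMap.pi fun e => (coeff (e : Fin 2 →₀ ℕ)) ∘ₗ (weirdRing k).val.toLinearMap
  have hφ : ∀ f e, φ f e = coeff (e : Fin 2 →₀ ℕ) (f : S k) := fun f e => rfl
  have hker : ∀ f, φ f = 0 → f ∈ J k v := by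
    intro f hf
    rw [mem_J, le_ord_iff]
    intro e he
    by_cases hy : e = ey
    · rw [hy]; exact f.2
    · have heL : e ∈ L := Finset.mem_biUnion.2 ⟨_, Finset.mem_range.2 he, mem_Mon.2 ⟨rfl, hy⟩⟩
      rw [← hφ f ⟨e, heL⟩, hf]; rfl
  let F : Set.Ici (J k v) → Submodule k (L → k) := fun I => ((I : Ideal (weirdRing k)).restrictScalars k).map φ
  have hF : StrictMono F := by
    apply Monotone.strictMono_of_injective
    · intro I I' h
      exact Submodule.map_mono h
    · have : ∀ I I' : Set.Ici (J k v), F I = F I' → (I : Ideal (weirdRing k)) ≤ I' := by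
        intro I I' h f hf
        have h1 : φ f ∈ F I := ⟨f, hf, rfl⟩
        rw [h] at h1
        obtain ⟨g, hg, hgf⟩ := h1
        have : f - g ∈ J k v := hker _ (by rw [map_sub, hgf, sub_self])
        have := add_mem (I'.2 this) hg
        simpa using this
      intro I I' h
      exact Subtype.ext (le_antisymm (this _ _ h) (this _ _ h.symm))
  refine (Order.krullDim_le_of_strictMono F hF).trans ?_
  rw [← Module.coe_length, Module.length_eq_finrank, Module.finrank_fintype_fun_eq_card,
    Fintype.card_coe]
  have : L.card ≤ ∑ u ∈ Finset.range v, (Mon u).card := Finset.card_biUnion_le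
  exact_mod_cast this

set_option synthInstance.maxHeartbeats 2000000
set_option maxHeartbeats 2000000

lemma domain : IsDomain (weirdRing k) := by
  have : NoZeroDivisors (weirdRing k) :=
    Function.Injective.noZeroDivisors (fun r : weirdRing k => (r : MvPowerSeries (Fin 2) k))
      Subtype.val_injective rfl (fun _ _ => rfl)
  have : Nontrivial (weirdRing k) := inferInstance
  exact NoZeroDivisors.to_isDomain _

lemma length_eq (n : ℕ) :
    moduleLength (weirdRing k) (weirdRing k ⧸ J k (2 * (n + 1))) =
      ((2 * (n + 2).choose 2 - 1 : ℕ) : WithBot ℕ∞) := by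
  rw [moduleLength_eq_coheight, ← sum_card, Nat.add_sub_cancel]
  apply le_antisymm (coheight_le _)
  exact_mod_cast coheight_ge (k := k) (2 * (n + 1))

lemma length_eq' (n : ℕ) (I : Ideal (weirdRing k))
    (hI : (I : Set (weirdRing k)) = intClSet (weirdRing k) (Q k ^ (n + 1))) :
    moduleLength (weirdRing k) (weirdRing k ⧸ I) =
      ((2 * (n + 2).choose 2 - 1 : ℕ) : WithBot ℕ∞) := by
  rw [intCl_eq] at hI
  rw [SetLike.coe_injective hI]
  exact length_eq n

lemma e1_eq (Jbar : ℕ → Ideal (weirdRing k)) (ebar : ℕ → ℤ)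
    (hJ : ∀ n, (Jbar n : Set (weirdRing k)) = intClSet (weirdRing k) (Q k ^ n))
    (h : HasHilbertSeries (weirdRing k) 2 Jbar ebar) : ebar 1 = 0 := by
  obtain ⟨N, hN⟩ := h
  have key : ∀ n ≥ N, ((n : ℤ) + 2) * (n + 1) * 2 - 2 =
      ebar 0 * ((n + 2) * (n + 1)) - 2 * ebar 1 * (n + 1) + 2 * ebar 2 := by
    intro n hn
    obtain ⟨m, hm, hm'⟩ := hN n hn
    rw [length_eq' n _ (hJ (n + 1))] at hm
    have hm2 : 2 * (n + 2).choose 2 - 1 = m := by exact_mod_cast hm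
    have hc : (n + 2).choose 2 * 2 = (n + 2) * (n + 1) := by
      rw [Nat.choose_two_right]
      exact Nat.div_mul_cancel (even_iff_two_dvd.1 (Nat.even_mul_pred_self _))
    have hpos : 0 < (n + 2).choose 2 := Nat.choose_pos (by omega)
    have hm3 : (m : ℤ) = 2 * ((n + 2).choose 2 : ℤ) - 1 := by omega
    have hc' : ((n + 2).choose 2 : ℤ) * 2 = (n + 2) * (n + 1) := by exact_mod_cast hc
    rw [hm3] at hm'
    simp [Finset.sum_range_succ] at hm'
    have h3 : (((n + 2 - 1 : ℕ)) : ℤ) = n + 1 := by push_cast [show n + 2 - 1 = n + 1 by omega]; ring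
    linear_combination 2 * hm' + (ebar 0 - 2) * hc'
  have k0 := key N le_rfl
  have k1 := key (N + 1) (by omega)
  have k2 := key (N + 2) (by omega)
  push_cast at k0 k1 k2
  have he0 : ebar 0 = 2 := by linarith
  rw [he0] at k0 k1
  linarith

lemma max_jac : (⊥ : Ideal (weirdRing k)).jacobson = maximalIdeal (weirdRing k) :=
  IsLocalRing.jacobson_eq_maximalIdeal _ bot_ne_top

lemma not_regular : ¬ IsRegularLocal (weirdRing k) := by
  rintro ⟨_, _, d, x, hd, hx⟩
  rw [dim_eq] at hd
  have hd2 : d = 2 := by exact_mod_cast hd.symm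
  subst hd2
  rw [max_jac] at hx
  let E : Fin 3 → (Fin 2 →₀ ℕ) :=
    ![Finsupp.single 0 1, Finsupp.single 0 1 + Finsupp.single 1 1, Finsupp.single 1 2]
  let φ : weirdRing k →ₗ[k] (Fin 3 → k) :=
    LinearMap.pi fun i => (coeff (E i)) ∘ₗ (weirdRing k).val.toLinearMap
  have hφ : ∀ f i, φ f i = coeff (E i) (f : S k) := fun f e => rfl
  have hE : ∀ i, 2 ≤ 2 * E i 0 + E i 1 ∧ 2 * E i 0 + E i 1 < 4 := by
    intro i; fin_cases i <;> simp [E]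
  have hEy : ∀ i, E i ≠ ey := by
    intro i h
    have := (hE i).1
    rw [h] at this; simp at this
  have hmul : ∀ (a f : weirdRing k), f ∈ maximalIdeal (weirdRing k) →
      φ (a * f) = coeff 0 (a : S k) • φ f := by
    intro a f hf
    set c := coeff 0 (a : S k) with hc
    have ha : a - algebraMap k _ c ∈ maximalIdeal (weirdRing k) := by
      rw [mem_max_iff]
      change coeff 0 ((a : S k) - C c) = 0
      rw [map_sub, ← hc]; simp
    rw [max_eq] at ha hf
    have h4 := J_mul_le 2 2 (Ideal.mul_mem_mul ha hf)
    have : φ ((a - algebraMap k _ c) * f) = 0 := by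
      ext i
      rw [hφ]
      exact le_ord_iff.1 h4 _ (hE i).2
    rw [sub_mul, map_sub, sub_eq_zero, ← Algebra.smul_def, map_smul] at this
    exact this
  have hspan : ∀ f ∈ maximalIdeal (weirdRing k), φ f ∈ Submodule.span k (Set.range fun i => φ (x i)) := by
    intro f hf
    rw [← hx] at hf
    induction hf using Submodule.closure_induction with
    | zero => simp
    | add f g _ _ h1 h2 => rw [map_add]; exact add_mem h1 h2
    | smul_mem a f hf =>
      rw [smul_eq_mul, hmul a f (by rw [← hx]; exact Ideal.subset_span hf)]
      obtain ⟨i, rfl⟩ := hf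
      exact Submodule.smul_mem _ _ (Submodule.subset_span ⟨i, rfl⟩)
  have htop : Submodule.span k (Set.range fun i => φ (x i)) = ⊤ := by
    classical
    rw [eq_top_iff]
    intro c _
    let f : S k := ∑ i, monomial (E i) (c i)
    have hE_inj : Function.Injective E := by
      intro i j hij
      have h0 := congrArg (fun e : Fin 2 →₀ ℕ => e 0) hij
      have h1 := congrArg (fun e : Fin 2 →₀ ℕ => e 1) hij
      fin_cases i <;> fin_cases j <;> simp [E] at h0 h1 ⊢
    have hcoef : ∀ e, coeff e f = ∑ i, if e = E i then c i else 0 := by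
      intro e
      simp [f, coeff_monomial]
    have hfm : f ∈ weirdRing k := by
      rw [mem_iff, hcoef]
      exact Finset.sum_eq_zero fun i _ => if_neg (Ne.symm (hEy i))
    have hf0 : (⟨f, hfm⟩ : weirdRing k) ∈ maximalIdeal (weirdRing k) := by
      rw [mem_max_iff]
      change coeff 0 f = 0
      rw [hcoef]
      refine Finset.sum_eq_zero fun i _ => if_neg ?_
      intro h
      have := (hE i).1
      rw [← h] at this; simp at this
    have hfc : φ ⟨f, hfm⟩ = c := by
      ext i
      rw [hφ]
      change coeff (E i) f = c i
      rw [hcoef]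
      simp [hE_inj.eq_iff]
    rw [← hfc]
    exact hspan _ hf0
  have := finrank_range_le_card (R := k) (fun i => φ (x i))
  rw [Set.finrank, htop, finrank_top] at this
  simp at this

open scoped Pointwise in
lemma not_depth_two {A : Type*} [CommRing A] (e : weirdRing k ≃+* A) : ¬ HasDepthGE A 2 := by
  rintro ⟨rs, hlen, hjac, hreg⟩
  obtain ⟨a, b, rfl⟩ := List.length_eq_two.1 hlen
  have hnt : Nontrivial A := e.injective.nontrivial
  have hmem : ∀ c ∈ (⊥ : Ideal A).jacobson, coeff 0 (e.symm c : S k) = 0 := by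
    intro c hc
    by_contra h
    rw [← ne_eq, ← isUnit_iff] at h
    have hu : IsUnit c := by simpa using h.map e
    have := Ideal.eq_top_of_isUnit_mem _ hc hu
    rw [Ideal.jacobson_eq_top_iff] at this
    exact bot_ne_top this
  have ha := hmem a (hjac a (by simp))
  have hb := hmem b (hjac b (by simp))
  have hw := hreg.toIsWeaklyRegular
  rw [RingTheory.Sequence.isWeaklyRegular_cons_iff, RingTheory.Sequence.isWeaklyRegular_cons_iff] at hw
  obtain ⟨h1, h2, _⟩ := hw
  let u : weirdRing k := ⟨(e.symm a : S k) * X 1, max_mul_mem _ ha _⟩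
  let v : weirdRing k := ⟨(e.symm b : S k) * X 1, max_mul_mem _ hb _⟩
  have huv : b * e u = a * e v := by
    apply e.symm.injective
    rw [map_mul, map_mul, e.symm_apply_apply, e.symm_apply_apply]
    apply Subtype.ext
    change (e.symm b : S k) * ((e.symm a : S k) * X 1) = (e.symm a : S k) * ((e.symm b : S k) * X 1)
    ring
  have hu : e u ∈ a • (⊤ : Submodule A A) := by
    rw [← Submodule.Quotient.mk_eq_zero]
    apply h2
    simp only [smul_zero]
    rw [← Submodule.Quotient.mk_smul, Submodule.Quotient.mk_eq_zero, smul_eq_mul, huv]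
    exact Submodule.smul_mem_pointwise_smul _ _ _ trivial
  obtain ⟨w, _, hw⟩ := hu
  have hw' : a * w = e u := hw
  have ha0 : (e.symm a : S k) ≠ 0 := by
    intro h0
    have ha0 : a = 0 := by
      apply e.symm.injective
      rw [map_zero]; exact Subtype.ext h0
    have := h1 (show a • (1 : A) = a • (0 : A) by simp [ha0])
    exact one_ne_zero this
  have h3 : (e.symm a : S k) * (e.symm w : S k) = (e.symm a : S k) * X 1 := by
    have := congrArg (fun t => (e.symm t : S k)) hw'
    simpa [u] using this
  have h4 := mul_left_cancel₀ ha0 h3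
  have h5 : coeff ey (e.symm w : S k) = 0 := (e.symm w).2
  rw [h4, coeff_ey_y] at h5
  exact one_ne_zero h5

lemma not_S2 : ¬ SerreS2 (weirdRing k) := by
  intro h
  let m := maximalIdeal (weirdRing k)
  let e : weirdRing k ≃+* Localization.AtPrime m :=
    (IsLocalization.atUnits (weirdRing k) m.primeCompl (S := Localization.AtPrime m) (by
      intro x hx
      exact IsLocalRing.notMem_maximalIdeal.1 hx)).toRingEquiv
  refine not_depth_two e (h m inferInstance 2 ?_)
  rw [← ringKrullDim_eq_of_ringEquiv e, dim_eq]
  simp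

lemma quot_equiv :
    Nonempty ((MvPowerSeries (Fin 2) k ⧸ Subalgebra.toSubmodule (weirdRing k)) ≃ₗ[k] k) := by
  have hk : Subalgebra.toSubmodule (weirdRing k) = LinearMap.ker (coeff (R := k) ey) := by
    ext f; rfl
  rw [hk]
  refine ⟨LinearMap.quotKerEquivOfSurjective _ ?_⟩
  intro c
  exact ⟨monomial ey c, by classical rw [coeff_monomial, if_pos rfl]⟩

end WR

set_option synthInstance.maxHeartbeats 2000000
set_option maxHeartbeats 2000000

/-- **Remark 3.6.** Let `k` be a field, `R = k[[x, xy, y², y³]]` and `Q = (x, y²) ⊆ R`.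
Then `ℓ(R/overline{Q^{n+1}}) = 2·binom(n+2,2) − 1` for all `n ≥ 0`; in particular
`ē₁(Q) = 0`, although `R` is a two-dimensional complete local domain which is neither
regular nor `S₂`, and `k[[x,y]]/R ≅ k`. -/
theorem stmt17 (k : Type u) [Field k] :
    IsLocalRing ↥(weirdRing k) ∧
    IsNoetherianRing ↥(weirdRing k) ∧
    IsDomain ↥(weirdRing k) ∧
    ringKrullDim ↥(weirdRing k) = (2 : WithBot ℕ∞) ∧
    IsAdicComplete ((⊥ : Ideal ↥(weirdRing k)).jacobson) ↥(weirdRing k) ∧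
    (∀ n : ℕ, ∀ J : Ideal ↥(weirdRing k),
      (J : Set ↥(weirdRing k)) =
        intClSet ↥(weirdRing k) (Ideal.span {weirdX k, weirdY2 k} ^ (n + 1)) →
      moduleLength ↥(weirdRing k) (↥(weirdRing k) ⧸ J) =
        ((2 * (n + 2).choose 2 - 1 : ℕ) : WithBot ℕ∞)) ∧
    (∀ (Jbar : ℕ → Ideal ↥(weirdRing k)) (ebar : ℕ → ℤ),
      (∀ n, (Jbar n : Set ↥(weirdRing k)) =
        intClSet ↥(weirdRing k) (Ideal.span {weirdX k, weirdY2 k} ^ n)) →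
      HasHilbertSeries ↥(weirdRing k) 2 Jbar ebar → ebar 1 = 0) ∧
    ¬ IsRegularLocal ↥(weirdRing k) ∧
    ¬ SerreS2 ↥(weirdRing k) ∧
    Nonempty ((MvPowerSeries (Fin 2) k ⧸ Subalgebra.toSubmodule (weirdRing k)) ≃ₗ[k] k) := by
  refine ⟨WR.isLocal, WR.noeth, WR.domain, WR.dim_eq, ?_, WR.length_eq', WR.e1_eq,
    WR.not_regular, WR.not_S2, WR.quot_equiv⟩
  rw [WR.max_jac]
  exact WR.complete
end
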